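/- Let n ≥ 2, p > 1, and let Ω ⊂ ℝⁿ be a strongly convex bounded open set with boundary of class C². Then there exists ν₀ > 0 such that for every ν ∈ (0, ν₀) there exists ε₁ > 0 with the property: for every ε ∈ (0, ε₁) and every normalized minimizer u_ε of the ε-regularized problem, the function log u_ε is concave on Ω_ν. -/

import Mathlib

open MeasureTheory Real Set Metric Bornology
open scoped RealInnerProductSpace Pointwise NNReal Topology

noncomputable def gaussianMeasure (n : ℕ) : Measure (EuclideanSpace ℝ (Fin n)) :=
  (volume : Measure (EuclideanSpace ℝ (Fin n))).withDensity
    (fun x => ENNReal.ofReal ((2 * π) ^ (-(n : ℝ) / 2) * Real.exp (-‖x‖ ^ 2 / 2)))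

/-- `φ` is a smooth compactly supported test function on `Ω`. -/
def IsTestFun (n : ℕ) (Ω : Set (EuclideanSpace ℝ (Fin n)))
    (φ : EuclideanSpace ℝ (Fin n) → ℝ) : Prop :=
  ContDiff ℝ (⊤ : ℕ∞) φ ∧ HasCompactSupport φ ∧ tsupport φ ⊆ Ω

/-- The first eigenvalue of the Gaussian-weighted `p`-Laplacian on `Ω`. -/
noncomputable def lambdaPGamma (n : ℕ) (p : ℝ) (Ω : Set (EuclideanSpace ℝ (Fin n))) : ℝ :=
  sInf { r : ℝ | ∃ v : EuclideanSpace ℝ (Fin n) → ℝ, IsTestFun n Ω v ∧ v ≠ 0 ∧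
    r = (∫ x in Ω, ‖gradient v x‖ ^ p ∂(gaussianMeasure n)) /
        (∫ x in Ω, |v x| ^ p ∂(gaussianMeasure n)) }

/-- `Ω` has boundary of class `C²`. -/
def HasC2Boundary (n : ℕ) (Ω : Set (EuclideanSpace ℝ (Fin n))) : Prop :=
  ∀ x ∈ frontier Ω, ∃ (U : Set (EuclideanSpace ℝ (Fin n))) (f : EuclideanSpace ℝ (Fin n) → ℝ),
    IsOpen U ∧ x ∈ U ∧ ContDiff ℝ 2 f ∧ (∀ y ∈ U, (y ∈ Ω ↔ f y < 0)) ∧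
    (∀ y ∈ U, y ∈ frontier Ω → fderiv ℝ f y ≠ 0)

/-- The regularized functional `J_ε(v) = ∫_Ω (ε v² + ‖∇v‖²)^{p/2} dγ`. -/
noncomputable def Jeps (n : ℕ) (p ε : ℝ) (Ω : Set (EuclideanSpace ℝ (Fin n)))
    (v : EuclideanSpace ℝ (Fin n) → ℝ) : ℝ :=
  ∫ x in Ω, (ε * v x ^ 2 + ‖gradient v x‖ ^ 2) ^ (p / 2) ∂(gaussianMeasure n)

/-- The infimum of the regularized functional over normalized test functions. -/
noncomputable def lambdaEps (n : ℕ) (p ε : ℝ) (Ω : Set (EuclideanSpace ℝ (Fin n))) : ℝ :=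
  sInf { r : ℝ | ∃ v : EuclideanSpace ℝ (Fin n) → ℝ, IsTestFun n Ω v ∧
    (∫ x in Ω, |v x| ^ p ∂(gaussianMeasure n)) = 1 ∧ r = Jeps n p ε Ω v }

/-- A normalized minimizer of the `ε`-regularized problem. -/
def IsNormalizedMinimizer (n : ℕ) (p ε : ℝ) (Ω : Set (EuclideanSpace ℝ (Fin n)))
    (uε : EuclideanSpace ℝ (Fin n) → ℝ) : Prop :=
  ContinuousOn uε (closure Ω) ∧ ContDiffOn ℝ 1 uε Ω ∧
  (∀ x ∈ closure Ω, 0 ≤ uε x) ∧ (∀ x ∈ frontier Ω, uε x = 0) ∧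
  (∫ x in Ω, uε x ^ p ∂(gaussianMeasure n)) = 1 ∧
  Jeps n p ε Ω uε = lambdaEps n p ε Ω

abbrev EE (n : ℕ) := EuclideanSpace ℝ (Fin n)
notation:max "BB" n:max => closedBall (0 : EE n)
notation:max "LG" u:max => fun y => Real.log (u y)
noncomputable def rho (n : ℕ) (x : EE n) : ℝ := (2 * π) ^ (-(n : ℝ) / 2) * Real.exp (-‖x‖ ^ 2 / 2)
lemma rho_pos (n : ℕ) (x : EE n) : 0 < rho n x := by unfold rho; positivity
lemma rho_contDiff (n : ℕ) : ContDiff ℝ 1 (rho n) := by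
  unfold rho
  have : ContDiff ℝ 1 (fun x : EE n => ‖x‖ ^ 2) := contDiff_norm_sq ℝ
  fun_prop
lemma rho_cont (n : ℕ) : Continuous (rho n) := (rho_contDiff n).continuous
lemma rho_fderiv (n : ℕ) (x : EE n) : HasFDerivAt (rho n) (-(rho n x) • innerSL ℝ x) x := by
  unfold rho
  have h1 : HasFDerivAt (fun x : EE n => ‖x‖ ^ 2) (2 • innerSL ℝ x) x := (hasStrictFDerivAt_norm_sq x).hasFDerivAt
  have h2 := (((h1.neg).mul_const ((2:ℝ)⁻¹)).exp).const_mul ((2 * π) ^ (-(n : ℝ) / 2))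
  have h3 : (fun x : EE n => (2 * π) ^ (-(n : ℝ) / 2) * Real.exp (-‖x‖ ^ 2 / 2)) = fun y => (2 * π) ^ (-(n:ℝ) / 2) * rexp ((-fun x : EE n => ‖x‖ ^ 2) y * 2⁻¹) := by funext y; simp [div_eq_mul_inv]
  rw [h3]
  refine h2.congr_fderiv ?_
  ext v
  simp
  rw [show -‖x‖ ^ 2 / 2 = -(‖x‖ ^ 2 * 2⁻¹) by ring]; ring
lemma rho_gradient (n : ℕ) (x : EE n) : gradient (rho n) x = -(rho n x) • x := by
  apply ext_inner_right ℝ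
  intro v
  rw [inner_gradient_left, (rho_fderiv n x).fderiv]
  simp [inner_smul_left]
lemma integral_gauss (n : ℕ) {S : Set (EE n)} (hS : MeasurableSet S) (f : EE n → ℝ) : ∫ x in S, f x ∂(gaussianMeasure n) = ∫ x in S, f x * rho n x := by
  unfold gaussianMeasure
  rw [restrict_withDensity hS, integral_withDensity_eq_integral_toReal_smul₀]
  · refine integral_congr_ae (Filter.Eventually.of_forall fun x => ?_)
    have := (rho_pos n x).le
    simp only [smul_eq_mul]
    rw [ENNReal.toReal_ofReal (by exact this), mul_comm]; rfl
  · exact (ENNReal.measurable_ofReal.comp (rho_cont n).measurable).aemeasurable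
  · exact Filter.Eventually.of_forall fun x => ENNReal.ofReal_lt_top
noncomputable def jd {n : ℕ} (ε p : ℝ) (v : EE n → ℝ) (x : EE n) : ℝ := (ε * v x ^ 2 + ‖gradient v x‖ ^ 2) ^ (p / 2)
lemma norm_gradient {n : ℕ} (v : EE n → ℝ) (x : EE n) : ‖gradient v x‖ = ‖fderiv ℝ v x‖ := by unfold gradient; simp
lemma gradient_cont {n : ℕ} {v : EE n → ℝ} (hv : ContDiff ℝ 1 v) : Continuous (gradient v) := by
  unfold gradient
  exact (LinearIsometryEquiv.continuous _).comp (hv.continuous_fderiv one_ne_zero)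
lemma gradient_contOn {n : ℕ} {v : EE n → ℝ} {U : Set (EE n)} (hU : IsOpen U) (hv : ContDiffOn ℝ 1 v U) : ContinuousOn (gradient v) U := by
  unfold gradient
  exact (LinearIsometryEquiv.continuous _).comp_continuousOn (hv.continuousOn_fderiv_of_isOpen hU le_rfl)
lemma gradient_zero_of_notMem {n : ℕ} {v : EE n → ℝ} {x : EE n} (h : x ∉ tsupport v) : gradient v x = 0 := by
  have := fderiv_of_notMem_tsupport (𝕜 := ℝ) h
  unfold gradient; rw [this]; simp
lemma contDiff_of_tsup {n : ℕ} {v : EE n → ℝ} (h : ∀ x ∈ tsupport v, ContDiffAt ℝ 1 v x) : ContDiff ℝ 1 v := by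
  rw [contDiff_iff_contDiffAt]
  intro x
  by_cases hx : x ∈ tsupport v
  · exact h x hx
  · exact contDiffAt_const.congr_of_eventuallyEq (notMem_tsupport_iff_eventuallyEq.mp hx)
lemma posSq_hasDerivAt (s : ℝ) : HasDerivAt (fun s : ℝ => (max s 0) ^ 2) (2 * max s 0) s := by
  rcases lt_trichotomy s 0 with h | h | h
  · rw [max_eq_right h.le, mul_zero]
    refine (hasDerivAt_const s (0:ℝ)).congr_of_eventuallyEq ?_
    filter_upwards [gt_mem_nhds h] with t ht
    simp [max_eq_right (le_of_lt ht)]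
  · subst h
    rw [hasDerivAt_iff_isLittleO_nhds_zero]
    simp only [zero_add, max_self, mul_zero, smul_zero, sub_zero, ne_eq, OfNat.ofNat_ne_zero, not_false_eq_true, zero_pow]
    refine Asymptotics.IsBigO.trans_isLittleO (g := fun h : ℝ => h ^ 2) ?_ ?_
    · refine Asymptotics.IsBigO.of_bound 1 (Filter.Eventually.of_forall fun t => ?_)
      simp only [Real.norm_eq_abs, abs_pow, one_mul, sq_abs]
      rcases le_total t 0 with h | h
      · simp [max_eq_right h]; positivity
      · simp [max_eq_left h]
    · exact Asymptotics.isLittleO_pow_id (by norm_num)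
  · rw [max_eq_left h.le]
    have := hasDerivAt_pow 2 s
    simp only [Nat.cast_ofNat, Nat.add_one_sub_one, pow_one] at this
    refine this.congr_of_eventuallyEq ?_
    filter_upwards [lt_mem_nhds h] with t ht
    simp [max_eq_left (le_of_lt ht)]
lemma posSq_contDiff : ContDiff ℝ 1 (fun s : ℝ => (max s 0) ^ 2) := by
  rw [contDiff_one_iff_deriv]
  refine ⟨fun s => (posSq_hasDerivAt s).differentiableAt, ?_⟩
  have : deriv (fun s : ℝ => (max s 0) ^ 2) = fun s => 2 * max s 0 := funext fun s => (posSq_hasDerivAt s).deriv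
  rw [this]; fun_prop
lemma hasDerivAt_integral_compact {n : ℕ} {K : Set (EE n)} (hK : IsCompact K) {F F' : ℝ → EE n → ℝ} {t₀ δ : ℝ} (hδ : 0 < δ) (hF : ∀ t ∈ Icc (t₀ - δ) (t₀ + δ), ContinuousOn (F t) K) (hF' : ContinuousOn (Function.uncurry F') (Icc (t₀ - δ) (t₀ + δ) ×ˢ K)) (hd : ∀ t ∈ Ioo (t₀ - δ) (t₀ + δ), ∀ x ∈ K, HasDerivAt (fun t => F t x) (F' t x) t) : HasDerivAt (fun t => ∫ x in K, F t x) (∫ x in K, F' t₀ x) t₀ := by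
  have hc : IsCompact (Icc (t₀ - δ) (t₀ + δ) ×ˢ K) := isCompact_Icc.prod hK
  obtain ⟨C, hC⟩ := hc.exists_bound_of_continuousOn hF'
  have hs : Ioo (t₀ - δ) (t₀ + δ) ∈ 𝓝 t₀ := Ioo_mem_nhds (by linarith) (by linarith)
  have h0 : t₀ ∈ Icc (t₀ - δ) (t₀ + δ) := ⟨by linarith, by linarith⟩
  refine (hasDerivAt_integral_of_dominated_loc_of_deriv_le (bound := fun _ => C) hs ?_ ?_ ?_ ?_ ?_ ?_).2
  · filter_upwards [hs] with t ht
    exact (hF t (Ioo_subset_Icc_self ht)).aestronglyMeasurable hK.measurableSet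
  · exact (hF t₀ h0).integrableOn_compact hK
  · have : ContinuousOn (F' t₀) K := by
      have := hF'.comp (f := fun x => (t₀, x)) (s := K) (by fun_prop) (fun x hx => ⟨h0, hx⟩)
      exact this
    exact this.aestronglyMeasurable hK.measurableSet
  · filter_upwards [ae_restrict_mem hK.measurableSet] with x hx t ht
    exact hC (t, x) ⟨Ioo_subset_Icc_self ht, hx⟩
  · exact (continuousOn_const).integrableOn_compact hK
  · filter_upwards [ae_restrict_mem hK.measurableSet] with x hx t ht
    exact hd t ht x hx
lemma jd_nonneg {n : ℕ} {ε : ℝ} (hε : 0 < ε) (p : ℝ) (v : EE n → ℝ) (x : EE n) : 0 ≤ jd ε p v x := by unfold jd; positivity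
lemma gradient_const_mul {n : ℕ} (c : ℝ) {v : EE n → ℝ} {x : EE n} (h : DifferentiableAt ℝ v x) : gradient (fun x => c * v x) x = c • gradient v x := by
  apply ext_inner_right ℝ
  intro y
  rw [inner_gradient_left, inner_smul_left, inner_gradient_left, fderiv_const_mul h]
  simp
lemma jd_const_mul {n : ℕ} {ε : ℝ} (hε : 0 < ε) (p : ℝ) {c : ℝ} (hc : 0 ≤ c) {v : EE n → ℝ} {x : EE n} (h : DifferentiableAt ℝ v x) : jd ε p (fun x => c * v x) x = c ^ p * jd ε p v x := by
  unfold jd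
  rw [gradient_const_mul c h, norm_smul, mul_pow, mul_pow, Real.norm_eq_abs, sq_abs, show ε * (c ^ 2 * v x ^ 2) + c ^ 2 * ‖gradient v x‖ ^ 2 = c ^ 2 * (ε * v x ^ 2 + ‖gradient v x‖ ^ 2) by ring,
    Real.mul_rpow (by positivity) (by positivity), ← Real.rpow_natCast, ← Real.rpow_mul hc]
  congr 2; push_cast; ring
lemma lam_bdd {n : ℕ} {p ε : ℝ} (hε : 0 < ε) (Ω : Set (EE n)) : BddBelow { r : ℝ | ∃ v : EE n → ℝ, IsTestFun n Ω v ∧ (∫ x in Ω, |v x| ^ p ∂(gaussianMeasure n)) = 1 ∧ r = Jeps n p ε Ω v } := by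
  refine ⟨0, ?_⟩
  rintro r ⟨v, -, -, rfl⟩
  exact integral_nonneg fun x => jd_nonneg hε p v x
lemma lam_test {n : ℕ} {p ε : ℝ} (hp : 1 < p) (hε : 0 < ε) {Ω : Set (EE n)} {v : EE n → ℝ} (hv : IsTestFun n Ω v) : lambdaEps n p ε Ω * ∫ x in Ω, |v x| ^ p ∂(gaussianMeasure n) ≤ Jeps n p ε Ω v := by
  set I := ∫ x in Ω, |v x| ^ p ∂(gaussianMeasure n) with hI
  have hI0 : 0 ≤ I := integral_nonneg fun x => by positivity
  have hJ0 : 0 ≤ Jeps n p ε Ω v := integral_nonneg fun x => jd_nonneg hε p v x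
  rcases hI0.eq_or_lt with h | h
  · rw [← h, mul_zero]; exact hJ0
  have hdiff : Differentiable ℝ v := hv.1.differentiable (by simp)
  set c := I ^ (-(1 / p)) with hc
  have hcpos : 0 < c := by positivity
  have hcp : c ^ p = I⁻¹ := by rw [hc, ← Real.rpow_mul hI0, ← Real.rpow_neg_one]; congr 1; field_simp
  have htest : IsTestFun n Ω (fun x => c * v x) := by
    refine ⟨contDiff_const.mul hv.1, hv.2.1.mul_left, ?_⟩
    exact (tsupport_mul_subset_right (f := fun _ => c) (g := v)).trans hv.2.2
  have h1 : (∫ x in Ω, |c * v x| ^ p ∂(gaussianMeasure n)) = 1 := by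
    have : ∀ x, |c * v x| ^ p = c ^ p * |v x| ^ p := fun x => by rw [abs_mul, abs_of_pos hcpos, Real.mul_rpow hcpos.le (abs_nonneg _)]
    simp_rw [this]
    rw [integral_const_mul, hcp, ← hI]; field_simp
  have h2 : Jeps n p ε Ω (fun x => c * v x) = c ^ p * Jeps n p ε Ω v := by
    unfold Jeps
    rw [← integral_const_mul]
    refine integral_congr_ae (Filter.Eventually.of_forall fun x => ?_)
    exact jd_const_mul hε p hcpos.le (hdiff x)
  have h3 : lambdaEps n p ε Ω ≤ c ^ p * Jeps n p ε Ω v := csInf_le (lam_bdd hε Ω) ⟨_, htest, h1, h2.symm⟩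
  rw [hcp] at h3
  calc lambdaEps n p ε Ω * I ≤ (I⁻¹ * Jeps n p ε Ω v) * I := by gcongr
    _ = _ := by field_simp
lemma lam_test' {n : ℕ} {p ε : ℝ} (hp : 1 < p) (hε : 0 < ε) {Ω : Set (EE n)} (hΩ : IsOpen Ω) {v : EE n → ℝ} (hv : IsTestFun n Ω v) : lambdaEps n p ε Ω * ∫ x, |v x| ^ p * rho n x ≤ ∫ x, jd ε p v x * rho n x := by
  have h := lam_test hp hε hv
  unfold Jeps at h
  rw [integral_gauss n hΩ.measurableSet, integral_gauss n hΩ.measurableSet, setIntegral_eq_integral_of_forall_compl_eq_zero, setIntegral_eq_integral_of_forall_compl_eq_zero] at h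
  · exact h
  · intro x hx
    have hx' : x ∉ tsupport v := fun h => hx (hv.2.2 h)
    rw [gradient_zero_of_notMem hx', image_eq_zero_of_notMem_tsupport hx']
    simp [Real.zero_rpow (show p / 2 ≠ 0 by positivity)]
  · intro x hx
    have hx' : x ∉ tsupport v := fun h => hx (hv.2.2 h)
    rw [image_eq_zero_of_notMem_tsupport hx']
    simp [Real.zero_rpow (show p ≠ 0 by positivity)]
lemma lam_C1 {n : ℕ} {p ε : ℝ} (hp : 1 < p) (hε : 0 < ε) {Ω : Set (EE n)} (hΩ : IsOpen Ω) {v : EE n → ℝ} (hv : ContDiff ℝ 1 v) (hvc : HasCompactSupport v) (hvs : tsupport v ⊆ Ω) : lambdaEps n p ε Ω * ∫ x, |v x| ^ p * rho n x ≤ ∫ x, jd ε p v x * rho n x := by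
  obtain ⟨δ, hδ, hδs⟩ := hvc.isCompact.exists_cthickening_subset_open hΩ hvs
  set K := cthickening δ (tsupport v) with hK
  have hKc : IsCompact K := hvc.isCompact.cthickening
  let φ : ℕ → ContDiffBump (0 : EE n) := fun k => ⟨δ / (k + 2) / 2, δ / (k + 2), by positivity, by
      have : 0 < δ / ((k:ℝ) + 2) := by positivity
      linarith⟩
  let V : ℕ → EE n → ℝ := fun k => MeasureTheory.convolution ((φ k).normed volume) v (ContinuousLinearMap.lsmul ℝ ℝ) volume
  let dv := fderiv ℝ v
  have hdvc : Continuous dv := hv.continuous_fderiv one_ne_zero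
  have hdvcs : HasCompactSupport dv := hvc.fderiv ℝ
  let W : ℕ → EE n → (EE n →L[ℝ] ℝ) := fun k => MeasureTheory.convolution ((φ k).normed volume) dv (ContinuousLinearMap.lsmul ℝ ℝ) volume
  have hr : Filter.Tendsto (fun k => (φ k).rOut) Filter.atTop (𝓝 0) := by
    have : Filter.Tendsto (fun k : ℕ => δ / ((k:ℝ) + 2)) Filter.atTop (𝓝 0) := Filter.Tendsto.div_atTop tendsto_const_nhds (Filter.tendsto_atTop_add_const_right _ _ tendsto_natCast_atTop_atTop)
    exact this
  have hVder : ∀ k x, fderiv ℝ (V k) x = W k x := by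
    intro k x
    have h1 := hvc.hasFDerivAt_convolution_right (ContinuousLinearMap.lsmul ℝ ℝ) ((φ k).continuous_normed (μ := volume)).locallyIntegrable hv x (μ := volume)
    rw [h1.fderiv]
    unfold W MeasureTheory.convolution
    refine integral_congr_ae (Filter.Eventually.of_forall fun t => ?_)
    ext z
    simp [ContinuousLinearMap.precompR, dv]
  have hVt : ∀ x, Filter.Tendsto (fun k => V k x) Filter.atTop (𝓝 (v x)) := fun x => ContDiffBump.convolution_tendsto_right_of_continuous hr hv.continuous x
  have hWt : ∀ x, Filter.Tendsto (fun k => W k x) Filter.atTop (𝓝 (dv x)) := fun x => ContDiffBump.convolution_tendsto_right_of_continuous hr hdvc x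
  obtain ⟨Cv, hCv⟩ := hv.continuous.bounded_above_of_compact_support hvc
  obtain ⟨Cd, hCd⟩ := hdvc.bounded_above_of_compact_support hdvcs
  have hVb : ∀ k x, |V k x| ≤ 3 * Cv := by
    intro k x
    have := (φ k).dist_normed_convolution_le (μ := volume) (x₀ := x) (ε := 2 * Cv) hv.continuous.aestronglyMeasurable (fun y _ => by
        rw [dist_eq_norm]
        calc ‖v y - v x‖ ≤ ‖v y‖ + ‖v x‖ := norm_sub_le _ _
          _ ≤ 2 * Cv := by linarith [hCv y, hCv x])
    rw [dist_eq_norm] at this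
    have h2 : ‖V k x‖ ≤ ‖V k x - v x‖ + ‖v x‖ := by simpa using norm_add_le (V k x - v x) (v x)
    have := hCv x
    rw [← Real.norm_eq_abs]; linarith
  have hWb : ∀ k x, ‖W k x‖ ≤ 3 * Cd := by
    intro k x
    have := (φ k).dist_normed_convolution_le (μ := volume) (x₀ := x) (ε := 2 * Cd) hdvc.aestronglyMeasurable (fun y _ => by
        rw [dist_eq_norm]
        calc ‖dv y - dv x‖ ≤ ‖dv y‖ + ‖dv x‖ := norm_sub_le _ _
          _ ≤ 2 * Cd := by linarith [hCd y, hCd x])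
    rw [dist_eq_norm] at this
    have h2 : ‖W k x‖ ≤ ‖W k x - dv x‖ + ‖dv x‖ := by simpa using norm_add_le (W k x - dv x) (dv x)
    have := hCd x
    linarith
  have hVs : ∀ k, ContDiff ℝ (⊤ : ℕ∞) (V k) := fun k => (φ k).hasCompactSupport_normed.contDiff_convolution_left _ (φ k).contDiff_normed hv.continuous.locallyIntegrable
  have hVsup : ∀ k, tsupport (V k) ⊆ K := by
    intro k
    refine closure_minimal ?_ isClosed_cthickening
    intro x hx
    have := support_convolution_subset (ContinuousLinearMap.lsmul ℝ ℝ) hx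
    obtain ⟨a, ha, b, hb, rfl⟩ := this
    rw [(φ k).support_normed_eq] at ha
    refine mem_cthickening_of_dist_le (a + b) b δ _ (subset_tsupport _ hb) ?_
    rw [dist_eq_norm]
    simp only [add_sub_cancel_right]
    have h1 : ‖a‖ < δ / (k + 2) := by simpa using ha
    refine h1.le.trans (div_le_self hδ.le ?_)
    have : (0:ℝ) ≤ k := by positivity
    linarith
  have htest : ∀ k, IsTestFun n Ω (V k) := fun k => ⟨hVs k, hKc.of_isClosed_subset (isClosed_tsupport _) (hVsup k), (hVsup k).trans hδs⟩
  have hKs : tsupport v ⊆ K := self_subset_cthickening _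
  have hbint : ∀ C : ℝ, Integrable (K.indicator (fun x => C * rho n x)) := fun C => (integrable_indicator_iff hKc.measurableSet).2 ((continuous_const.mul (rho_cont n)).continuousOn.integrableOn_compact hKc)
  have hp2 : 0 < p / 2 := by linarith
  have hjc : ∀ f : EE n → ℝ, ContDiff ℝ 1 f → Continuous (jd ε p f) := by
    intro f hf
    unfold jd
    have h1 := gradient_cont hf
    have h2 := hf.continuous
    exact Continuous.rpow_const (by fun_prop) (fun x => Or.inr hp2.le)
  have hV1 : ∀ k, ContDiff ℝ 1 (V k) := fun k => (hVs k).of_le (by simp)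
  have hL : Filter.Tendsto (fun k => ∫ x, |V k x| ^ p * rho n x) Filter.atTop (𝓝 (∫ x, |v x| ^ p * rho n x)) := by
    refine tendsto_integral_of_dominated_convergence (K.indicator (fun x => (3 * Cv) ^ p * rho n x)) ?_ (hbint _) ?_ ?_
    · intro k
      have := (hV1 k).continuous
      exact (Continuous.mul (Continuous.rpow_const (by fun_prop) (fun x => Or.inr (by linarith))) (rho_cont n)).aestronglyMeasurable
    · intro k
      refine Filter.Eventually.of_forall fun x => ?_
      by_cases hx : x ∈ K
      · rw [indicator_of_mem hx, Real.norm_eq_abs, abs_of_nonneg (mul_nonneg (by positivity) (rho_pos n x).le)]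
        have := rho_pos n x
        gcongr
        exact hVb k x
      · rw [indicator_of_notMem hx, image_eq_zero_of_notMem_tsupport (fun h => hx (hVsup k h))]
        simp [Real.zero_rpow (show p ≠ 0 by positivity)]
    · refine Filter.Eventually.of_forall fun x => ?_
      refine Filter.Tendsto.mul_const _ ?_
      exact ((hVt x).abs).rpow_const (Or.inr (by linarith))
  have hR : Filter.Tendsto (fun k => ∫ x, jd ε p (V k) x * rho n x) Filter.atTop (𝓝 (∫ x, jd ε p v x * rho n x)) := by
    refine tendsto_integral_of_dominated_convergence (K.indicator (fun x => (ε * (3 * Cv) ^ 2 + (3 * Cd) ^ 2) ^ (p / 2) * rho n x)) ?_ (hbint _) ?_ ?_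
    · intro k
      exact ((hjc _ (hV1 k)).mul (rho_cont n)).aestronglyMeasurable
    · intro k
      refine Filter.Eventually.of_forall fun x => ?_
      by_cases hx : x ∈ K
      · rw [indicator_of_mem hx, Real.norm_eq_abs, abs_of_nonneg (mul_nonneg (jd_nonneg hε _ _ _) (rho_pos n x).le)]
        have := rho_pos n x
        unfold jd
        rw [norm_gradient, hVder, ← sq_abs (V k x)]
        have h1 := hVb k x
        have h2 := hWb k x
        gcongr
      · have hx' : x ∉ tsupport (V k) := fun h => hx (hVsup k h)
        rw [indicator_of_notMem hx]
        unfold jd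
        rw [image_eq_zero_of_notMem_tsupport hx', gradient_zero_of_notMem hx']
        simp [Real.zero_rpow hp2.ne']
    · refine Filter.Eventually.of_forall fun x => ?_
      refine Filter.Tendsto.mul_const _ ?_
      unfold jd
      simp_rw [norm_gradient, hVder]
      refine Filter.Tendsto.rpow_const ?_ (Or.inr hp2.le)
      exact (((hVt x).pow 2).const_mul ε).add ((hWt x).norm.pow 2)
  exact le_of_tendsto_of_tendsto' (hL.const_mul _) hR (fun k => lam_test' hp hε hΩ (htest k))
noncomputable def chi (δ s : ℝ) : ℝ := (max (s - δ) 0) ^ 2 / s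
lemma chi_hasDerivAt (δ : ℝ) {s : ℝ} (hs : 0 < s) : HasDerivAt (chi δ) (2 * (max (s - δ) 0 / s) - (max (s - δ) 0 / s) ^ 2) s := by
  have h1 := (posSq_hasDerivAt (s - δ)).comp s ((hasDerivAt_id s).sub_const δ)
  have h2 := h1.div (hasDerivAt_id s) hs.ne'
  refine h2.congr_deriv ?_
  simp only [Function.comp_def, id]
  field_simp
lemma chi_contDiffAt (δ : ℝ) {s : ℝ} (hs : 0 < s) : ContDiffAt ℝ 1 (chi δ) s := by
  unfold chi
  refine ContDiffAt.div ?_ contDiffAt_id hs.ne'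
  exact (posSq_contDiff.comp (contDiff_id.sub contDiff_const)).contDiffAt
lemma chi_zero {δ s : ℝ} (hs : s ≤ δ) : chi δ s = 0 := by unfold chi; rw [max_eq_right (by linarith)]; simp
lemma chi_nonneg {δ s : ℝ} (hs : 0 ≤ s) : 0 ≤ chi δ s := by unfold chi; positivity
lemma chi_le {δ s : ℝ} (hδ : 0 ≤ δ) (hs : 0 ≤ s) : chi δ s ≤ s := by
  unfold chi
  rcases hs.eq_or_lt with h | h
  · rw [← h]; simp
  rw [div_le_iff₀ h, ← sq]
  gcongr
  exact max_le (by linarith) hs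
lemma chi_ge {δ s : ℝ} (hδ : 0 ≤ δ) (hs : 0 ≤ s) : s - 2 * δ ≤ chi δ s := by
  unfold chi
  rcases hs.eq_or_lt with h | h
  · rw [← h]; simp; linarith
  rw [le_div_iff₀ h]
  rcases le_total (s - δ) 0 with h1 | h1
  · rw [max_eq_right h1]; nlinarith
  · rw [max_eq_left h1]; nlinarith [sq_nonneg δ]
lemma chi_deriv_bd {δ s : ℝ} (hδ : 0 ≤ δ) (hs : 0 < s) : (2 * (max (s - δ) 0 / s) - (max (s - δ) 0 / s) ^ 2) ^ 2 ≤ 1 := by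
  have h0 : 0 ≤ max (s - δ) 0 / s := by positivity
  have h1 : max (s - δ) 0 / s ≤ 1 := by rw [div_le_one hs]; exact max_le (by linarith) hs.le
  set t := max (s - δ) 0 / s
  have : 0 ≤ 2 * t - t ^ 2 := by nlinarith
  have : 2 * t - t ^ 2 ≤ 1 := by nlinarith [sq_nonneg (t - 1)]
  nlinarith
lemma hasCompactSupport_of_zero_off {n : ℕ} {Ω : Set (EE n)} (hΩb : IsBounded Ω) {v : EE n → ℝ} (hvΩ : ∀ x ∉ Ω, v x = 0) : HasCompactSupport v := HasCompactSupport.intro hΩb.isCompact_closure fun x hx => hvΩ x fun h => hx (subset_closure h)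
lemma gradient_comp {n : ℕ} {f : ℝ → ℝ} {v : EE n → ℝ} {x : EE n} {f' : ℝ} (hf : HasDerivAt f f' (v x)) (hv : DifferentiableAt ℝ v x) : gradient (fun x => f (v x)) x = f' • gradient v x := by
  apply ext_inner_right ℝ
  intro y
  have := (hf.comp_hasFDerivAt x hv.hasFDerivAt).fderiv
  rw [inner_gradient_left, inner_smul_left, inner_gradient_left, show (fun x => f (v x)) = f ∘ v from rfl, this]
  simp
lemma min_ineq {n : ℕ} {p ε : ℝ} (hp : 1 < p) (hε : 0 < ε) {Ω : Set (EE n)} (hΩ : IsOpen Ω) (hΩb : IsBounded Ω) {v : EE n → ℝ} (hvc : Continuous v) (hv0 : ∀ x, 0 ≤ v x) (hvΩ : ∀ x ∉ Ω, v x = 0) (hv1 : ContDiffOn ℝ 1 v {x | 0 < v x}) (hint : IntegrableOn (fun x => jd ε p v x * rho n x) {x | 0 < v x}) : lambdaEps n p ε Ω * ∫ x, v x ^ p * rho n x ≤ ∫ x in {x | 0 < v x}, jd ε p v x * rho n x := by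
  have hU : IsOpen {x | 0 < v x} := isOpen_lt continuous_const hvc
  have hcs : HasCompactSupport v := hasCompactSupport_of_zero_off hΩb hvΩ
  have hp2 : 0 < p / 2 := by linarith
  let d : ℕ → ℝ := fun k => 1 / ((k:ℝ) + 1)
  have hd : ∀ k, 0 < d k := fun k => by positivity
  have hdt : Filter.Tendsto d Filter.atTop (𝓝 0) := tendsto_one_div_add_atTop_nhds_zero_nat
  let V : ℕ → EE n → ℝ := fun k x => chi (d k) (v x)
  have hVsub : ∀ k, tsupport (V k) ⊆ {x | d k ≤ v x} := by
    intro k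
    refine closure_minimal ?_ (isClosed_le continuous_const hvc)
    intro x hx
    by_contra h
    exact hx (chi_zero (not_le.mp h).le)
  have hVpos : ∀ k, tsupport (V k) ⊆ {x | 0 < v x} := fun k x hx => lt_of_lt_of_le (hd k) (hVsub k hx)
  have hVC : ∀ k, ContDiff ℝ 1 (V k) := by
    intro k
    refine contDiff_of_tsup fun x hx => ?_
    have hx := hVpos k hx
    exact (chi_contDiffAt (d k) hx).comp x (hv1.contDiffAt (hU.mem_nhds hx))
  have hVcs : ∀ k, HasCompactSupport (V k) := fun k => hasCompactSupport_of_zero_off hΩb fun x hx => by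
      change chi (d k) (v x) = 0
      rw [hvΩ x hx]; exact chi_zero (hd k).le
  have hVΩ : ∀ k, tsupport (V k) ⊆ Ω := by
    intro k x hx
    by_contra h
    have := hVpos k hx
    simp [hvΩ x h] at this
  have hkey : ∀ k, lambdaEps n p ε Ω * ∫ x, V k x ^ p * rho n x ≤ ∫ x in {x | 0 < v x}, jd ε p v x * rho n x := by
    intro k
    have h1 := lam_C1 hp hε hΩ (hVC k) (hVcs k) (hVΩ k)
    have h2 : ∀ x, |V k x| = V k x := fun x => abs_of_nonneg (chi_nonneg (hv0 x))
    simp_rw [h2] at h1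
    refine h1.trans ?_
    have hz : ∀ x ∉ {x | 0 < v x}, jd ε p (V k) x * rho n x = 0 := by
      intro x hx
      have hx' : x ∉ tsupport (V k) := fun h => hx (hVpos k h)
      unfold jd
      rw [image_eq_zero_of_notMem_tsupport hx', gradient_zero_of_notMem hx']
      simp [Real.zero_rpow hp2.ne']
    rw [← setIntegral_eq_integral_of_forall_compl_eq_zero hz]
    refine integral_mono_of_nonneg (Filter.Eventually.of_forall fun x => mul_nonneg (jd_nonneg hε _ _ _) (rho_pos n x).le) hint ?_
    refine (ae_restrict_iff' hU.measurableSet).2 (Filter.Eventually.of_forall fun x hx => ?_)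
    have hx0 : 0 < v x := hx
    have hg := gradient_comp (chi_hasDerivAt (d k) hx0) ((hv1.contDiffAt (hU.mem_nhds hx)).differentiableAt one_ne_zero)
    have hr := (rho_pos n x).le
    change jd ε p (V k) x * rho n x ≤ jd ε p v x * rho n x
    refine mul_le_mul_of_nonneg_right ?_ hr
    unfold jd
    refine Real.rpow_le_rpow (by positivity) ?_ hp2.le
    change ε * (chi (d k) (v x)) ^ 2 + ‖gradient (fun x => chi (d k) (v x)) x‖ ^ 2 ≤ _
    rw [hg, norm_smul, mul_pow, Real.norm_eq_abs, sq_abs]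
    have h3 := chi_deriv_bd (hd k).le hx0
    have h4 := chi_le (hd k).le hx0.le
    have h5 : 0 ≤ chi (d k) (v x) := chi_nonneg hx0.le
    have h6 : chi (d k) (v x) ^ 2 ≤ v x ^ 2 := by gcongr
    have h7 := mul_le_mul_of_nonneg_right h3 (sq_nonneg ‖gradient v x‖)
    have h8 := mul_le_mul_of_nonneg_left h6 hε.le
    linarith
  have hL : Filter.Tendsto (fun k => ∫ x, V k x ^ p * rho n x) Filter.atTop (𝓝 (∫ x, v x ^ p * rho n x)) := by
    refine tendsto_integral_of_dominated_convergence (fun x => v x ^ p * rho n x) ?_ ?_ ?_ ?_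
    · intro k
      have := (hVC k).continuous
      exact (Continuous.mul (Continuous.rpow_const (by fun_prop) (fun x => Or.inr (by linarith))) (rho_cont n)).aestronglyMeasurable
    · refine Continuous.integrable_of_hasCompactSupport ?_ ?_
      · exact (Continuous.mul (Continuous.rpow_const (by fun_prop) (fun x => Or.inr (by linarith))) (rho_cont n))
      · refine hasCompactSupport_of_zero_off hΩb fun x hx => ?_
        rw [hvΩ x hx, Real.zero_rpow (by linarith)]; simp
    · intro k
      refine Filter.Eventually.of_forall fun x => ?_
      have h0 : 0 ≤ V k x := chi_nonneg (hv0 x)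
      have := rho_pos n x
      rw [Real.norm_eq_abs, abs_of_nonneg (by positivity)]
      gcongr
      exact chi_le (hd k).le (hv0 x)
    · refine Filter.Eventually.of_forall fun x => ?_
      refine Filter.Tendsto.mul_const _ ?_
      refine Filter.Tendsto.rpow_const ?_ (Or.inr (by linarith))
      refine tendsto_of_tendsto_of_tendsto_of_le_of_le (g := fun k => v x - 2 * d k) (h := fun _ => v x) ?_ tendsto_const_nhds (fun k => chi_ge (hd k).le (hv0 x)) (fun k => chi_le (hd k).le (hv0 x))
      simpa using (hdt.const_mul 2).const_sub (v x)
  exact le_of_tendsto' (hL.const_mul _) hkey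
structure Good (n : ℕ) (p ε lam : ℝ) (Ω : Set (EE n)) (u : EE n → ℝ) : Prop where
  hp : 1 < p
  hε : 0 < ε
  hlam : 0 < lam
  hΩ : IsOpen Ω
  hΩb : IsBounded Ω
  cont : Continuous u
  nonneg : ∀ x, 0 ≤ u x
  zero : ∀ x ∉ Ω, u x = 0
  c1 : ContDiffOn ℝ 1 u Ω
  mass : ∫ x, u x ^ p * rho n x = 1
  int : IntegrableOn (fun x => jd ε p u x * rho n x) {x | 0 < u x}
  val : ∫ x in {x | 0 < u x}, jd ε p u x * rho n x = lam
  min : ∀ v : EE n → ℝ, Continuous v → (∀ x, 0 ≤ v x) → (∀ x ∉ Ω, v x = 0) → ContDiffOn ℝ 1 v {x | 0 < v x} → IntegrableOn (fun x => jd ε p v x * rho n x) {x | 0 < v x} → lam * ∫ x, v x ^ p * rho n x ≤ ∫ x in {x | 0 < v x}, jd ε p v x * rho n x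
lemma lam_pos {n : ℕ} {p ε : ℝ} (hp : 1 < p) (hε : 0 < ε) {Ω : Set (EE n)} (hΩ : IsOpen Ω) (hne : Ω.Nonempty) : 0 < lambdaEps n p ε Ω := by
  have hp2 : 0 < p / 2 := by linarith
  have hp0 : 0 < p := by linarith
  have key : ∀ v : EE n → ℝ, IsTestFun n Ω v → Integrable (fun x => |v x| ^ p * rho n x) := by
    intro v hv
    have hvc := hv.1.continuous
    refine Continuous.integrable_of_hasCompactSupport ?_ ?_
    · exact (Continuous.mul (Continuous.rpow_const (by fun_prop) (fun x => Or.inr (by linarith))) (rho_cont n))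
    · refine HasCompactSupport.intro hv.2.1 fun x hx => ?_
      rw [image_eq_zero_of_notMem_tsupport hx, abs_zero, Real.zero_rpow hp0.ne', zero_mul]
  refine lt_of_lt_of_le (b := ε ^ (p / 2)) (by positivity) (le_csInf ?_ ?_)
  · obtain ⟨x0, hx0⟩ := hne
    obtain ⟨f, hfs, hfc, hfd, hfr, hf1⟩ := exists_contDiff_tsupport_subset (n := (⊤ : ℕ∞)) (hΩ.mem_nhds hx0)
    have hft : IsTestFun n Ω f := ⟨hfd, hfc, hfs⟩
    set I := ∫ x in Ω, |f x| ^ p ∂(gaussianMeasure n) with hI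
    have hIpos : 0 < I := by
      rw [hI, integral_gauss n hΩ.measurableSet, setIntegral_eq_integral_of_forall_compl_eq_zero]
      · have hc : Continuous (fun x => |f x| ^ p * rho n x) := by
          have := hfd.continuous
          exact (Continuous.mul (Continuous.rpow_const (by fun_prop) (fun x => Or.inr (by linarith))) (rho_cont n))
        refine hc.integral_pos_of_hasCompactSupport_nonneg_nonzero (x := x0) ?_ ?_ ?_
        · refine HasCompactSupport.intro hft.2.1 fun x hx => ?_
          rw [image_eq_zero_of_notMem_tsupport hx, abs_zero, Real.zero_rpow hp0.ne', zero_mul]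
        · intro x
          have := rho_pos n x
          positivity
        · have := rho_pos n x0
          simp [hf1, this.ne']
      · intro x hx
        have hx' : x ∉ tsupport f := fun h => hx (hfs h)
        rw [image_eq_zero_of_notMem_tsupport hx', abs_zero, Real.zero_rpow hp0.ne', zero_mul]
    set c := I ^ (-(1 / p)) with hc
    have hcpos : 0 < c := by positivity
    have hcp : c ^ p = I⁻¹ := by rw [hc, ← Real.rpow_mul hIpos.le, ← Real.rpow_neg_one]; congr 1; field_simp
    refine ⟨_, fun x => c * f x, ⟨contDiff_const.mul hfd, hfc.mul_left, ?_⟩, ?_, rfl⟩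
    · exact (tsupport_mul_subset_right (f := fun _ => c) (g := f)).trans hfs
    · have : ∀ x, |c * f x| ^ p = c ^ p * |f x| ^ p := fun x => by rw [abs_mul, abs_of_pos hcpos, Real.mul_rpow hcpos.le (abs_nonneg _)]
      simp_rw [this]
      rw [integral_const_mul, hcp, ← hI]; field_simp
  · rintro r ⟨v, hv, hv1, rfl⟩
    unfold Jeps
    rw [integral_gauss n hΩ.measurableSet] at hv1 ⊢
    rw [← mul_one (ε ^ (p / 2)), ← hv1, ← integral_const_mul]
    have hC1 : ContDiff ℝ 1 v := hv.1.of_le (by simp)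
    refine setIntegral_mono ((key v hv).integrableOn.const_mul _) ?_ ?_
    · refine Integrable.integrableOn (Continuous.integrable_of_hasCompactSupport ?_ ?_)
      · have h1 := gradient_cont hC1
        have h2 := hC1.continuous
        exact Continuous.mul (Continuous.rpow_const (by fun_prop) (fun x => Or.inr hp2.le)) (rho_cont n)
      · refine HasCompactSupport.intro hv.2.1 fun x hx => ?_
        rw [image_eq_zero_of_notMem_tsupport hx, gradient_zero_of_notMem hx]
        simp [Real.zero_rpow hp2.ne']
    · intro x
      have := (rho_pos n x).le
      simp only
      rw [← mul_assoc]
      refine mul_le_mul_of_nonneg_right ?_ this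
      have h1 : |v x| ^ p = (v x ^ 2) ^ (p / 2) := by
        rw [← sq_abs, ← Real.rpow_natCast, ← Real.rpow_mul (abs_nonneg _)]
        congr 1; push_cast; ring
      rw [h1, ← Real.mul_rpow hε.le (sq_nonneg _)]
      refine Real.rpow_le_rpow (by positivity) ?_ hp2.le
      have := sq_nonneg ‖gradient v x‖
      linarith
lemma gradient_congr {n : ℕ} {f g : EE n → ℝ} {x : EE n} (h : f =ᶠ[𝓝 x] g) : gradient f x = gradient g x := by unfold gradient; rw [h.fderiv_eq]
lemma good_of_min {n : ℕ} {p ε : ℝ} (hp : 1 < p) (hε : 0 < ε) {Ω : Set (EE n)} (hΩ : IsOpen Ω) (hΩb : IsBounded Ω) {u : EE n → ℝ} (hu : IsNormalizedMinimizer n p ε Ω u) : Good n p ε (lambdaEps n p ε Ω) Ω (Ω.indicator u) := by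
  obtain ⟨huc, hu1, hu0, hub, hmass, hJ⟩ := hu
  have hp2 : 0 < p / 2 := by linarith
  have hp0 : 0 < p := by linarith
  have hne : Ω.Nonempty := by
    by_contra h
    rw [not_nonempty_iff_eq_empty] at h
    rw [h] at hmass; simp at hmass
  have hlam := lam_pos hp hε hΩ hne
  set v := Ω.indicator u with hv
  have hvu : ∀ x ∈ Ω, v x = u x := fun x hx => indicator_of_mem hx _
  have hv0 : ∀ x ∉ Ω, v x = 0 := fun x hx => indicator_of_notMem hx _
  have heq : ∀ x ∈ Ω, v =ᶠ[𝓝 x] u := fun x hx => by filter_upwards [hΩ.mem_nhds hx] with y hy using hvu y hy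
  have hjd : ∀ x ∈ Ω, jd ε p v x = jd ε p u x := fun x hx => by unfold jd; rw [hvu x hx, gradient_congr (heq x hx)]
  have hcont : Continuous v := continuous_indicator hub huc
  have hnn : ∀ x, 0 ≤ v x := fun x => by
    by_cases hx : x ∈ Ω
    · rw [hvu x hx]; exact hu0 x (subset_closure hx)
    · rw [hv0 x hx]
  have hUΩ : {x | 0 < v x} ⊆ Ω := fun x hx => by
    by_contra h
    have : 0 < v x := hx
    rw [hv0 x h] at this; exact lt_irrefl _ this
  have hz : ∀ x ∈ Ω \ {x | 0 < v x}, jd ε p v x * rho n x = 0 := by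
    intro x hx
    have h0 : v x = 0 := le_antisymm (not_lt.mp hx.2) (hnn x)
    have hm : IsLocalMin v x := Filter.Eventually.of_forall fun y => by rw [h0]; exact hnn y
    have : gradient v x = 0 := by unfold gradient; rw [hm.fderiv_eq_zero]; simp
    unfold jd; rw [this, h0]; simp [Real.zero_rpow hp2.ne']
  have hJ' : ∫ x in Ω, jd ε p v x * rho n x = lambdaEps n p ε Ω := by
    rw [← hJ]; unfold Jeps; rw [integral_gauss n hΩ.measurableSet]
    refine setIntegral_congr_fun hΩ.measurableSet fun x hx => ?_
    simp only [hjd x hx]; rfl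
  have hint : IntegrableOn (fun x => jd ε p v x * rho n x) Ω := by
    by_contra h
    rw [integral_undef h] at hJ'
    exact hlam.ne hJ'
  refine ⟨hp, hε, hlam, hΩ, hΩb, hcont, hnn, hv0, hu1.congr hvu, ?_, hint.mono_set hUΩ, ?_, ?_⟩
  · rw [integral_gauss n hΩ.measurableSet] at hmass
    rw [← hmass, ← setIntegral_eq_integral_of_forall_compl_eq_zero (s := Ω)]
    · exact setIntegral_congr_fun hΩ.measurableSet fun x hx => by simp only [hvu x hx]
    · intro x hx; rw [hv0 x hx, Real.zero_rpow hp0.ne', zero_mul]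
  · rw [← hJ']
    exact setIntegral_eq_of_subset_of_forall_diff_eq_zero hΩ.measurableSet hUΩ hz |>.symm
  · intro w h1 h2 h3 h4 h5
    exact min_ineq hp hε hΩ hΩb h1 h2 h3 h4 h5
noncomputable def FF {n : ℕ} (ε p : ℝ) (q : EE n) : ℝ := (ε + ‖q‖ ^ 2) ^ (p / 2)
noncomputable def AA {n : ℕ} (ε p : ℝ) (q : EE n) : EE n := (ε + ‖q‖ ^ 2) ^ (p / 2 - 1) • q
noncomputable def Rhs {n : ℕ} (ε p lam : ℝ) (x q : EE n) : ℝ := FF ε p q - lam - p * ⟪AA ε p q, q⟫ + ⟪AA ε p q, x⟫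
lemma FF_hasDerivAt {n : ℕ} {ε : ℝ} (hε : 0 < ε) (p : ℝ) (q ξ : EE n) (t : ℝ) : HasDerivAt (fun t : ℝ => FF ε p (q + t • ξ)) (p * ⟪AA ε p (q + t • ξ), ξ⟫) t := by
  have h1 : HasDerivAt (fun t : ℝ => q + t • ξ) ξ t := by simpa using ((hasDerivAt_id t).smul_const ξ).const_add q
  have h2 := (h1.norm_sq).const_add ε
  have h3 := h2.rpow_const (p := p / 2) (Or.inl (by positivity))
  refine h3.congr_deriv ?_
  unfold AA
  rw [inner_smul_left]; simp; ring
lemma FF_cont {n : ℕ} {ε : ℝ} (hε : 0 < ε) (p : ℝ) : Continuous (FF (n := n) ε p) := by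
  unfold FF
  exact Continuous.rpow_const (by fun_prop) fun x => Or.inl (by positivity)
lemma AA_cont {n : ℕ} {ε : ℝ} (hε : 0 < ε) (p : ℝ) : Continuous (AA (n := n) ε p) := by
  unfold AA
  exact (Continuous.rpow_const (by fun_prop) fun x => Or.inl (by positivity)).smul continuous_id
lemma FF_pos {n : ℕ} {ε : ℝ} (hε : 0 < ε) (p : ℝ) (q : EE n) : 0 < FF ε p q := by unfold FF; positivity
namespace Good
variable {n : ℕ} {p ε lam : ℝ} {Ω : Set (EE n)} {u : EE n → ℝ}
lemma openU (G : Good n p ε lam Ω u) : IsOpen {x | 0 < u x} := isOpen_lt continuous_const G.cont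
lemma subU (G : Good n p ε lam Ω u) : {x | 0 < u x} ⊆ Ω := fun x hx => by
  by_contra h
  have : 0 < u x := hx
  rw [G.zero x h] at this; exact lt_irrefl _ this
lemma logC1 (G : Good n p ε lam Ω u) : ContDiffOn ℝ 1 (fun x => Real.log (u x)) {x | 0 < u x} := (G.c1.mono G.subU).log fun x hx => (ne_of_gt hx)
lemma diffU (G : Good n p ε lam Ω u) {x : EE n} (hx : 0 < u x) : DifferentiableAt ℝ u x := (G.c1.contDiffAt (G.hΩ.mem_nhds (G.subU hx))).differentiableAt one_ne_zero
end Good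
lemma jd_log {n : ℕ} {ε : ℝ} (hε : 0 < ε) (p : ℝ) {u : EE n → ℝ} {x : EE n} (hx : 0 < u x) (hd : DifferentiableAt ℝ u x) : jd ε p u x = u x ^ p * FF ε p (gradient (fun y => Real.log (u y)) x) := by
  have h := gradient_comp (Real.hasDerivAt_log hx.ne') hd
  unfold jd FF
  rw [h, norm_smul, mul_pow, Real.norm_eq_abs, sq_abs]
  have : ε * u x ^ 2 + ‖gradient u x‖ ^ 2 = u x ^ 2 * (ε + (u x)⁻¹ ^ 2 * ‖gradient u x‖ ^ 2) := by field_simp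
  rw [this, Real.mul_rpow (by positivity) (by positivity), ← Real.rpow_natCast (u x), ← Real.rpow_mul hx.le]
  congr 2; push_cast; ring
lemma gradient_add_smul {n : ℕ} {f g : EE n → ℝ} {x : EE n} (c : ℝ) (hf : DifferentiableAt ℝ f x) (hg : DifferentiableAt ℝ g x) : gradient (fun y => f y + c * g y) x = gradient f x + c • gradient g x := by
  apply ext_inner_right ℝ
  intro y
  have := (hf.hasFDerivAt.add (hg.hasFDerivAt.const_mul c)).fderiv
  rw [inner_add_left, inner_smul_left, inner_gradient_left, inner_gradient_left, inner_gradient_left]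
  change fderiv ℝ (f + fun y => c * g y) x y = _
  rw [this]
  simp
lemma gradient_mul {n : ℕ} {f g : EE n → ℝ} {x : EE n} (hf : DifferentiableAt ℝ f x) (hg : DifferentiableAt ℝ g x) : gradient (fun y => f y * g y) x = f x • gradient g x + g x • gradient f x := by
  apply ext_inner_right ℝ
  intro y
  have := (hf.hasFDerivAt.mul hg.hasFDerivAt).fderiv
  rw [inner_add_left, inner_smul_left, inner_smul_left, inner_gradient_left, inner_gradient_left, inner_gradient_left]
  change fderiv ℝ (f * g) x y = _
  rw [this]
  simp
lemma Good.EL0 {n : ℕ} {p ε lam : ℝ} {Ω : Set (EE n)} {u : EE n → ℝ} (G : Good n p ε lam Ω u) {η : EE n → ℝ} (hη : ContDiff ℝ 1 η) (hηc : HasCompactSupport η) (hηU : tsupport η ⊆ {x | 0 < u x}) : ∫ x in tsupport η, u x ^ p * rho n x * (η x * (FF ε p (gradient LG u x) - lam) + ⟪AA ε p (gradient LG u x), gradient η x⟫) = 0 := by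
  have hε := G.hε
  have hp0 : 0 < p := by linarith [G.hp]
  set U := {x | 0 < u x} with hU
  have hUo : IsOpen U := G.openU
  set K := tsupport η with hK
  have hKc : IsCompact K := hηc
  set w := fun y => log (u y) with hw
  have hwc : ContinuousOn (gradient w) U := gradient_contOn hUo G.logC1
  have hηg := gradient_cont hη
  have hηc' := hη.continuous
  let v : ℝ → EE n → ℝ := fun t x => u x * Real.exp (t * η x)
  have hvpos : ∀ t, {x | 0 < v t x} = U := fun t => by
    ext x; simp only [mem_ofPred_eq, v, hU]
    exact mul_pos_iff_of_pos_right (Real.exp_pos _)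
  have hvC : ∀ t, Continuous (v t) := fun t => by have := G.cont; fun_prop
  have hv1 : ∀ t, ContDiffOn ℝ 1 (v t) U := fun t => by
    have := G.c1.mono G.subU
    have h2 : ContDiffOn ℝ 1 (fun x => Real.exp (t * η x)) U := by
      have : ContDiff ℝ 1 (fun x => Real.exp (t * η x)) := by fun_prop
      exact this.contDiffOn
    exact this.mul h2
  have hvd : ∀ t, ∀ x ∈ U, DifferentiableAt ℝ (v t) x := fun t x hx => ((hv1 t).contDiffAt (hUo.mem_nhds hx)).differentiableAt one_ne_zero
  have hwd : ∀ x ∈ U, DifferentiableAt ℝ w x := fun x hx => ((G.logC1).contDiffAt (hUo.mem_nhds hx)).differentiableAt one_ne_zero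
  have hηd : ∀ x, DifferentiableAt ℝ η x := fun x => (hη.differentiable one_ne_zero) x
  have hvlog : ∀ t, ∀ x ∈ U, gradient (fun y => log (v t y)) x = gradient w x + t • gradient η x := by
    intro t x hx
    rw [← gradient_add_smul t (hwd x hx) (hηd x)]
    refine gradient_congr ?_
    filter_upwards [hUo.mem_nhds hx] with y hy
    have hy : 0 < u y := hy
    simp only [v, hw]
    rw [Real.log_mul hy.ne' (Real.exp_pos _).ne', Real.log_exp]
  have hvp : ∀ t, ∀ x, v t x ^ p = u x ^ p * Real.exp (p * t * η x) := fun t x => by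
    simp only [v]
    rw [Real.mul_rpow (G.nonneg x) (Real.exp_pos _).le, ← Real.exp_mul]; congr 2; ring
  let E : ℝ → EE n → ℝ := fun t x => u x ^ p * Real.exp (p * t * η x) * FF ε p (gradient w x + t • gradient η x) * rho n x
  have hjv : ∀ t, ∀ x ∈ U, jd ε p (v t) x * rho n x = E t x := by
    intro t x hx
    have : 0 < v t x := by have := hvpos t; rw [Set.ext_iff] at this; exact (this x).2 hx
    rw [jd_log hε p this (hvd t x hx), hvlog t x hx, hvp t x]
  have hv0 : ∀ x, v 0 x = u x := fun x => by simp [v]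
  have hE0int : IntegrableOn (E 0) U := by
    refine G.int.congr_fun (fun x hx => ?_) hUo.measurableSet
    have := hjv 0 x hx
    rw [show v 0 = u from funext hv0] at this
    exact this
  have hEc : ∀ t, ContinuousOn (E t) U := by
    intro t
    have h1 : Continuous fun x => u x ^ p := G.cont.rpow_const fun _ => Or.inr hp0.le
    have h2 : ContinuousOn (fun x => FF ε p (gradient w x + t • gradient η x)) U := (FF_cont hε p).comp_continuousOn (hwc.add (by fun_prop))
    exact ((h1.continuousOn.mul (by fun_prop)).mul h2).mul (rho_cont n).continuousOn
  have hEoff : ∀ t, ∀ x ∈ U \ K, E t x = E 0 x := by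
    intro t x hx
    simp only [E]
    rw [gradient_zero_of_notMem hx.2, image_eq_zero_of_notMem_tsupport hx.2]; simp
  have hKm : MeasurableSet K := hKc.measurableSet
  have hEint : ∀ t, IntegrableOn (E t) U := by
    intro t
    have h1 : IntegrableOn (E t) K := ((hEc t).mono hηU).integrableOn_compact hKc
    have h2 : IntegrableOn (E t) (U \ K) := (hE0int.mono_set sdiff_subset).congr_fun (fun x hx => (hEoff t x hx).symm) (hUo.measurableSet.diff hKm)
    have := h1.union h2
    rwa [union_sdiff_cancel hηU] at this
  let M : ℝ → EE n → ℝ := fun t x => u x ^ p * Real.exp (p * t * η x) * rho n x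
  have hMc : ∀ t, Continuous (M t) := by
    intro t
    have h1 : Continuous fun x => u x ^ p := G.cont.rpow_const fun _ => Or.inr hp0.le
    exact (h1.mul (by fun_prop)).mul (rho_cont n)
  have hMint : ∀ t, Integrable (M t) := by
    intro t
    refine (hMc t).integrable_of_hasCompactSupport (hasCompactSupport_of_zero_off G.hΩb fun x hx => ?_)
    simp only [M]; rw [G.zero x hx, Real.zero_rpow hp0.ne']; simp
  have hmin : ∀ t, lam * ∫ x in U, M t x ≤ ∫ x in U, E t x := by
    intro t
    have h := G.min (v t) (hvC t) (fun x => mul_nonneg (G.nonneg x) (Real.exp_pos _).le) (fun x hx => by simp [v, G.zero x hx]) (by rw [hvpos t]; exact hv1 t) (by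
        rw [hvpos t]
        exact (hEint t).congr_fun (fun x hx => (hjv t x hx).symm) hUo.measurableSet)
    rw [hvpos t, setIntegral_congr_fun hUo.measurableSet (hjv t)] at h
    rw [← setIntegral_eq_integral_of_forall_compl_eq_zero (s := U)] at h
    · simp_rw [hvp] at h
      exact h
    · intro x hx
      have : u x = 0 := le_antisymm (not_lt.mp hx) (G.nonneg x)
      rw [hvp, this, Real.zero_rpow hp0.ne']; simp
  have hmin0 : lam * ∫ x in U, M 0 x = ∫ x in U, E 0 x := by
    have h1 : ∫ x in U, M 0 x = 1 := by
      rw [← G.mass, setIntegral_eq_integral_of_forall_compl_eq_zero (s := U)]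
      · simp [M]
      · intro x hx
        have : u x = 0 := le_antisymm (not_lt.mp hx) (G.nonneg x)
        simp only [M, this, Real.zero_rpow hp0.ne']; simp
    rw [h1, mul_one, ← G.val]
    refine setIntegral_congr_fun hUo.measurableSet fun x hx => ?_
    have := hjv 0 x hx
    rw [show v 0 = u from funext hv0] at this
    exact this
  let H : ℝ → EE n → ℝ := fun t x => u x ^ p * rho n x * (Real.exp (p * t * η x) * (FF ε p (gradient w x + t • gradient η x) - lam))
  have hH : ∀ t x, H t x = E t x - lam * M t x := fun t x => by simp only [H, E, M]; ring
  have hHsplit : ∀ t, (∫ x in U, E t x) - lam * ∫ x in U, M t x = (∫ x in K, H t x) + ∫ x in U \ K, H 0 x := by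
    intro t
    have hi : IntegrableOn (H t) U := by
      rw [show H t = fun x => E t x - lam * M t x from funext (hH t)]
      exact (hEint t).sub ((hMint t).integrableOn.const_mul _)
    rw [← integral_const_mul, ← integral_sub (hEint t) ((hMint t).integrableOn.const_mul _)]
    simp_rw [← hH]
    rw [← setIntegral_congr_fun (hUo.measurableSet.diff hKm) (f := H t) (g := H 0)]
    · rw [← setIntegral_union disjoint_sdiff_right (hUo.measurableSet.diff hKm) (hi.mono_set hηU) (hi.mono_set sdiff_subset), union_sdiff_cancel hηU]
    · intro x hx
      rw [hH, hH, hEoff t x hx]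
      simp only [M]
      rw [image_eq_zero_of_notMem_tsupport hx.2]; simp
  have hlm : IsLocalMin (fun t => ∫ x in K, H t x) 0 := by
    refine Filter.Eventually.of_forall fun t => ?_
    have h1 := hHsplit t
    have h2 := hHsplit 0
    have h3 := hmin t
    change (∫ x in K, H 0 x) ≤ ∫ x in K, H t x
    linarith
  have hupc : Continuous fun x => u x ^ p := G.cont.rpow_const fun _ => Or.inr hp0.le
  have hder := hasDerivAt_integral_compact (K := K) hKc (F := H) (F' := fun t x => u x ^ p * rho n x * (Real.exp (p * t * η x) * (p * η x) * (FF ε p (gradient w x + t • gradient η x) - lam) + Real.exp (p * t * η x) * (p * ⟪AA ε p (gradient w x + t • gradient η x), gradient η x⟫))) (t₀ := 0) one_pos ?_ ?_ ?_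
  · have h0 := hlm.hasDerivAt_eq_zero hder
    simp only [mul_zero, zero_mul, zero_smul, add_zero, Real.exp_zero, one_mul] at h0
    have : ∀ x, u x ^ p * rho n x * (p * η x * (FF ε p (gradient w x) - lam) + p * ⟪AA ε p (gradient w x), gradient η x⟫) = p * (u x ^ p * rho n x * (η x * (FF ε p (gradient w x) - lam) + ⟪AA ε p (gradient w x), gradient η x⟫)) := fun x => by ring
    simp_rw [this] at h0
    rw [integral_const_mul] at h0
    exact (mul_eq_zero.mp h0).resolve_left hp0.ne'
  · intro t _
    rw [show H t = fun x => E t x - lam * M t x from funext (hH t)]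
    exact ((hEc t).mono hηU).sub (continuous_const.mul (hMc t)).continuousOn
  · have hw2 : ContinuousOn (fun z : ℝ × EE n => gradient w z.2) (Icc (0-1) (0+1) ×ˢ K) := (hwc.mono hηU).comp continuousOn_snd fun z hz => hz.2
    have hq : ContinuousOn (fun z : ℝ × EE n => gradient w z.2 + z.1 • gradient η z.2) (Icc (0-1) (0+1) ×ˢ K) := by
      refine hw2.add ?_
      have : Continuous fun z : ℝ × EE n => z.1 • gradient η z.2 := continuous_fst.smul (hηg.comp continuous_snd)
      exact this.continuousOn
    have hF2 := (FF_cont hε p).comp_continuousOn hq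
    have hA2 := (AA_cont hε p).comp_continuousOn hq
    have hg2 : ContinuousOn (fun z : ℝ × EE n => gradient η z.2) (Icc (0-1) (0+1) ×ˢ K) := (hηg.comp continuous_snd).continuousOn
    have hu2 : ContinuousOn (fun z : ℝ × EE n => u z.2 ^ p * rho n z.2) (Icc (0-1) (0+1) ×ˢ K) := ((hupc.mul (rho_cont n)).comp continuous_snd).continuousOn
    have hex : ContinuousOn (fun z : ℝ × EE n => Real.exp (p * z.1 * η z.2)) (Icc (0-1) (0+1) ×ˢ K) := by
      have : Continuous (fun z : ℝ × EE n => Real.exp (p * z.1 * η z.2)) := by fun_prop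
      exact this.continuousOn
    have hpe : ContinuousOn (fun z : ℝ × EE n => p * η z.2) (Icc (0-1) (0+1) ×ˢ K) := by
      have : Continuous (fun z : ℝ × EE n => p * η z.2) := by fun_prop
      exact this.continuousOn
    exact hu2.mul (((hex.mul hpe).mul (hF2.sub continuousOn_const)).add (hex.mul (continuousOn_const.mul (hA2.inner hg2))))
  · intro t _ x _
    have h1 : HasDerivAt (fun t => Real.exp (p * t * η x)) (Real.exp (p * t * η x) * (p * η x)) t := by
      have := ((hasDerivAt_id t).const_mul p).mul_const (η x)
      simpa using this.exp
    have h2 := (FF_hasDerivAt hε p (gradient w x) (gradient η x) t).sub_const lam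
    exact (h1.mul h2).const_mul _
lemma Good.EL {n : ℕ} {p ε lam : ℝ} {Ω : Set (EE n)} {u : EE n → ℝ} (G : Good n p ε lam Ω u) {φ : EE n → ℝ} (hφ : ContDiff ℝ 1 φ) (hφc : HasCompactSupport φ) (hφU : tsupport φ ⊆ {x | 0 < u x}) : ∫ x, ⟪AA ε p (gradient LG u x), gradient φ x⟫ = - ∫ x, Rhs ε p lam x (gradient LG u x) * φ x := by
  have hε := G.hε
  have hp0 : 0 < p := by linarith [G.hp]
  set U := {x | 0 < u x} with hU
  have hUo : IsOpen U := G.openU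
  set w := fun y => log (u y) with hw
  have hwc : ContinuousOn (gradient w) U := gradient_contOn hUo G.logC1
  let s : EE n → ℝ := fun x => (u x ^ p * rho n x)⁻¹
  let η : EE n → ℝ := fun x => φ x * s x
  have hs1 : ContDiffOn ℝ 1 s U := by
    refine ContDiffOn.inv ?_ ?_
    · exact ((G.c1.mono G.subU).rpow_const_of_ne fun x hx => ne_of_gt hx).mul (rho_contDiff n).contDiffOn
    · intro x hx
      have : 0 < u x := hx
      have := rho_pos n x
      positivity
  have hts : tsupport η ⊆ tsupport φ := tsupport_mul_subset_left
  have hη : ContDiff ℝ 1 η := by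
    refine contDiff_of_tsup fun x hx => ?_
    exact hφ.contDiffAt.mul (hs1.contDiffAt (hUo.mem_nhds (hφU (hts hx))))
  have hηc : HasCompactSupport η := hφc.mul_right
  have h := G.EL0 hη hηc (hts.trans hφU)
  have hsupp : ∀ x ∉ tsupport η, u x ^ p * rho n x * (η x * (FF ε p (gradient w x) - lam) + ⟪AA ε p (gradient w x), gradient η x⟫) = 0 := by
    intro x hx
    rw [gradient_zero_of_notMem hx, image_eq_zero_of_notMem_tsupport hx]; simp
  rw [setIntegral_eq_integral_of_forall_compl_eq_zero hsupp] at h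
  have hpt : ∀ x, u x ^ p * rho n x * (η x * (FF ε p (gradient w x) - lam) + ⟪AA ε p (gradient w x), gradient η x⟫) = ⟪AA ε p (gradient w x), gradient φ x⟫ + Rhs ε p lam x (gradient w x) * φ x := by
    intro x
    by_cases hx : x ∈ tsupport φ
    · have hxU : 0 < u x := hφU hx
      have hr := rho_pos n x
      have hd := (hs1.contDiffAt (hUo.mem_nhds (hφU hx))).differentiableAt one_ne_zero
      have hgs : gradient s x = s x • (x - p • gradient w x) := by
        have hdw : gradient w x = (u x)⁻¹ • gradient u x := gradient_comp (Real.hasDerivAt_log hxU.ne') (G.diffU hxU)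
        have h1 : gradient (fun x => u x ^ p) x = (p * u x ^ (p - 1)) • gradient u x := gradient_comp (f := fun s => s ^ p) (Real.hasDerivAt_rpow_const (Or.inl hxU.ne')) (G.diffU hxU)
        have hdp : DifferentiableAt ℝ (fun x => u x ^ p) x := (G.diffU hxU).rpow_const (Or.inl hxU.ne')
        have hdr : DifferentiableAt ℝ (rho n) x := (rho_fderiv n x).differentiableAt
        have h2 := gradient_mul hdp hdr
        have h3 : gradient s x = (-((u x ^ p * rho n x) ^ 2)⁻¹) • gradient (fun x => u x ^ p * rho n x) x := gradient_comp (f := fun s => s⁻¹) (hasDerivAt_inv (by positivity)) (hdp.mul hdr)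
        rw [h3, h2, h1, hdw, rho_gradient]
        simp only [s]
        have h4 : u x ^ (p - 1) = u x ^ p * (u x)⁻¹ := by rw [Real.rpow_sub_one hxU.ne']; rfl
        rw [h4, smul_sub, smul_add, smul_smul, smul_smul, smul_smul, smul_smul, smul_smul, smul_smul]
        have hup : 0 < u x ^ p := by positivity
        rw [sub_eq_add_neg, ← neg_smul]
        congr 1
        · congr 1; field_simp
        · congr 1; field_simp
      have hgη : gradient η x = φ x • gradient s x + s x • gradient φ x := gradient_mul (hφ.differentiable one_ne_zero x) hd
      rw [hgη, hgs]
      have hss : u x ^ p * rho n x * s x = 1 := by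
        have : 0 < u x ^ p * rho n x := by positivity
        simp only [s]; field_simp
      simp only [η, Rhs, inner_add_right, inner_smul_right, inner_sub_right]
      linear_combination (φ x * (FF ε p (gradient w x) - lam) + φ x * (⟪AA ε p (gradient w x), x⟫ - p * ⟪AA ε p (gradient w x), gradient w x⟫) + ⟪AA ε p (gradient w x), gradient φ x⟫) * hss
    · have hx' : x ∉ tsupport η := fun h => hx (hts h)
      rw [gradient_zero_of_notMem hx, image_eq_zero_of_notMem_tsupport hx, hsupp x hx']; simp
  simp_rw [hpt] at h
  have hAw : ContinuousOn (fun x => AA ε p (gradient w x)) U := (AA_cont hε p).comp_continuousOn hwc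
  have hI1 : Integrable (fun x => ⟪AA ε p (gradient w x), gradient φ x⟫) := by
    refine (integrableOn_iff_integrable_of_support_subset (s := tsupport φ) ?_).1 (((hAw.mono hφU).inner (gradient_cont hφ).continuousOn).integrableOn_compact hφc)
    intro x hx
    by_contra h
    exact hx (by simp [gradient_zero_of_notMem h])
  have hI2 : Integrable (fun x => Rhs ε p lam x (gradient w x) * φ x) := by
    refine (integrableOn_iff_integrable_of_support_subset (s := tsupport φ) ?_).1 (ContinuousOn.integrableOn_compact hφc ?_)
    · intro x hx
      by_contra h
      exact hx (by simp [image_eq_zero_of_notMem_tsupport h])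
    · have h1 := (hAw.mono hφU).inner (𝕜 := ℝ) (hwc.mono hφU)
      have h2 := (hAw.mono hφU).inner (𝕜 := ℝ) (continuousOn_id)
      have h3 := (FF_cont hε p).comp_continuousOn (hwc.mono hφU)
      unfold Rhs
      exact ((((h3.sub continuousOn_const).sub (continuousOn_const.mul h1)).add h2)).mul hφ.continuous.continuousOn
  rw [integral_add hI1 hI2] at h
  linarith
structure Loc (n : ℕ) (c L R0 R1 r1 : ℝ) (g κ k S : EE n → ℝ) (V : EE n → EE n)
    (D : EE n →L[ℝ] EE n) : Prop where
  hc : 0 < c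
  hL : 0 < L
  hR0 : 0 < R0
  hR1 : 1 ≤ R1
  hr1 : 0 < r1
  hr1' : r1 ≤ 1
  g1 : ContDiff ℝ 1 g
  g0 : g 0 = 0
  gpos : ∀ z, ‖z‖ ≤ R0 → 0 ≤ g z
  Vc : Continuous V
  Sc : Continuous S
  coer : ∀ z, c * ‖gradient g z‖ ^ 2 ≤ ⟪V z, gradient g z⟫
  Vb : ∀ z, ‖V z‖ ≤ L * ‖gradient g z‖
  VD : ∀ z, ‖V z - D (gradient g z)‖ ≤ L * ‖gradient g z‖ ^ 2
  Sb : ∀ z, ‖z‖ ≤ R0 → |S z| ≤ L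
  el : ∀ φ : EE n → ℝ, ContDiff ℝ 1 φ → tsupport φ ⊆ closedBall 0 R0 → ∫ z, ⟪V z, gradient φ z⟫ = ∫ z, S z * φ z
  κ1 : ContDiff ℝ 1 κ
  kc : Continuous k
  κ0 : ∀ z, 0 ≤ κ z
  κle : ∀ z, κ z ≤ 1
  k0 : ∀ z, 0 ≤ k z
  kle : ∀ z, k z ≤ 2
  κs : tsupport κ ⊆ closedBall 0 R1
  ks : ∀ z, z ∉ BB n R1 → k z = 0
  klow : ∀ z, ‖z‖ ≤ r1 → 1 ≤ k z
  κg : ∀ z, ‖gradient κ z‖ ≤ L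
  Dκ : ∀ v z, ⟪D v, gradient κ z⟫ = - (k z * ⟪v, z⟫)
lemma gradient_comp_smul {n : ℕ} {φ : EE n → ℝ} (hφ : Differentiable ℝ φ) (a : ℝ) (x : EE n) : gradient (fun x => φ (a • x)) x = a • gradient φ (a • x) := by
  apply ext_inner_right ℝ
  intro y
  have h1 : HasFDerivAt (fun x : EE n => a • x) (a • ContinuousLinearMap.id ℝ (EE n)) x := (hasFDerivAt_id x).const_smul a
  have h2 := ((hφ (a • x)).hasFDerivAt.comp x h1).fderiv
  rw [inner_smul_left, inner_gradient_left, inner_gradient_left]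
  change fderiv ℝ (φ ∘ fun x => a • x) x y = _
  rw [h2]; simp
namespace Loc
variable {n : ℕ} {c L R0 R1 r1 : ℝ} {g κ k S : EE n → ℝ} {V : EE n → EE n} {D : EE n →L[ℝ] EE n}
lemma el_scaled (H : Loc n c L R0 R1 r1 g κ k S V D) {r ρ : ℝ} (hr : 0 < r) (hρ : r * ρ ≤ R0) {φ : EE n → ℝ} (hφ : ContDiff ℝ 1 φ) (hs : tsupport φ ⊆ closedBall 0 ρ) : ∫ z, ⟪V (r • z), gradient φ z⟫ = r * ∫ z, S (r • z) * φ z := by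
  have h := H.el (fun x => φ (r⁻¹ • x)) (by fun_prop) ?_
  · have h1 : ∀ z, ⟪V z, gradient (fun x => φ (r⁻¹ • x)) z⟫ = (fun y => r⁻¹ * ⟪V (r • y), gradient φ y⟫) (r⁻¹ • z) := by
      intro z
      rw [gradient_comp_smul (hφ.differentiable one_ne_zero), inner_smul_right]
      simp only
      rw [smul_inv_smul₀ hr.ne']
    have h2 : ∀ z, S z * φ (r⁻¹ • z) = (fun y => S (r • y) * φ y) (r⁻¹ • z) := by intro z; simp only; rw [smul_inv_smul₀ hr.ne']
    rw [integral_congr_ae (Filter.Eventually.of_forall h1), integral_congr_ae (Filter.Eventually.of_forall h2)] at h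
    rw [Measure.integral_comp_inv_smul volume (fun y => r⁻¹ * ⟪V (r • y), gradient φ y⟫) r, Measure.integral_comp_inv_smul volume (fun y => S (r • y) * φ y) r, integral_const_mul, smul_eq_mul, smul_eq_mul] at h
    have h3 : |r ^ Module.finrank ℝ (EE n)| ≠ 0 := by positivity
    have h4 := mul_left_cancel₀ h3 h
    rw [← h4]; field_simp
  · have : tsupport (fun x => φ (r⁻¹ • x)) ⊆ (fun x => r⁻¹ • x) ⁻¹' (tsupport φ) := by
      refine closure_minimal ?_ ((isClosed_tsupport φ).preimage (by fun_prop))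
      intro x hx
      exact subset_tsupport _ hx
    refine this.trans fun x hx => ?_
    have := hs hx
    simp only [mem_closedBall, dist_zero_right, norm_smul, norm_inv, Real.norm_eq_abs, abs_of_pos hr] at this ⊢
    rw [inv_mul_le_iff₀ hr] at this
    linarith
lemma gg (H : Loc n c L R0 R1 r1 g κ k S V D) : Continuous (gradient g) := gradient_cont H.g1
set_option maxHeartbeats 1000000 in
lemma cacc (H : Loc n c L R0 R1 r1 g κ k S V D) {r η : ℝ} (hr : 0 < r) (hrR : r * (2 * R1) ≤ R0) (hη : 0 ≤ η) (hg : ∀ z, ‖z‖ ≤ 2 * R1 → g (r • z) ≤ η * r) : ∫ z in BB n R1, ‖gradient g (r • z)‖ ^ 2 ≤ (4 / c * (L + 2 * L ^ 2 / c)) * (1 + η / r) * ∫ z in BB n (2 * R1), g (r • z) := by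
  have hR1 := H.hR1
  have hc := H.hc
  have hL := H.hL
  have hgc := H.g1.continuous
  have hGc := H.gg
  let s0 : EE n → ℝ := fun z => 1 - ‖z‖ ^ 2 / (4 * R1 ^ 2)
  let s : EE n → ℝ := fun z => max (s0 z) 0
  let θ : EE n → ℝ := fun z => (s z) ^ 2
  have hs0 : ContDiff ℝ 1 s0 := by
    have : ContDiff ℝ 1 (fun x : EE n => ‖x‖ ^ 2) := contDiff_norm_sq ℝ
    fun_prop
  have hs0g : ∀ z, gradient s0 z = (-(1 / (2 * R1 ^ 2))) • z := by
    intro z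
    apply ext_inner_right ℝ
    intro y
    have h1 : HasFDerivAt (fun x : EE n => ‖x‖ ^ 2) (2 • innerSL ℝ z) z := (hasStrictFDerivAt_norm_sq z).hasFDerivAt
    have h2 := (h1.mul_const ((4 * R1 ^ 2)⁻¹)).const_sub 1
    rw [inner_gradient_left]
    change fderiv ℝ (fun x => 1 - ‖x‖ ^ 2 * (4 * R1 ^ 2)⁻¹) z y = _
    rw [h2.fderiv]
    simp [inner_smul_left]
    field_simp; ring
  have hθ : ContDiff ℝ 1 θ := posSq_contDiff.comp hs0
  have hθg : ∀ z, gradient θ z = (2 * s z) • gradient s0 z := fun z => gradient_comp (posSq_hasDerivAt (s0 z)) (hs0.differentiable one_ne_zero z)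
  have hsz : ∀ z, z ∉ closedBall (0:EE n) (2 * R1) → s z = 0 := by
    intro z hz
    simp only [mem_closedBall, dist_zero_right, not_le] at hz
    refine max_eq_right ?_
    simp only [s0]
    rw [sub_nonpos, le_div_iff₀ (by positivity)]
    nlinarith
  have hsc : Continuous s := by have := hs0.continuous; fun_prop
  have hsn : ∀ z, 0 ≤ s z := fun z => le_max_right _ _
  have hs1 : ∀ z, s z ≤ 1 := fun z => max_le (by simp only [s0]; linarith [show 0 ≤ ‖z‖ ^ 2 / (4 * R1 ^ 2) by positivity]) (by norm_num)
  let φ : EE n → ℝ := fun z => θ z * g (r • z)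
  have hh1 : ContDiff ℝ 1 (fun z => g (r • z)) := H.g1.comp (contDiff_const_smul r)
  have hφ : ContDiff ℝ 1 φ := hθ.mul hh1
  have hφs : tsupport φ ⊆ closedBall 0 (2 * R1) := by
    refine closure_minimal ?_ isClosed_closedBall
    intro z hz
    by_contra h
    apply hz
    simp [φ, θ, hsz z h]
  have hel := H.el_scaled hr hrR hφ hφs
  have hφg : ∀ z, gradient φ z = (θ z * r) • gradient g (r • z) + (g (r • z) * (2 * s z)) • gradient s0 z := by
    intro z
    have := gradient_mul (hθ.differentiable one_ne_zero z) (hh1.differentiable one_ne_zero z)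
    rw [gradient_comp_smul (H.g1.differentiable one_ne_zero), hθg, smul_smul, smul_smul] at this
    exact this
  set B := BB n (2 * R1) with hB
  have hBc : IsCompact B := isCompact_closedBall _ _
  have e1 : ∫ z, ⟪V (r • z), gradient φ z⟫ = ∫ z in B, ⟪V (r • z), gradient φ z⟫ := by
    rw [setIntegral_eq_integral_of_forall_compl_eq_zero]
    intro z hz
    rw [gradient_zero_of_notMem (fun h => hz (hφs h)), inner_zero_right]
  have e2 : ∫ z, S (r • z) * φ z = ∫ z in B, S (r • z) * φ z := by
    rw [setIntegral_eq_integral_of_forall_compl_eq_zero]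
    intro z hz
    rw [image_eq_zero_of_notMem_tsupport (fun h => hz (hφs h)), mul_zero]
  rw [e1, e2, ← integral_const_mul] at hel
  have hI : ∀ f : EE n → ℝ, Continuous f → IntegrableOn f B := fun f hf => hf.continuousOn.integrableOn_compact hBc
  have hVr : Continuous fun z => V (r • z) := H.Vc.comp (by fun_prop)
  have hGr : Continuous fun z => gradient g (r • z) := hGc.comp (by fun_prop)
  have hgr : Continuous fun z => g (r • z) := hgc.comp (by fun_prop)
  have hSr : Continuous fun z => S (r • z) := H.Sc.comp (by fun_prop)
  have hφg' := gradient_cont hφ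
  have hθc := hθ.continuous
  set C1 := L + 2 * L ^ 2 / c with hC1
  have hC1p : 0 < C1 := by positivity
  have hpt : ∀ z ∈ B, c / 2 * (θ z * ‖gradient g (r • z)‖ ^ 2) - C1 * (1 + η / r) * g (r • z) ≤ r⁻¹ * (⟪V (r • z), gradient φ z⟫ - r * (S (r • z) * φ z)) := by
    intro z hz
    have hz' : ‖z‖ ≤ 2 * R1 := by simpa [hB] using hz
    have hrz : ‖r • z‖ ≤ R0 := by
      rw [norm_smul, Real.norm_eq_abs, abs_of_pos hr]
      exact (mul_le_mul_of_nonneg_left hz' hr.le).trans hrR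
    have hg0 := H.gpos _ hrz
    have hg1 := hg z hz'
    have hS := H.Sb _ hrz
    have hV := H.Vb (r • z)
    have hco := H.coer (r • z)
    rw [hφg, inner_add_right, inner_smul_right, inner_smul_right, hs0g, inner_smul_right]
    have hin : |⟪V (r • z), z⟫| ≤ L * ‖gradient g (r • z)‖ * (2 * R1) := (abs_real_inner_le_norm _ _).trans (mul_le_mul hV hz' (norm_nonneg _) (by positivity))
    set G := ‖gradient g (r • z)‖ with hG
    have hG0 : 0 ≤ G := norm_nonneg _
    set h := g (r • z) with hh
    set t := s z with ht
    have ht0 := hsn z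
    have ht1 := hs1 z
    have hθt : θ z = t ^ 2 := rfl
    have hφt : φ z = t ^ 2 * h := rfl
    rw [hθt, hφt]
    have hin2 : -(1 / (2 * R1 ^ 2)) * ⟪V (r • z), z⟫ ≥ - (L * G) := by
      have h3 : ⟪V (r • z), z⟫ ≤ L * G * (2 * R1) := (le_abs_self _).trans hin
      have h4 : (1 / (2 * R1 ^ 2)) * ⟪V (r • z), z⟫ ≤ (1 / (2 * R1 ^ 2)) * (L * G * (2 * R1)) := by gcongr
      have h5 : (1 / (2 * R1 ^ 2)) * (L * G * (2 * R1)) = L * G / R1 := by field_simp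
      have h6 : L * G / R1 ≤ L * G := div_le_self (by positivity) hR1
      linarith
    have a1 : h * (2 * t) * (-(1 / (2 * R1 ^ 2)) * ⟪V (r • z), z⟫) ≥ h * (2 * t) * (-(L * G)) := mul_le_mul_of_nonneg_left hin2 (by positivity)
    have a2 : t ^ 2 * r * ⟪V (r • z), gradient g (r • z)⟫ ≥ t ^ 2 * r * (c * G ^ 2) := mul_le_mul_of_nonneg_left hco (by positivity)
    have a3 : S (r • z) * (t ^ 2 * h) ≤ L * h := by
      have : t ^ 2 ≤ 1 := by nlinarith
      calc S (r • z) * (t ^ 2 * h) ≤ L * (t ^ 2 * h) :=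
            mul_le_mul_of_nonneg_right ((le_abs_self _).trans hS) (by positivity)
        _ ≤ L * (1 * h) := by gcongr
        _ = _ := by ring
    have a3' : r * (S (r • z) * (t ^ 2 * h)) ≤ r * (L * h) := mul_le_mul_of_nonneg_left a3 hr.le
    rw [inv_mul_eq_div, le_div_iff₀ hr]
    have a4 : h * (2 * t) * (L * G) ≤ r * c / 2 * (t ^ 2 * G ^ 2) + 2 * L ^ 2 / c * η * h := by
      have b1 : h * (2 * t) * (L * G) ≤ r * c / 2 * (t ^ 2 * G ^ 2) + 2 * L ^ 2 / (c * r) * h ^ 2 := by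
        have : r * c / 2 * (t ^ 2 * G ^ 2) + 2 * L ^ 2 / (c * r) * h ^ 2 - h * (2 * t) * (L * G) = (r * c * (t * G) - 2 * L * h) ^ 2 / (2 * r * c) := by field_simp; ring
        have : 0 ≤ (r * c * (t * G) - 2 * L * h) ^ 2 / (2 * r * c) := by positivity
        linarith
      have b2 : 2 * L ^ 2 / (c * r) * h ^ 2 ≤ 2 * L ^ 2 / (c * r) * (h * (η * r)) := by
        refine mul_le_mul_of_nonneg_left ?_ (by positivity)
        rw [sq]; exact mul_le_mul_of_nonneg_left hg1 hg0
      have b3 : 2 * L ^ 2 / (c * r) * (h * (η * r)) = 2 * L ^ 2 / c * η * h := by field_simp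
      linarith
    have a5 : C1 * (1 + η / r) * h * r = C1 * (r + η) * h := by field_simp
    have a6 : (L * r + 2 * L ^ 2 / c * η) * h ≤ C1 * (r + η) * h := by
      refine mul_le_mul_of_nonneg_right ?_ hg0
      have : 0 ≤ 2 * L ^ 2 / c := by positivity
      rw [hC1]; nlinarith [mul_nonneg hL.le hη, mul_nonneg this hr.le]
    have a7 : (c / 2 * (t ^ 2 * G ^ 2) - C1 * (1 + η / r) * h) * r = r * c / 2 * (t ^ 2 * G ^ 2) - C1 * (1 + η / r) * h * r := by ring
    rw [a7, a5]
    linarith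
  have hφcc := hφ.continuous
  have hin : Continuous fun z => ⟪V (r • z), gradient φ z⟫ := hVr.inner hφg'
  have hin2 : Continuous fun z => r * (S (r • z) * φ z) := continuous_const.mul (hSr.mul hφcc)
  have hD : Continuous fun z => ⟪V (r • z), gradient φ z⟫ - r * (S (r • z) * φ z) := hin.sub hin2
  have hint := setIntegral_mono_on (μ := volume) (s := B) (hI _ (by fun_prop)) ((hI _ hD).const_mul _) hBc.measurableSet hpt
  have hzero : ∫ z in B, (⟪V (r • z), gradient φ z⟫ - r * (S (r • z) * φ z)) = 0 := by rw [integral_sub (hI _ hin) (hI _ hin2), hel, sub_self]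
  rw [integral_const_mul, hzero, mul_zero, integral_sub (hI _ (by fun_prop)) (hI _ (by fun_prop)), integral_const_mul, integral_const_mul] at hint
  have hlow : (1 / 2) * ∫ z in BB n R1, ‖gradient g (r • z)‖ ^ 2 ≤ ∫ z in B, θ z * ‖gradient g (r • z)‖ ^ 2 := by
    rw [← integral_const_mul]
    refine le_trans ?_ (setIntegral_mono_set (s := closedBall (0:EE n) R1) (hI _ (by fun_prop)) (Filter.Eventually.of_forall fun z => by simp only [θ, Pi.zero_apply]; positivity) (Filter.Eventually.of_forall (closedBall_subset_closedBall (by linarith))))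
    refine setIntegral_mono_on ?_ ?_ measurableSet_closedBall ?_
    · exact ((by fun_prop : Continuous fun z => 1 / 2 * ‖gradient g (r • z)‖ ^ 2)).continuousOn.integrableOn_compact (isCompact_closedBall _ _)
    · exact ((by fun_prop : Continuous fun z => θ z * ‖gradient g (r • z)‖ ^ 2)).continuousOn.integrableOn_compact (isCompact_closedBall _ _)
    · intro z hz
      have hz' : ‖z‖ ≤ R1 := by simpa using hz
      have : 3 / 4 ≤ s z := by
        refine le_trans ?_ (le_max_left _ _)
        simp only [s0]
        have : ‖z‖ ^ 2 / (4 * R1 ^ 2) ≤ 1 / 4 := by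
          rw [div_le_iff₀ (by positivity)]
          have := pow_le_pow_left₀ (norm_nonneg _) hz' 2
          linarith
        linarith
      have : 1 / 2 ≤ θ z := by simp only [θ]; nlinarith
      gcongr
  have hfin : ∫ z in BB n R1, ‖gradient g (r • z)‖ ^ 2 ≤ 4 / c * (C1 * (1 + η / r) * ∫ z in B, g (r • z)) := by
    rw [div_mul_eq_mul_div, le_div_iff₀ hc]
    nlinarith
  calc _ ≤ _ := hfin
    _ = _ := by ring
end Loc
noncomputable def mm {n : ℕ} (g k : EE n → ℝ) (r : ℝ) : ℝ := ∫ z, g (r • z) * k z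
lemma iter_lemma {m m' : ℝ → ℝ} {C η0 η s R : ℝ} (hC : 0 ≤ C) (hη0 : 0 ≤ η0) (hη : 0 ≤ η) (hs : 1 ≤ s) (hR : 0 < R) (hm : ∀ r, HasDerivAt m (m' r) r) (hm0 : m 0 = 0) (hd : ∀ r, 0 < r → s * r ≤ R → m' r ≤ C * r + η / r * m (s * r)) (hb : ∀ r, 0 < r → r ≤ R → m r ≤ η0 * r) (hsm : η * s ^ 2 ≤ 1 / 2) {r : ℝ} (hr : 0 < r) (hrR : r ≤ R) : m r ≤ (2 * C + η0 * s / R) * r ^ 2 := by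
  set X := 2 * C + η0 * s / R with hX
  have hX0 : 0 ≤ X := by positivity
  have hηs : η * s ≤ 1 / 2 := by nlinarith
  have key : ∀ j : ℕ, ∀ r, 0 < r → r ≤ R → m r ≤ X * r ^ 2 + (1 / 2) ^ j * η0 * r := by
    intro j
    induction j with
    | zero => intro r hr hrR; have := hb r hr hrR; have : 0 ≤ X * r ^ 2 := by positivity
              simp; linarith
    | succ j ih =>
      intro r hr hrR
      by_cases hsr : s * r ≤ R
      · -- integrate
        set Y := (1 / 2 : ℝ) ^ j * η0 with hY
        have hY0 : 0 ≤ Y := by positivity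
        let b : ℝ → ℝ := fun t => m t - (X * t ^ 2 + (1 / 2) ^ (j + 1) * η0 * t)
        have hbd : ∀ t, HasDerivAt b (m' t - (X * (2 * t) + (1 / 2) ^ (j + 1) * η0)) t := by
          intro t
          have h2 : HasDerivAt (fun t : ℝ => X * t ^ 2 + (1 / 2) ^ (j + 1) * η0 * t) (X * (2 * t) + (1 / 2) ^ (j + 1) * η0) t := by
            have := ((hasDerivAt_pow 2 t).const_mul X).add ((hasDerivAt_id t).const_mul ((1 / 2) ^ (j + 1) * η0))
            refine this.congr_deriv ?_
            simp
          exact (hm t).sub h2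
        have hanti : AntitoneOn b (Icc 0 r) := by
          refine antitoneOn_of_deriv_nonpos (convex_Icc _ _) (fun t _ => (hbd t).continuousAt.continuousWithinAt) (fun t _ => (hbd t).differentiableAt.differentiableWithinAt) ?_
          intro t ht
          rw [interior_Icc] at ht
          rw [(hbd t).deriv]
          have hst : s * t ≤ R := by nlinarith [ht.1, ht.2]
          have h1 := hd t ht.1 hst
          have h2 := ih (s * t) (by have := ht.1; positivity) hst
          have h3 : η / t * m (s * t) ≤ η / t * (X * (s * t) ^ 2 + Y * (s * t)) := by
            have := ht.1
            exact mul_le_mul_of_nonneg_left h2 (by positivity)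
          have ht0 := ht.1
          have h4 : η / t * (X * (s * t) ^ 2 + Y * (s * t)) = X * (η * s ^ 2) * t + Y * (η * s) := by field_simp
          have h5 : X * (η * s ^ 2) * t ≤ X * (1 / 2) * t := by gcongr
          have h6 : Y * (η * s) ≤ Y * (1 / 2) := by gcongr
          have h7 : (1 / 2 : ℝ) ^ (j + 1) * η0 = Y * (1 / 2) := by rw [hY, pow_succ]; ring
          rw [h7]
          have h8 : C * t ≤ X * t := by
            refine mul_le_mul_of_nonneg_right ?_ ht0.le
            rw [hX]; have : 0 ≤ η0 * s / R := by positivity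
            linarith
          nlinarith [mul_nonneg hX0 ht0.le]
        have := hanti (left_mem_Icc.2 hr.le) (right_mem_Icc.2 hr.le) hr.le
        simp only [b, hm0] at this
        simp at this
        simp
        linarith
      · push Not at hsr
        have h1 := hb r hr hrR
        have h2 : η0 * r ≤ η0 * s / R * r ^ 2 := by
          rw [div_mul_eq_mul_div, le_div_iff₀ hR]
          nlinarith [mul_nonneg hη0 hr.le]
        have h3 : η0 * s / R * r ^ 2 ≤ X * r ^ 2 := by gcongr; rw [hX]; linarith
        have : 0 ≤ (1 / 2 : ℝ) ^ (j + 1) * η0 * r := by positivity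
        linarith
  have hlim : Filter.Tendsto (fun j : ℕ => X * r ^ 2 + (1 / 2 : ℝ) ^ j * η0 * r) Filter.atTop (𝓝 (X * r ^ 2 + 0 * η0 * r)) := by
    refine Filter.Tendsto.const_add _ (Filter.Tendsto.mul_const _ (Filter.Tendsto.mul_const _ ?_))
    exact tendsto_pow_atTop_nhds_zero_of_lt_one (by norm_num) (by norm_num)
  have := ge_of_tendsto' hlim fun j => key j r hr hrR
  simpa using this
namespace Loc
variable {n : ℕ} {c L R0 R1 r1 : ℝ} {g κ k S : EE n → ℝ} {V : EE n → EE n} {D : EE n →L[ℝ] EE n}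
lemma mm_eq (H : Loc n c L R0 R1 r1 g κ k S V D) (r : ℝ) : mm g k r = ∫ z in BB n R1, g (r • z) * k z := by
  unfold mm
  rw [setIntegral_eq_integral_of_forall_compl_eq_zero]
  intro z hz; rw [H.ks z hz, mul_zero]
lemma mm_deriv (H : Loc n c L R0 R1 r1 g κ k S V D) (r : ℝ) : HasDerivAt (mm g k) (∫ z in BB n R1, ⟪gradient g (r • z), z⟫ * k z) r := by
  rw [show mm g k = fun r => ∫ z in BB n R1, g (r • z) * k z from funext H.mm_eq]
  have hgc := H.g1.continuous
  have hkc := H.kc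
  have hGc := H.gg
  refine hasDerivAt_integral_compact (F := fun r z => g (r • z) * k z) (F' := fun r z => ⟪gradient g (r • z), z⟫ * k z) (isCompact_closedBall _ _) one_pos ?_ ?_ ?_
  · intro t _
    exact (by fun_prop : Continuous fun z => g (t • z) * k z).continuousOn
  · have h1 : Continuous fun x : ℝ × EE n => gradient g (x.1 • x.2) := hGc.comp (continuous_fst.smul continuous_snd)
    have h2 : Continuous fun x : ℝ × EE n => ⟪gradient g (x.1 • x.2), x.2⟫ * k x.2 := (h1.inner continuous_snd).mul (hkc.comp continuous_snd)
    exact h2.continuousOn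
  · intro t _ z _
    have h1 : HasDerivAt (fun t : ℝ => t • z) z t := by simpa using (hasDerivAt_id t).smul_const z
    have h2 := ((H.g1.differentiable one_ne_zero (t • z)).hasFDerivAt).comp_hasDerivAt t h1
    rw [inner_gradient_left]
    exact h2.mul_const (k z)
lemma deriv_formula (H : Loc n c L R0 R1 r1 g κ k S V D) {r : ℝ} (hr : 0 < r) (hrR : r * R1 ≤ R0) : |(∫ z in BB n R1, ⟪gradient g (r • z), z⟫ * k z) + r * ∫ z, S (r • z) * κ z| ≤ L ^ 2 * ∫ z in BB n R1, ‖gradient g (r • z)‖ ^ 2 := by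
  rw [← H.el_scaled hr hrR H.κ1 H.κs]
  have hL := H.hL
  set B := BB n R1 with hB
  have hBc : IsCompact B := isCompact_closedBall _ _
  have hI : ∀ f : EE n → ℝ, Continuous f → IntegrableOn f B := fun f hf => hf.continuousOn.integrableOn_compact hBc
  have hVr : Continuous fun z => V (r • z) := H.Vc.comp (by fun_prop)
  have hGr : Continuous fun z => gradient g (r • z) := H.gg.comp (by fun_prop)
  have hκg := gradient_cont H.κ1
  have hkc := H.kc
  have e1 : ∫ z, ⟪V (r • z), gradient κ z⟫ = ∫ z in B, ⟪V (r • z), gradient κ z⟫ := by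
    rw [setIntegral_eq_integral_of_forall_compl_eq_zero]
    intro z hz
    rw [gradient_zero_of_notMem (fun h => hz (H.κs h)), inner_zero_right]
  have hc1 : Continuous fun z => ⟪gradient g (r • z), z⟫ * k z := (hGr.inner continuous_id).mul hkc
  have hc2 : Continuous fun z => ⟪V (r • z), gradient κ z⟫ := hVr.inner hκg
  rw [e1, ← integral_add (hI _ hc1) (hI _ hc2), ← integral_const_mul, ← Real.norm_eq_abs]
  refine norm_integral_le_of_norm_le ((hI _ (by fun_prop)).const_mul _) ?_
  refine Filter.Eventually.of_forall fun z => ?_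
  have h1 : ⟪gradient g (r • z), z⟫ * k z + ⟪V (r • z), gradient κ z⟫ = ⟪V (r • z) - D (gradient g (r • z)), gradient κ z⟫ := by rw [inner_sub_left, H.Dκ]; ring
  rw [h1, Real.norm_eq_abs]
  calc _ ≤ _ := abs_real_inner_le_norm _ _
    _ ≤ (L * ‖gradient g (r • z)‖ ^ 2) * L := mul_le_mul (H.VD _) (H.κg z) (norm_nonneg _) (by positivity)
    _ = _ := by ring
lemma ball_le (H : Loc n c L R0 R1 r1 g κ k S V D) {r a : ℝ} (hr : 0 < r) (ha : 0 < a) (hrR : r * (a / r1) * R1 ≤ R0) : ∫ z in BB n a, g (r • z) ≤ (a / r1) ^ n * mm g k (r * (a / r1)) := by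
  have hr1 := H.hr1
  set b := a / r1 with hb
  have hb0 : 0 < b := by positivity
  have hgc := H.g1.continuous
  have hkc := H.kc
  have h := Measure.setIntegral_comp_smul_of_pos (volume : Measure (EE n)) (fun z => g (r • z)) (BB n r1) hb0
  rw [smul_closedBall _ _ hr1.le, smul_zero, Real.norm_eq_abs, abs_of_pos hb0, show b * r1 = a by rw [hb]; field_simp, smul_eq_mul, finrank_euclideanSpace_fin] at h
  have h2 : ∫ z in BB n a, g (r • z) = b ^ n * ∫ z in BB n r1, g (r • b • z) := by rw [h]; field_simp
  rw [h2]
  refine mul_le_mul_of_nonneg_left ?_ (by positivity)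
  rw [H.mm_eq]
  have hnn : ∀ z ∈ BB n R1, 0 ≤ g ((r * b) • z) := by
    intro z hz
    apply H.gpos
    have hz : ‖z‖ ≤ R1 := by simpa using hz
    rw [norm_smul, Real.norm_eq_abs, abs_of_pos (by positivity)]
    exact (mul_le_mul_of_nonneg_left hz (by positivity)).trans hrR
  have hsub : BB n r1 ⊆ closedBall 0 R1 := closedBall_subset_closedBall (H.hr1'.trans H.hR1)
  have hI : ∀ (ρ : ℝ) (f : EE n → ℝ), Continuous f → IntegrableOn f (closedBall (0:EE n) ρ) := fun ρ f hf => hf.continuousOn.integrableOn_compact (isCompact_closedBall _ _)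
  calc ∫ z in BB n r1, g (r • b • z)
      ≤ ∫ z in BB n r1, g ((r * b) • z) * k z := by
        refine setIntegral_mono_on (hI _ _ (by fun_prop)) (hI _ _ (by fun_prop)) measurableSet_closedBall ?_
        intro z hz
        rw [smul_smul]
        exact le_mul_of_one_le_right (hnn z (hsub hz)) (H.klow z (by simpa using hz))
    _ ≤ _ := by
        refine setIntegral_mono_set (hI _ _ (by fun_prop)) ?_ (Filter.Eventually.of_forall hsub)
        refine (ae_restrict_iff' measurableSet_closedBall).2 (Filter.Eventually.of_forall ?_)
        intro z hz
        exact mul_nonneg (hnn z hz) (H.k0 z)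
lemma deriv_est (H : Loc n c L R0 R1 r1 g κ k S V D) {r η : ℝ} (hr : 0 < r) (hη : 0 ≤ η) (hrR : r * (2 * R1 / r1) * R1 ≤ R0) (hg : ∀ z, ‖z‖ ≤ 2 * R1 → g (r • z) ≤ η * r) : |(∫ z in BB n R1, ⟪gradient g (r • z), z⟫ * k z) + r * ∫ z, S (r • z) * κ z| ≤ (L ^ 2 * (4 / c * (L + 2 * L ^ 2 / c)) * (2 * R1 / r1) ^ n) * (1 + η / r) * mm g k (r * (2 * R1 / r1)) := by
  have hR1 := H.hR1
  have hr1 := H.hr1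
  have hc := H.hc
  have hL := H.hL
  have h1 : 2 * R1 ≤ 2 * R1 / r1 := by rw [le_div_iff₀ hr1]; nlinarith [H.hr1']
  have h2 : 2 * R1 / r1 ≤ 2 * R1 / r1 * R1 := le_mul_of_one_le_right (by positivity) hR1
  have h3 : r * (2 * R1) ≤ R0 := by
    refine le_trans ?_ hrR
    rw [mul_assoc]; exact mul_le_mul_of_nonneg_left (h1.trans h2) hr.le
  have h4 : r * R1 ≤ R0 := le_trans (mul_le_mul_of_nonneg_left (by linarith) hr.le) h3
  have a1 := H.deriv_formula hr h4
  have a2 := H.cacc hr h3 hη hg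
  have a3 := H.ball_le hr (a := 2 * R1) (by positivity) hrR
  refine a1.trans ?_
  calc _ ≤ L ^ 2 * ((4 / c * (L + 2 * L ^ 2 / c)) * (1 + η / r) *
        ((2 * R1 / r1) ^ n * mm g k (r * (2 * R1 / r1)))) := by
        refine mul_le_mul_of_nonneg_left (a2.trans ?_) (by positivity)
        exact mul_le_mul_of_nonneg_left a3 (by positivity)
    _ = _ := by ring
end Loc
noncomputable def Ck (n : ℕ) (c L R1 r1 : ℝ) : ℝ := L ^ 2 * (4 / c * (L + 2 * L ^ 2 / c)) * (2 * R1 / r1) ^ n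
noncomputable def etaQ (n : ℕ) (c L R1 r1 : ℝ) : ℝ := 1 / (2 * (2 * R1 / r1) ^ 2 * Ck n c L R1 r1 * (1 + 2 * R1))
lemma Ck_pos {n : ℕ} {c L R1 r1 : ℝ} (hc : 0 < c) (hL : 0 < L) (hR1 : 1 ≤ R1) (hr1 : 0 < r1) : 0 < Ck n c L R1 r1 := by unfold Ck; positivity
lemma etaQ_pos {n : ℕ} {c L R1 r1 : ℝ} (hc : 0 < c) (hL : 0 < L) (hR1 : 1 ≤ R1) (hr1 : 0 < r1) : 0 < etaQ n c L R1 r1 := by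
  have := Ck_pos (n := n) hc hL hR1 hr1
  unfold etaQ; positivity
namespace Loc
variable {n : ℕ} {c L R0 R1 r1 : ℝ} {g κ k S : EE n → ℝ} {V : EE n → EE n} {D : EE n →L[ℝ] EE n}
lemma mm_zero (H : Loc n c L R0 R1 r1 g κ k S V D) : mm g k 0 = 0 := by simp [mm, H.g0]
lemma mm_nonneg (H : Loc n c L R0 R1 r1 g κ k S V D) {r : ℝ} (hr : 0 ≤ r) (hrR : r * R1 ≤ R0) : 0 ≤ mm g k r := by
  rw [H.mm_eq]
  refine setIntegral_nonneg measurableSet_closedBall fun z hz => ?_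
  refine mul_nonneg (H.gpos _ ?_) (H.k0 z)
  rw [norm_smul, Real.norm_eq_abs, abs_of_nonneg hr]
  exact (mul_le_mul_of_nonneg_left (by simpa using hz) hr).trans hrR
lemma Sκ_bound (H : Loc n c L R0 R1 r1 g κ k S V D) {r : ℝ} (hr : 0 ≤ r) (hrR : r * R1 ≤ R0) : |∫ z, S (r • z) * κ z| ≤ L * volume.real (BB n R1) := by
  have hL := H.hL
  have : ∫ z, S (r • z) * κ z = ∫ z in BB n R1, S (r • z) * κ z := by
    rw [setIntegral_eq_integral_of_forall_compl_eq_zero]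
    intro z hz
    rw [image_eq_zero_of_notMem_tsupport (fun h => hz (H.κs h)), mul_zero]
  rw [this, ← Real.norm_eq_abs]
  refine norm_setIntegral_le_of_norm_le_const (isCompact_closedBall _ _).measure_lt_top ?_
  intro z hz
  rw [norm_mul, Real.norm_eq_abs, Real.norm_eq_abs, abs_of_nonneg (H.κ0 z)]
  have : |S (r • z)| ≤ L := by
    apply H.Sb
    rw [norm_smul, Real.norm_eq_abs, abs_of_nonneg hr]
    exact (mul_le_mul_of_nonneg_left (by simpa using hz) hr).trans hrR
  calc _ ≤ L * 1 := mul_le_mul this (H.κle z) (H.κ0 z) hL.le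
    _ = L := mul_one L
lemma quad (H : Loc n c L R0 R1 r1 g κ k S V D) {R : ℝ} (hR : 0 < R) (hRη : R ≤ etaQ n c L R1 r1) (hRR : R * R1 ≤ R0) (hg : ∀ z, ‖z‖ ≤ R * R1 → g z ≤ etaQ n c L R1 r1 * ‖z‖) {r : ℝ} (hr : 0 < r) (hrR : r ≤ R) : mm g k r ≤ (2 * (L * volume.real (BB n R1)) + (2 * etaQ n c L R1 r1 * R1 * volume.real (BB n R1)) * (2 * R1 / r1) / R) * r ^ 2 := by
  have hL := H.hL
  have hR1 := H.hR1
  have hr1 := H.hr1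
  have hη := etaQ_pos (n := n) H.hc hL hR1 hr1
  have hCk := Ck_pos (n := n) H.hc hL hR1 hr1
  set η := etaQ n c L R1 r1 with hηd
  set s := 2 * R1 / r1 with hs
  set v := volume.real (BB n R1) with hv
  have hv0 : 0 ≤ v := measureReal_nonneg
  have hs2 : 2 * R1 ≤ s := by rw [hs, le_div_iff₀ hr1]; nlinarith [H.hr1']
  have hs0 : 0 < s := by positivity
  have hηC : Ck n c L R1 r1 * (1 + 2 * R1) * η = 1 / (2 * s ^ 2) := by rw [hηd, etaQ, ← hs]; field_simp
  refine iter_lemma (m := mm g k) (η := 1 / (2 * s ^ 2)) (by positivity) (by positivity) (by positivity) (by linarith) hR H.mm_deriv H.mm_zero ?_ ?_ ?_ hr hrR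
  · intro t ht htR
    have h1 : t ≤ R := by nlinarith
    have htR1 : t * R1 ≤ R0 := (mul_le_mul_of_nonneg_right h1 (by linarith)).trans hRR
    have hts : t * s * R1 ≤ R0 := by
      refine le_trans (mul_le_mul_of_nonneg_right ?_ (by linarith)) hRR
      linarith
    have h2 := H.deriv_est ht (η := 2 * R1 * η) (by positivity) hts ?_
    · have h3 := H.Sκ_bound ht.le htR1
      have h4 := (abs_le.1 h2).2
      have h5 := (abs_le.1 h3).1
      have h6 : mm g k (t * s) = mm g k (s * t) := by rw [mul_comm]
      rw [h6] at h4
      have h7 : 0 ≤ mm g k (s * t) := H.mm_nonneg (by positivity) (by rw [mul_comm s t]; exact hts)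
      have h8 : Ck n c L R1 r1 * (1 + 2 * R1 * η / t) ≤ 1 / (2 * s ^ 2) / t := by
        rw [← hηC, le_div_iff₀ ht]
        have : Ck n c L R1 r1 * (1 + 2 * R1 * η / t) * t = Ck n c L R1 r1 * (t + 2 * R1 * η) := by field_simp
        rw [this, mul_assoc (Ck n c L R1 r1) (1 + 2 * R1) η]
        refine mul_le_mul_of_nonneg_left ?_ hCk.le
        linarith
      have h9 := mul_le_mul_of_nonneg_right h8 h7
      have h10 : -(t * ∫ z, S (t • z) * κ z) ≤ L * v * t := by nlinarith
      unfold Ck at h9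
      linarith
    · intro z hz
      have hz' : ‖t • z‖ ≤ 2 * R1 * t := by
        rw [norm_smul, Real.norm_eq_abs, abs_of_pos ht, mul_comm]
        exact mul_le_mul_of_nonneg_right hz ht.le
      refine (hg _ ?_).trans ?_
      · refine hz'.trans ?_
        calc 2 * R1 * t ≤ s * t := by gcongr
          _ ≤ R := htR
          _ ≤ R * R1 := le_mul_of_one_le_right hR.le hR1
      · calc _ ≤ η * (2 * R1 * t) := by gcongr
          _ = _ := by ring
  · intro t ht htR
    rw [H.mm_eq]
    have : ‖∫ z in BB n R1, g (t • z) * k z‖ ≤ (η * (t * R1) * 2) * v := by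
      refine norm_setIntegral_le_of_norm_le_const (isCompact_closedBall _ _).measure_lt_top ?_
      intro z hz
      have hz : ‖z‖ ≤ R1 := by simpa using hz
      have hn : ‖t • z‖ ≤ t * R1 := by rw [norm_smul, Real.norm_eq_abs, abs_of_pos ht]; gcongr
      have hn2 : ‖t • z‖ ≤ R * R1 := hn.trans (by gcongr)
      have h0 := H.gpos _ (hn2.trans hRR)
      rw [norm_mul, Real.norm_eq_abs, Real.norm_eq_abs, abs_of_nonneg h0, abs_of_nonneg (H.k0 z)]
      refine mul_le_mul ?_ (H.kle z) (H.k0 z) (by positivity)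
      refine (hg _ hn2).trans (by gcongr)
    rw [Real.norm_eq_abs] at this
    refine (le_abs_self _).trans (this.trans (le_of_eq ?_))
    ring
  · have : 1 / (2 * s ^ 2) * s ^ 2 = 1 / 2 := by field_simp
    rw [this]
lemma limit (H : Loc n c L R0 R1 r1 g κ k S V D) (hg0 : gradient g 0 = 0) : Filter.Tendsto (fun r => mm g k r / r ^ 2) (𝓝[>] 0) (𝓝 (- S 0 * (∫ z, κ z) / 2)) := by
  have hL := H.hL
  have hR1 := H.hR1
  have hr1 := H.hr1
  have hR0 := H.hR0
  have hη := etaQ_pos (n := n) H.hc hL hR1 hr1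
  have hCk := Ck_pos (n := n) H.hc hL hR1 hr1
  set s := 2 * R1 / r1 with hs
  have hs2 : 2 * R1 ≤ s := by rw [hs, le_div_iff₀ hr1]; nlinarith [H.hr1']
  have hs0 : 0 < s := by positivity
  have hsmall : ∀ η > 0, ∃ δ > 0, ∀ z, ‖z‖ ≤ δ → g z ≤ η * ‖z‖ := by
    intro η hη
    have hd : HasFDerivAt g (0 : EE n →L[ℝ] ℝ) 0 := by
      have h := (H.g1.differentiable one_ne_zero 0).hasGradientAt
      rw [hg0] at h
      have := h.hasFDerivAt
      simpa using this
    have := hd.isLittleO.bound hη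
    obtain ⟨δ, hδ, hb⟩ := Metric.eventually_nhds_iff.1 this
    refine ⟨δ / 2, by positivity, fun z hz => ?_⟩
    have := hb (y := z) (by rw [dist_zero_right]; linarith)
    simp [H.g0] at this
    exact (le_abs_self _).trans this
  obtain ⟨X, R, hX, hR, hRR, hq⟩ : ∃ X R, 0 ≤ X ∧ 0 < R ∧ R * R1 ≤ R0 ∧ ∀ r, 0 < r → r ≤ R → mm g k r ≤ X * r ^ 2 := by
    obtain ⟨δ, hδ, hb⟩ := hsmall _ hη
    let R := min (etaQ n c L R1 r1) (min (R0 / R1) (δ / R1))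
    have hR : 0 < R := by positivity
    have e1 : R * R1 ≤ R0 := by rw [← le_div_iff₀ (by linarith)]; exact (min_le_right _ _).trans (min_le_left _ _)
    have e2 : R * R1 ≤ δ := by rw [← le_div_iff₀ (by linarith)]; exact (min_le_right _ _).trans (min_le_right _ _)
    refine ⟨_, R, ?_, hR, e1, fun r h1 h2 => H.quad hR (min_le_left _ _) e1 (fun z hz => hb z (hz.trans e2)) h1 h2⟩
    positivity
  have hI : Filter.Tendsto (fun r : ℝ => ∫ z, S (r • z) * κ z) (𝓝[>] 0) (𝓝 (S 0 * ∫ z, κ z)) := by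
    have hc : Continuous fun r : ℝ => ∫ z in BB n R1, S (r • z) * κ z := by
      have h1 : Continuous (Function.uncurry fun (r : ℝ) (z : EE n) => S (r • z) * κ z) := (H.Sc.comp (continuous_fst.smul continuous_snd)).mul (H.κ1.continuous.comp continuous_snd)
      exact continuous_parametric_integral_of_continuous h1 (isCompact_closedBall _ _)
    have he : (fun r : ℝ => ∫ z, S (r • z) * κ z) = fun r : ℝ => ∫ z in BB n R1, S (r • z) * κ z := by
      funext r
      rw [setIntegral_eq_integral_of_forall_compl_eq_zero]
      intro z hz
      rw [image_eq_zero_of_notMem_tsupport (fun h => hz (H.κs h)), mul_zero]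
    have h0 : S 0 * ∫ z, κ z = (fun r : ℝ => ∫ z, S (r • z) * κ z) 0 := by simp [integral_const_mul]
    rw [h0, he]
    exact (hc.tendsto 0).mono_left nhdsWithin_le_nhds
  have hder : Filter.Tendsto (fun r : ℝ => (∫ z in BB n R1, ⟪gradient g (r • z), z⟫ * k z) / (2 * r)) (𝓝[>] 0) (𝓝 (- S 0 * (∫ z, κ z) / 2)) := by
    have hz : Filter.Tendsto (fun r : ℝ => (∫ z in BB n R1, ⟪gradient g (r • z), z⟫ * k z) / r + ∫ z, S (r • z) * κ z) (𝓝[>] 0) (𝓝 0) := by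
      rw [Metric.tendsto_nhds]
      intro e he
      obtain ⟨δ, hδ, hb⟩ := hsmall (e / (4 * R1 * Ck n c L R1 r1 * (X + 1) * s ^ 2)) (by positivity)
      set η := e / (4 * R1 * Ck n c L R1 r1 * (X + 1) * s ^ 2) with hηd
      set T := e / (4 * Ck n c L R1 r1 * (X + 1) * s ^ 2) with hT
      have hT0 : 0 < T := by positivity
      have hev : ∀ᶠ r in 𝓝[>] (0 : ℝ), r ∈ Ioo 0 (min (R / s) (min (δ / (2 * R1)) T)) := Ioo_mem_nhdsGT (by positivity)
      filter_upwards [hev] with r hr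
      obtain ⟨hr0, hr2⟩ := hr
      have a1 : r ≤ R / s := hr2.le.trans (min_le_left _ _)
      have a2 : r ≤ δ / (2 * R1) := hr2.le.trans ((min_le_right _ _).trans (min_le_left _ _))
      have a3 : r < T := hr2.trans_le ((min_le_right _ _).trans (min_le_right _ _))
      rw [le_div_iff₀ hs0] at a1
      rw [le_div_iff₀ (by positivity)] at a2
      have hm := hq (r * s) (by positivity) a1
      have hrs : r * s * R1 ≤ R0 := le_trans (by gcongr) hRR
      have hd := H.deriv_est hr0 (η := η * (2 * R1)) (by positivity) hrs ?_
      · rw [dist_zero_right, Real.norm_eq_abs]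
        have e1 : (∫ z in BB n R1, ⟪gradient g (r • z), z⟫ * k z) / r + ∫ z, S (r • z) * κ z = ((∫ z in BB n R1, ⟪gradient g (r • z), z⟫ * k z) + r * ∫ z, S (r • z) * κ z) / r := by field_simp
        rw [e1, abs_div, abs_of_pos hr0, div_lt_iff₀ hr0]
        refine hd.trans_lt ?_
        have : Ck n c L R1 r1 * (1 + η * (2 * R1) / r) * mm g k (r * s) ≤ Ck n c L R1 r1 * (1 + η * (2 * R1) / r) * ((X + 1) * (r * s) ^ 2) := by
          refine mul_le_mul_of_nonneg_left (hm.trans ?_) (by positivity)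
          nlinarith [sq_nonneg (r * s)]
        refine this.trans_lt ?_
        have e2 : Ck n c L R1 r1 * (1 + η * (2 * R1) / r) * ((X + 1) * (r * s) ^ 2) = (Ck n c L R1 r1 * (X + 1) * s ^ 2 * r + Ck n c L R1 r1 * (X + 1) * s ^ 2 * (η * (2 * R1))) * r := by field_simp
        rw [e2]
        refine mul_lt_mul_of_pos_right ?_ hr0
        have e3 : Ck n c L R1 r1 * (X + 1) * s ^ 2 * (η * (2 * R1)) = e / 2 := by rw [hηd]; field_simp; ring
        have e4 : Ck n c L R1 r1 * (X + 1) * s ^ 2 * T = e / 4 := by rw [hT]; field_simp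
        have e5 : Ck n c L R1 r1 * (X + 1) * s ^ 2 * r < Ck n c L R1 r1 * (X + 1) * s ^ 2 * T := by gcongr
        linarith
      · intro z hz
        have hn : ‖r • z‖ ≤ r * (2 * R1) := by rw [norm_smul, Real.norm_eq_abs, abs_of_pos hr0]; gcongr
        refine (hb _ (hn.trans a2)).trans ?_
        calc _ ≤ η * (r * (2 * R1)) := by gcongr
          _ = _ := by ring
    have := (hz.sub hI).div_const 2
    rw [show (0 - S 0 * ∫ z, κ z) / 2 = - S 0 * (∫ z, κ z) / 2 by ring] at this
    refine this.congr' ?_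
    filter_upwards with r
    rw [add_sub_cancel_right, div_div, mul_comm r 2]
  refine HasDerivAt.lhopital_zero_nhdsGT (f' := fun r => ∫ z in BB n R1, ⟪gradient g (r • z), z⟫ * k z) (g' := fun r => 2 * r) (Filter.Eventually.of_forall H.mm_deriv) (Filter.Eventually.of_forall fun r => by simpa using hasDerivAt_pow 2 r) ?_ ?_ ?_ hder
  · filter_upwards [self_mem_nhdsWithin] with r hr
    have : (0:ℝ) < r := hr
    positivity
  · have := (H.mm_deriv 0).continuousAt.tendsto
    rw [H.mm_zero] at this
    exact this.mono_left nhdsWithin_le_nhds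
  · have : Continuous fun r : ℝ => r ^ 2 := by fun_prop
    have := this.tendsto 0
    simp only [ne_eq, OfNat.ofNat_ne_zero, not_false_eq_true, zero_pow] at this
    exact this.mono_left nhdsWithin_le_nhds
end Loc
section
variable {n : ℕ} {ε p : ℝ}
lemma AA_contDiff (hε : 0 < ε) (p : ℝ) : ContDiff ℝ 2 (AA (n := n) ε p) := by
  unfold AA
  refine ContDiff.smul (ContDiff.rpow_const_of_ne (contDiff_const.add (contDiff_norm_sq ℝ)) ?_) contDiff_id
  intro x; positivity
noncomputable def DA (ε p : ℝ) (q : EE n) : EE n →L[ℝ] EE n := fderiv ℝ (AA ε p) q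
lemma AA_hasFDerivAt (hε : 0 < ε) (p : ℝ) (q : EE n) : HasFDerivAt (AA ε p) (DA ε p q) q := ((AA_contDiff hε p).differentiable two_ne_zero q).hasFDerivAt
lemma DA_apply (hε : 0 < ε) (p : ℝ) (q v : EE n) : DA ε p q v = (ε + ‖q‖ ^ 2) ^ (p / 2 - 1) • v + ((p - 2) * (ε + ‖q‖ ^ 2) ^ (p / 2 - 2) * ⟪q, v⟫) • q := by
  have h1 : HasFDerivAt (fun q : EE n => ε + ‖q‖ ^ 2) (2 • innerSL ℝ q) q := (hasStrictFDerivAt_norm_sq q).hasFDerivAt.const_add ε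
  have h2 := h1.rpow_const (p := p / 2 - 1) (Or.inl (by positivity))
  have h3 := h2.smul (hasFDerivAt_id q)
  have : DA ε p q = _ := h3.fderiv
  rw [this]
  simp
  rw [show p / 2 - 1 - 1 = p / 2 - 2 by ring]
  congr 1
  ring
lemma DA_symm (hε : 0 < ε) (p : ℝ) (q v w : EE n) : ⟪DA ε p q v, w⟫ = ⟪v, DA ε p q w⟫ := by
  rw [DA_apply hε, DA_apply hε, inner_add_left, inner_add_right, inner_smul_left, inner_smul_left, inner_smul_right, inner_smul_right, real_inner_comm q v]
  simp; ring
lemma DA_coer (hε : 0 < ε) (hp : 1 < p) (q v : EE n) : min 1 (p - 1) * (ε + ‖q‖ ^ 2) ^ (p / 2 - 1) * ‖v‖ ^ 2 ≤ ⟪DA ε p q v, v⟫ := by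
  rw [DA_apply hε, inner_add_left, inner_smul_left, inner_smul_left]
  simp only [conj_trivial, real_inner_self_eq_norm_sq]
  set h := ε + ‖q‖ ^ 2 with hh
  have hh0 : 0 < h := by positivity
  have e1 : h ^ (p / 2 - 1) = h ^ (p / 2 - 2) * h := by rw [← Real.rpow_add_one hh0.ne']; congr 1; ring
  have hx : 0 < h ^ (p / 2 - 2) := by positivity
  rw [e1]
  set X := h ^ (p / 2 - 2)
  have hcs : ⟪q, v⟫ ^ 2 ≤ h * ‖v‖ ^ 2 := by
    have : ⟪q, v⟫ ^ 2 ≤ (‖q‖ * ‖v‖) ^ 2 := sq_le_sq.2 (by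
      rw [abs_of_nonneg (by positivity : 0 ≤ ‖q‖ * ‖v‖)]; exact abs_real_inner_le_norm q v)
    rw [mul_pow] at this
    refine this.trans (mul_le_mul_of_nonneg_right ?_ (by positivity))
    linarith
  have hkey : min 1 (p - 1) * (h * ‖v‖ ^ 2) ≤ h * ‖v‖ ^ 2 + (p - 2) * ⟪q, v⟫ ^ 2 := by
    have h0 : 0 ≤ h * ‖v‖ ^ 2 := by positivity
    rcases le_total p 2 with h2 | h2
    · have : min 1 (p - 1) ≤ p - 1 := min_le_right _ _
      nlinarith [mul_le_mul_of_nonneg_right this h0]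
    · have : min 1 (p - 1) ≤ 1 := min_le_left _ _
      nlinarith [mul_le_mul_of_nonneg_right this h0, sq_nonneg ⟪q, v⟫]
  calc _ = X * (min 1 (p - 1) * (h * ‖v‖ ^ 2)) := by ring
    _ ≤ X * (h * ‖v‖ ^ 2 + (p - 2) * ⟪q, v⟫ ^ 2) := mul_le_mul_of_nonneg_left hkey hx.le
    _ = _ := by ring
lemma AA_bounds (hε : 0 < ε) (hp : 1 < p) {M : ℝ} (hM : 0 ≤ M) : ∃ c L : ℝ, 0 < c ∧ 0 < L ∧ ∀ q q' : EE n, ‖q‖ ≤ M → ‖q'‖ ≤ M → (∀ v, c * ‖v‖ ^ 2 ≤ ⟪DA ε p q v, v⟫) ∧ (∀ v, ‖DA ε p q v‖ ≤ L * ‖v‖) ∧ c * ‖q - q'‖ ^ 2 ≤ ⟪AA ε p q - AA ε p q', q - q'⟫ ∧ ‖AA ε p q - AA ε p q'‖ ≤ L * ‖q - q'‖ ∧ ‖AA ε p q - AA ε p q' - DA ε p q (q - q')‖ ≤ L * ‖q - q'‖ ^ 2 := by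
  set B := BB n M with hB
  have hBc : IsCompact B := isCompact_closedBall _ _
  have hBne : B.Nonempty := ⟨0, by simpa [hB] using hM⟩
  have hmem : ∀ q : EE n, ‖q‖ ≤ M ↔ q ∈ B := fun q => by simp [hB]
  have hh : Continuous fun q : EE n => (ε + ‖q‖ ^ 2) ^ (p / 2 - 1) := Continuous.rpow_const (by fun_prop) fun x => Or.inl (by positivity)
  obtain ⟨q0, hq0, hmin⟩ := hBc.exists_isMinOn hBne hh.continuousOn
  have hm : 0 < min 1 (p - 1) := lt_min one_pos (by linarith)
  set c := min 1 (p - 1) * (ε + ‖q0‖ ^ 2) ^ (p / 2 - 1) with hc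
  have hc0 : 0 < c := by positivity
  have hDc : Continuous (DA (n := n) ε p) := (AA_contDiff hε p).continuous_fderiv two_ne_zero
  obtain ⟨L1, hL1⟩ := hBc.exists_bound_of_continuousOn hDc.continuousOn
  have hDC1 : ContDiff ℝ 1 (DA (n := n) ε p) := (AA_contDiff hε p).fderiv_right (by norm_num)
  have hDDc : Continuous (fderiv ℝ (DA (n := n) ε p)) := hDC1.continuous_fderiv one_ne_zero
  obtain ⟨L2, hL2⟩ : ∃ C, ∀ x ∈ B, ‖fderiv ℝ (DA (n := n) ε p) x‖ ≤ C := IsCompact.exists_bound_of_continuousOn (f := fderiv ℝ (DA (n := n) ε p)) hBc hDDc.continuousOn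
  have hconv : Convex ℝ B := convex_closedBall _ _
  set L := max 1 (max L1 L2) with hL
  have hL10 : L1 ≤ L := (le_max_left _ _).trans (le_max_right _ _)
  have hL20 : L2 ≤ L := (le_max_right _ _).trans (le_max_right _ _)
  have hco : ∀ q ∈ B, ∀ v, c * ‖v‖ ^ 2 ≤ ⟪DA ε p q v, v⟫ := by
    intro q hq v
    refine le_trans ?_ (DA_coer hε hp q v)
    refine mul_le_mul_of_nonneg_right ?_ (by positivity)
    exact mul_le_mul_of_nonneg_left (hmin hq) hm.le
  have hDL : ∀ x ∈ B, ∀ y ∈ B, ‖DA ε p x - DA ε p y‖ ≤ L * ‖x - y‖ := by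
    intro x hx y hy
    exact hconv.norm_image_sub_le_of_norm_fderiv_le (𝕜 := ℝ) (fun z _ => hDC1.differentiable one_ne_zero z) (fun z hz => (hL2 z hz).trans hL20) hy hx
  refine ⟨c, L, hc0, lt_of_lt_of_le one_pos (le_max_left _ _), fun q q' hq hq' => ?_⟩
  rw [hmem] at hq hq'
  refine ⟨hco q hq, ?_, ?_, ?_, ?_⟩
  · intro v
    exact (ContinuousLinearMap.le_opNorm _ _).trans (mul_le_mul_of_nonneg_right ((hL1 q hq).trans hL10) (norm_nonneg _))
  · -- mean value
    let f : ℝ → ℝ := fun t => ⟪AA ε p (q' + t • (q - q')), q - q'⟫ - c * ‖q - q'‖ ^ 2 * t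
    have hf : ∀ t, HasDerivAt f (⟪DA ε p (q' + t • (q - q')) (q - q'), q - q'⟫ - c * ‖q - q'‖ ^ 2) t := by
      intro t
      have h1 : HasDerivAt (fun t : ℝ => q' + t • (q - q')) (q - q') t := by simpa using ((hasDerivAt_id t).smul_const (q - q')).const_add q'
      have h2 := (AA_hasFDerivAt hε p (q' + t • (q - q'))).comp_hasDerivAt t h1
      have h3 := (h2.inner ℝ (hasDerivAt_const t (q - q'))).sub ((hasDerivAt_id t).const_mul (c * ‖q - q'‖ ^ 2))
      refine h3.congr_deriv ?_
      simp
    have hmono : MonotoneOn f (Icc 0 1) := by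
      refine monotoneOn_of_deriv_nonneg (convex_Icc _ _) (fun t _ => (hf t).continuousAt.continuousWithinAt) (fun t _ => (hf t).differentiableAt.differentiableWithinAt) ?_
      intro t ht
      rw [interior_Icc] at ht
      rw [(hf t).deriv]
      have hin : q' + t • (q - q') ∈ B := by
        have := hconv hq' hq (by linarith [ht.2] : 0 ≤ 1 - t) ht.1.le (by ring)
        convert this using 1
        module
      linarith [hco _ hin (q - q')]
    have := hmono (left_mem_Icc.2 zero_le_one) (right_mem_Icc.2 zero_le_one) zero_le_one
    simp [f] at this
    rw [inner_sub_left]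
    linarith
  · exact hconv.norm_image_sub_le_of_norm_fderiv_le (𝕜 := ℝ) (fun z _ => (AA_contDiff hε p).differentiable two_ne_zero z) (fun z hz => (hL1 z hz).trans hL10) hq' hq
  · have hseg : segment ℝ q q' ⊆ B := hconv.segment_subset hq hq'
    have h1 := (convex_segment q q').norm_image_sub_le_of_norm_hasFDerivWithin_le' (f := AA ε p) (f' := DA ε p) (φ := DA ε p q) (C := L * ‖q - q'‖) (x := q') (y := q) (fun z _ => (AA_hasFDerivAt hε p z).hasFDerivWithinAt) ?_ (right_mem_segment ℝ q q') (left_mem_segment ℝ q q')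
    · refine h1.trans (le_of_eq ?_); ring
    · intro z hz
      refine (hDL z (hseg hz) q hq).trans ?_
      refine mul_le_mul_of_nonneg_left ?_ (by positivity)
      have := norm_sub_le_of_mem_segment hz
      rwa [norm_sub_rev q q']
end
section
variable {n : ℕ}
noncomputable def NN (D : EE n →L[ℝ] EE n) (z : EE n) : ℝ := ⟪D.inverse z, z⟫
noncomputable def kap (D : EE n →L[ℝ] EE n) (z : EE n) : ℝ := (max (1 - NN D z) 0) ^ 2 / 2
noncomputable def kk (D : EE n →L[ℝ] EE n) (z : EE n) : ℝ := 2 * max (1 - NN D z) 0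
lemma inverse_props {D : EE n →L[ℝ] EE n} {c L : ℝ} (hc : 0 < c) (hL : 0 < L) (hsym : ∀ v w, ⟪D v, w⟫ = ⟪v, D w⟫) (hco : ∀ v, c * ‖v‖ ^ 2 ≤ ⟪D v, v⟫) (hb : ∀ v, ‖D v‖ ≤ L * ‖v‖) : (∀ z, D (D.inverse z) = z) ∧ (∀ z w, ⟪D.inverse z, w⟫ = ⟪z, D.inverse w⟫) ∧ (∀ z, ‖D.inverse z‖ ≤ ‖z‖ / c) ∧ (∀ z, c * ‖z‖ ^ 2 / L ^ 2 ≤ NN D z) ∧ (∀ z, NN D z ≤ ‖z‖ ^ 2 / c) := by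
  have hinj : Function.Injective (D : EE n →ₗ[ℝ] EE n) := by
    rw [← LinearMap.ker_eq_bot, LinearMap.ker_eq_bot']
    intro v hv
    have h := hco v
    have hv' : D v = 0 := hv
    rw [hv', inner_zero_left] at h
    have : ‖v‖ ^ 2 ≤ 0 := by nlinarith
    have : ‖v‖ = 0 := by nlinarith [sq_nonneg ‖v‖]
    exact norm_eq_zero.1 this
  let e := (LinearEquiv.ofInjectiveEndo (D : EE n →ₗ[ℝ] EE n) hinj).toContinuousLinearEquiv
  have he : D = (e : EE n →L[ℝ] EE n) := by ext1 v; rfl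
  have h1 : ∀ z, D (D.inverse z) = z := by
    intro z
    rw [he, ContinuousLinearMap.inverse_equiv]
    exact e.apply_symm_apply z
  have h3 : ∀ z, ‖D.inverse z‖ ≤ ‖z‖ / c := by
    intro z
    rw [le_div_iff₀ hc]
    have := hco (D.inverse z)
    rw [h1] at this
    have h2 := this.trans (real_inner_le_norm _ _)
    by_cases h0 : ‖D.inverse z‖ = 0
    · rw [h0]; simp
    · have : 0 < ‖D.inverse z‖ := lt_of_le_of_ne (norm_nonneg _) (Ne.symm h0)
      nlinarith
  refine ⟨h1, ?_, h3, ?_, ?_⟩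
  · intro z w
    conv_lhs => rw [← h1 w]
    rw [← hsym, h1]
  · intro z
    have a1 := hco (D.inverse z)
    have a2 := hb (D.inverse z)
    rw [h1] at a1 a2
    unfold NN
    rw [real_inner_comm, div_le_iff₀ (by positivity)]
    have : ‖z‖ ^ 2 ≤ L ^ 2 * ‖D.inverse z‖ ^ 2 := by rw [← mul_pow]; gcongr
    calc c * ‖z‖ ^ 2 ≤ c * (L ^ 2 * ‖D.inverse z‖ ^ 2) := by gcongr
      _ = (c * ‖D.inverse z‖ ^ 2) * L ^ 2 := by ring
      _ ≤ _ := by gcongr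
  · intro z
    unfold NN
    refine (real_inner_le_norm _ _).trans ?_
    calc _ ≤ ‖z‖ / c * ‖z‖ := by gcongr; exact h3 z
      _ = _ := by ring
lemma NN_contDiff (D : EE n →L[ℝ] EE n) : ContDiff ℝ 1 (NN D) := by
  unfold NN
  exact (D.inverse.contDiff).inner ℝ contDiff_id
lemma kernel_props {D : EE n →L[ℝ] EE n} {c L : ℝ} (hc : 0 < c) (hL : 0 < L) (hsym : ∀ v w, ⟪D v, w⟫ = ⟪v, D w⟫) (hco : ∀ v, c * ‖v‖ ^ 2 ≤ ⟪D v, v⟫) (hb : ∀ v, ‖D v‖ ≤ L * ‖v‖) {R1 r1 : ℝ} (hR1 : 0 < R1) (hR1' : L ^ 2 ≤ c * R1 ^ 2) (hr1 : 2 * r1 ^ 2 ≤ c) : ContDiff ℝ 1 (kap D) ∧ Continuous (kk D) ∧ (∀ z, 0 ≤ kap D z) ∧ (∀ z, kap D z ≤ 1) ∧ (∀ z, 0 ≤ kk D z) ∧ (∀ z, kk D z ≤ 2) ∧ tsupport (kap D) ⊆ closedBall 0 R1 ∧ (∀ z, z ∉ BB n R1 → kk D z = 0) ∧ (∀ z,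 ‖z‖ ≤ r1 → 1 ≤ kk D z) ∧ (∀ z, ‖gradient (kap D) z‖ ≤ 2 * R1 / c) ∧ (∀ v z, ⟪D v, gradient (kap D) z⟫ = - (kk D z * ⟪v, z⟫)) := by
  obtain ⟨h1, h2, h3, h4, h5⟩ := inverse_props hc hL hsym hco hb
  have hN0 : ∀ z, 0 ≤ NN D z := fun z => le_trans (by positivity) (h4 z)
  have hout : ∀ z, z ∉ BB n R1 → max (1 - NN D z) 0 = 0 := by
    intro z hz
    have hz : R1 < ‖z‖ := by simpa using hz
    refine max_eq_right ?_
    have := h4 z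
    rw [div_le_iff₀ (by positivity)] at this
    have h6 : R1 ^ 2 ≤ ‖z‖ ^ 2 := by gcongr
    by_contra hcon
    push Not at hcon
    have h7 : NN D z < 1 := by linarith
    have h8 : L ^ 2 * NN D z < L ^ 2 * 1 := by exact mul_lt_mul_of_pos_left h7 (by positivity)
    nlinarith [mul_le_mul_of_nonneg_left h6 hc.le]
  have hm0 : ∀ z, 0 ≤ max (1 - NN D z) 0 := fun z => le_max_right _ _
  have hm1 : ∀ z, max (1 - NN D z) 0 ≤ 1 := fun z => max_le (by linarith [hN0 z]) zero_le_one
  have hgN : ∀ z v, fderiv ℝ (NN D) z v = 2 * ⟪D.inverse z, v⟫ := by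
    intro z v
    have := (D.inverse.hasFDerivAt (x := z)).inner ℝ (hasFDerivAt_id z)
    have e : fderiv ℝ (NN D) z = _ := this.fderiv
    rw [e]
    simp [fderivInnerCLM_apply]
    rw [h2 v z, real_inner_comm v]; ring
  have hgk : ∀ z, gradient (kap D) z = - (kk D z) • D.inverse z := by
    intro z
    apply ext_inner_right ℝ
    intro v
    rw [inner_gradient_left, inner_smul_left]
    have hNd : HasFDerivAt (NN D) (fderiv ℝ (NN D) z) z := ((NN_contDiff D).differentiable one_ne_zero z).hasFDerivAt
    have a1 := (posSq_hasDerivAt (1 - NN D z)).comp_hasFDerivAt z (hNd.const_sub 1)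
    have a2 := a1.mul_const (1 / 2 : ℝ)
    have a3 : (fun y => ((fun s : ℝ => (max s 0) ^ 2) ∘ fun x => 1 - NN D x) y * (1 / 2 : ℝ)) = kap D := by funext y; simp [kap]; ring
    rw [a3] at a2
    rw [a2.fderiv]
    simp [hgN, kk]; ring
  have hkc : Continuous (kk D) := by
    have := (NN_contDiff D).continuous
    unfold kk; fun_prop
  refine ⟨?_, hkc, ?_, ?_, ?_, ?_, ?_, ?_, ?_, ?_, ?_⟩
  · have := (posSq_contDiff.comp (contDiff_const.sub (NN_contDiff D) : ContDiff ℝ 1 fun z => 1 - NN D z)).div_const 2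
    exact this
  · intro z; unfold kap; positivity
  · intro z; unfold kap; nlinarith [hm0 z, hm1 z]
  · intro z; unfold kk; linarith [hm0 z]
  · intro z; unfold kk; linarith [hm1 z]
  · refine closure_minimal ?_ isClosed_closedBall
    intro z hz
    by_contra h
    apply hz
    unfold kap; rw [hout z h]; simp
  · intro z hz; unfold kk; rw [hout z hz]; simp
  · intro z hz
    have : NN D z ≤ 1 / 2 := by
      refine (h5 z).trans ?_
      rw [div_le_iff₀ hc]
      have : ‖z‖ ^ 2 ≤ r1 ^ 2 := by gcongr
      linarith
    unfold kk
    have := le_max_left (1 - NN D z) 0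
    linarith
  · intro z
    rw [hgk, norm_smul, norm_neg, Real.norm_eq_abs]
    by_cases hz : z ∈ BB n R1
    · have hz : ‖z‖ ≤ R1 := by simpa using hz
      have e1 : |kk D z| ≤ 2 := by unfold kk; rw [abs_of_nonneg (by linarith [hm0 z])]; linarith [hm1 z]
      have e2 : ‖D.inverse z‖ ≤ R1 / c := (h3 z).trans (by gcongr)
      calc _ ≤ 2 * (R1 / c) := mul_le_mul e1 e2 (norm_nonneg _) (by norm_num)
        _ = _ := by ring
    · have : kk D z = 0 := by unfold kk; rw [hout z hz]; simp
      rw [this]; simp; positivity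
  · intro v z
    rw [hgk, inner_smul_right, hsym, h1]; ring
end
lemma integral_inner_gradient_zero {n : ℕ} {φ : EE n → ℝ} (hφ : ContDiff ℝ 1 φ) (hc : HasCompactSupport φ) (a : EE n) : ∫ z, ⟪a, gradient φ z⟫ = 0 := by
  have h : ∀ z, ⟪a, gradient φ z⟫ = (fun _ => (1:ℝ)) z * fderiv ℝ φ z a := by intro z; rw [real_inner_comm, inner_gradient_left, one_mul]
  simp_rw [h]
  have hi : Integrable fun z => fderiv ℝ φ z a := Continuous.integrable_of_hasCompactSupport ((hφ.continuous_fderiv one_ne_zero).clm_apply continuous_const) (hc.fderiv_apply ℝ a)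
  rw [integral_mul_fderiv_eq_neg_fderiv_mul_of_integrable]
  · simp
  · simp
  · simpa using hi
  · simpa using hφ.continuous.integrable_of_hasCompactSupport hc
  · intro x _; exact differentiableAt_const _
  · intro x _; exact hφ.differentiable one_ne_zero x
namespace Good
variable {n : ℕ} {p ε lam : ℝ} {Ω : Set (EE n)} {u : EE n → ℝ}
lemma compact_super (G : Good n p ε lam Ω u) {δ : ℝ} (hδ : 0 < δ) : IsCompact {x | δ ≤ u x} := by
  refine Metric.isCompact_of_isClosed_isBounded (isClosed_le continuous_const G.cont) ?_
  refine G.hΩb.subset fun x hx => G.subU ?_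
  exact lt_of_lt_of_le hδ hx
lemma cutoff (G : Good n p ε lam Ω u) {K : Set (EE n)} (hK : IsCompact K) (hKU : K ⊆ {x | 0 < u x}) : ∃ (R0 : ℝ) (W : EE n → ℝ), 0 < R0 ∧ cthickening R0 K ⊆ {x | 0 < u x} ∧ ContDiff ℝ 1 W ∧ HasCompactSupport W ∧ ∀ x ∈ cthickening R0 K, W =ᶠ[𝓝 x] fun y => log (u y) := by
  obtain ⟨R0, hR0, hsub⟩ := hK.exists_cthickening_subset_open G.openU hKU
  have hKc : IsCompact (cthickening R0 K) := hK.cthickening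
  obtain ⟨m, hm, hmin⟩ : ∃ m, 0 < m ∧ ∀ x ∈ cthickening R0 K, m ≤ u x := by
    rcases (cthickening R0 K).eq_empty_or_nonempty with he | hne
    · exact ⟨1, one_pos, by simp [he]⟩
    · obtain ⟨x0, hx0, h⟩ := hKc.exists_isMinOn hne G.cont.continuousOn
      exact ⟨u x0, hsub hx0, fun x hx => h hx⟩
  let δ := m / 3
  have hδ : 0 < δ := by positivity
  let W : EE n → ℝ := fun x => smoothTransition ((u x - δ) / δ) * log (u x)
  have hsupp : tsupport W ⊆ {x | δ ≤ u x} := by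
    refine closure_minimal ?_ (isClosed_le continuous_const G.cont)
    intro x hx
    by_contra h
    apply hx
    have h : u x < δ := not_le.1 h
    have : smoothTransition ((u x - δ) / δ) = 0 := smoothTransition.zero_of_nonpos (div_nonpos_of_nonpos_of_nonneg (by linarith) hδ.le)
    simp [W, this]
  refine ⟨R0, W, hR0, hsub, contDiff_of_tsup fun x hx => ?_, ?_, ?_⟩
  · have hx : 0 < u x := lt_of_lt_of_le hδ (hsupp hx)
    have hu : ContDiffAt ℝ 1 u x := G.c1.contDiffAt (G.hΩ.mem_nhds (G.subU hx))
    refine ContDiffAt.mul ?_ (hu.log hx.ne')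
    exact (smoothTransition.contDiff.contDiffAt).comp x ((hu.sub contDiffAt_const).div_const δ)
  · exact HasCompactSupport.of_support_subset_isCompact (G.compact_super hδ) ((subset_tsupport _).trans hsupp)
  · intro x hx
    have hopen : IsOpen {y | 2 * δ < u y} := isOpen_lt continuous_const G.cont
    have hxm : 2 * δ < u x := by
      have := hmin x hx
      have e : δ = m / 3 := rfl
      linarith
    filter_upwards [hopen.mem_nhds hxm] with y hy
    have hy : 2 * δ < u y := hy
    have : smoothTransition ((u y - δ) / δ) = 1 := by
      refine smoothTransition.one_of_one_le ?_
      rw [le_div_iff₀ hδ]; linarith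
    simp [W, this]
end Good
noncomputable def gap {n : ℕ} (w : EE n → ℝ) (y : EE n) (q z : EE n) : ℝ := w y + ⟪q, z⟫ - w (y + z)
lemma gap_contDiff {n : ℕ} {W : EE n → ℝ} (hW : ContDiff ℝ 1 W) (y q : EE n) : ContDiff ℝ 1 (gap W y q) := by
  unfold gap
  exact ((contDiff_const.add (contDiff_const.inner ℝ contDiff_id)).sub (hW.comp (contDiff_const.add contDiff_id)))
lemma gap_gradient {n : ℕ} {W : EE n → ℝ} (hW : ContDiff ℝ 1 W) (y q z : EE n) : gradient (gap W y q) z = q - gradient W (y + z) := by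
  apply ext_inner_right ℝ
  intro v
  rw [inner_sub_left, inner_gradient_left, inner_gradient_left]
  have h1 : HasFDerivAt (fun z => ⟪q, z⟫) (innerSL ℝ q) z := (innerSL ℝ q).hasFDerivAt
  have h2 : HasFDerivAt (fun z => W (y + z)) (fderiv ℝ W (y + z)) z := by
    have a := (hW.differentiable one_ne_zero (y + z)).hasFDerivAt
    have b : HasFDerivAt (fun z => y + z) (ContinuousLinearMap.id ℝ (EE n)) z := (hasFDerivAt_id z).const_add y
    have h := a.comp z b
    rw [ContinuousLinearMap.comp_id] at h
    exact h
  have h3 := (h1.const_add (W y)).sub h2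
  have e : fderiv ℝ (gap W y q) z = _ := h3.fderiv
  rw [e]; simp
namespace Good
variable {n : ℕ} {p ε lam : ℝ} {Ω : Set (EE n)} {u : EE n → ℝ}
lemma exists_loc (G : Good n p ε lam Ω u) {K : Set (EE n)} (hK : IsCompact K) (hKU : K ⊆ {x | 0 < u x}) : ∃ (c L R0 R1 r1 : ℝ) (W : EE n → ℝ), 0 < c ∧ 0 < L ∧ 0 < R0 ∧ 1 ≤ R1 ∧ 0 < r1 ∧ r1 ≤ 1 ∧ cthickening R0 K ⊆ {x | 0 < u x} ∧ ContDiff ℝ 1 W ∧ HasCompactSupport W ∧ (∀ x ∈ cthickening R0 K, W =ᶠ[𝓝 x] fun y => log (u y)) ∧ ∀ y ∈ K, ∀ q, q = gradient LG u y → (∀ z, ‖z‖ ≤ R0 → 0 ≤ gap LG u y q z) → Loc n c L R0 R1 r1 (gap W y q) (kap (DA ε p q)) (kk (DA ε p q)) (fun z => Rhs ε p lam (y + z) (gradient W (y + z))) (fun z => AA ε p q - AA ε p (gradient W (y + z))) (DA ε p q) := by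
  obtain ⟨R0, W, hR0, hsub, hW, hWc, hWe⟩ := G.cutoff hK hKU
  have hgc := gradient_cont hW
  have hgs : HasCompactSupport (gradient W) := by refine HasCompactSupport.intro hWc fun x hx => gradient_zero_of_notMem hx
  obtain ⟨M, hM⟩ : ∃ M, ∀ x, ‖gradient W x‖ ≤ M := hgs.exists_bound_of_continuous hgc
  have hM0 : 0 ≤ M := (norm_nonneg _).trans (hM 0)
  obtain ⟨c, L, hc, hL, hA⟩ := AA_bounds (n := n) G.hε G.hp hM0
  have hRc : Continuous fun x => Rhs ε p lam x (gradient W x) := by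
    have h1 := (FF_cont (n := n) G.hε p).comp hgc
    have h2 := (AA_cont (n := n) G.hε p).comp hgc
    unfold Rhs
    exact ((h1.sub continuous_const).sub (continuous_const.mul (h2.inner hgc))).add (h2.inner continuous_id)
  obtain ⟨L2, hL2⟩ := (hK.cthickening (r := R0)).exists_bound_of_continuousOn hRc.continuousOn
  let R1 := max 1 (L / √c)
  let r1 := Min.min 1 (√(c / 2))
  have hR1 : 1 ≤ R1 := le_max_left _ _
  have hr1 : 0 < r1 := by positivity
  let L' := max L (max L2 (2 * R1 / c))
  have hLL : L ≤ L' := le_max_left _ _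
  have hL0 : 0 < L' := lt_of_lt_of_le hL hLL
  refine ⟨c, L', R0, R1, r1, W, hc, hL0, hR0, hR1, hr1, min_le_left _ _, hsub, hW, hWc, hWe, ?_⟩
  intro y hy q hq hpos
  have hyK : ∀ z, ‖z‖ ≤ R0 → y + z ∈ cthickening R0 K := by
    intro z hz
    refine mem_cthickening_of_dist_le (y + z) y R0 K hy ?_
    simpa using hz
  have hy0 : y ∈ cthickening R0 K := by simpa using hyK 0 (by simpa using hR0.le)
  have hq' : q = gradient W y := by rw [hq]; exact (gradient_congr (hWe y hy0)).symm
  have hqM : ‖q‖ ≤ M := hq' ▸ hM y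
  have hWv : ∀ z, ‖z‖ ≤ R0 → W (y + z) = log (u (y + z)) := fun z hz => (hWe _ (hyK z hz)).eq_of_nhds
  obtain ⟨k1, k2, k3, k4, k5, k6, k7, k8, k9, k10, k11⟩ := kernel_props (D := DA ε p q) hc hL (DA_symm G.hε p q) (hA q q hqM hqM).1 (hA q q hqM hqM).2.1 (R1 := R1) (r1 := r1) (by positivity) (by
      have : L / √c ≤ R1 := le_max_right _ _
      have h2 : (L / √c) ^ 2 ≤ R1 ^ 2 := by gcongr
      rw [div_pow, Real.sq_sqrt hc.le, div_le_iff₀ hc] at h2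
      linarith)
    (by
      have : r1 ≤ √(c / 2) := min_le_right _ _
      have h2 : r1 ^ 2 ≤ (√(c / 2)) ^ 2 := by gcongr
      rw [Real.sq_sqrt (by positivity)] at h2
      linarith)
  refine ⟨hc, hL0, hR0, hR1, hr1, min_le_left _ _, gap_contDiff hW y q, ?_, ?_, ?_, ?_, ?_, ?_, ?_, ?_, ?_, k1, k2, k3, k4, k5, k6, k7, k8, k9, ?_, k11⟩
  · simp [gap]
  · intro z hz
    have := hpos z hz
    have e0 := hWv 0 (by simpa using hR0.le)
    rw [add_zero] at e0
    unfold gap at this ⊢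
    rw [hWv z hz, e0]; exact this
  · exact continuous_const.sub ((AA_cont G.hε p).comp (hgc.comp (continuous_const.add continuous_id)))
  · exact hRc.comp (continuous_const.add continuous_id)
  · intro z
    rw [gap_gradient hW]
    exact (hA q _ hqM (hM _)).2.2.1
  · intro z
    rw [gap_gradient hW]
    exact ((hA q _ hqM (hM _)).2.2.2.1).trans (by gcongr)
  · intro z
    rw [gap_gradient hW]
    exact ((hA q _ hqM (hM _)).2.2.2.2).trans (by gcongr)
  · intro z hz
    exact (hL2 _ (hyK z hz)).trans ((le_max_left _ _).trans (le_max_right _ _))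
  · intro φ hφ hφs
    have hφc : HasCompactSupport φ := HasCompactSupport.of_support_subset_isCompact (isCompact_closedBall (0:EE n) R0) ((subset_tsupport _).trans hφs)
    let ψ : EE n → ℝ := fun x => φ (x - y)
    have hψ : ContDiff ℝ 1 ψ := hφ.comp (contDiff_id.sub contDiff_const)
    have hψs : tsupport ψ ⊆ closedBall y R0 := by
      refine closure_minimal ?_ isClosed_closedBall
      intro x hx
      have : x - y ∈ BB n R0 := hφs (subset_tsupport _ hx)
      simpa [dist_eq_norm] using this
    have hψK : tsupport ψ ⊆ cthickening R0 K := fun x hx => by refine mem_cthickening_of_dist_le x y R0 K hy (hψs hx)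
    have hψc : HasCompactSupport ψ := HasCompactSupport.of_support_subset_isCompact (isCompact_closedBall y R0) ((subset_tsupport _).trans hψs)
    have hgψ : ∀ x, gradient ψ x = gradient φ (x - y) := by
      intro x
      apply ext_inner_right ℝ
      intro v
      rw [inner_gradient_left, inner_gradient_left]
      have : fderiv ℝ (fun x => φ (x - y)) x = fderiv ℝ φ (x - y) := fderiv_comp_sub y
      rw [← this]
    have hEL := G.EL hψ hψc (hψK.trans hsub)
    have e1 : ∫ x, ⟪AA ε p (gradient LG u x), gradient ψ x⟫ = ∫ z, ⟪AA ε p (gradient W (y + z)), gradient φ z⟫ := by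
      rw [← integral_add_left_eq_self _ y]
      refine integral_congr_ae (Filter.Eventually.of_forall fun z => ?_)
      simp only [hgψ, add_sub_cancel_left]
      by_cases hz : z ∈ tsupport φ
      · have hz : ‖z‖ ≤ R0 := by simpa using hφs hz
        rw [gradient_congr (hWe _ (hyK z hz))]
      · rw [gradient_zero_of_notMem hz]; simp
    have e2 : ∫ x, Rhs ε p lam x (gradient LG u x) * ψ x = ∫ z, Rhs ε p lam (y + z) (gradient W (y + z)) * φ z := by
      rw [← integral_add_left_eq_self _ y]
      refine integral_congr_ae (Filter.Eventually.of_forall fun z => ?_)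
      simp only [ψ, add_sub_cancel_left]
      by_cases hz : z ∈ tsupport φ
      · have hz : ‖z‖ ≤ R0 := by simpa using hφs hz
        rw [gradient_congr (hWe _ (hyK z hz))]
      · rw [image_eq_zero_of_notMem_tsupport hz]; simp
    rw [e1, e2] at hEL
    have hgφ := gradient_cont hφ
    have hgφs : HasCompactSupport (gradient φ) := HasCompactSupport.intro hφc fun x hx => gradient_zero_of_notMem hx
    have i1 : Integrable fun z => ⟪AA ε p q, gradient φ z⟫ := by
      refine Continuous.integrable_of_hasCompactSupport (continuous_const.inner hgφ) ?_
      exact HasCompactSupport.intro hφc fun x hx => by rw [gradient_zero_of_notMem hx]; simp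
    have i2 : Integrable fun z => ⟪AA ε p (gradient W (y + z)), gradient φ z⟫ := by
      refine Continuous.integrable_of_hasCompactSupport (((AA_cont G.hε p).comp (hgc.comp (continuous_const.add continuous_id))).inner hgφ) ?_
      exact HasCompactSupport.intro hφc fun x hx => by rw [gradient_zero_of_notMem hx]; simp
    simp only [inner_sub_left]
    rw [integral_sub i1 i2, integral_inner_gradient_zero hφ hφc, hEL]
    ring
  · intro z
    exact (k10 z).trans ((le_max_right _ _).trans (le_max_right _ _))
end Good
lemma Good.contact {n : ℕ} {p ε lam : ℝ} {Ω : Set (EE n)} {u : EE n → ℝ} (G : Good n p ε lam Ω u) {K : Set (EE n)} (hK : IsCompact K) (hKU : K ⊆ {x | 0 < u x}) : ∃ (C r0 R1 : ℝ), 0 ≤ C ∧ 0 < r0 ∧ 0 < R1 ∧ (∀ y ∈ K, closedBall y r0 ⊆ {x | 0 < u x}) ∧ ∀ y ∈ K, ∀ q, q = gradient LG u y → (∀ x, 0 < u x → log (u x) ≤ log (u y) + ⟪q, x - y⟫) → (∀ r, 0 < r → r ≤ r0 → ∫ z in BB n 1, gap LG u y q (r • z) ≤ C * r ^ 2) ∧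 (Continuous (kk (DA ε p q)) ∧ (∀ z, 0 ≤ kk (DA ε p q) z) ∧ ∀ z, z ∉ BB n R1 → kk (DA ε p q) z = 0) ∧ (ContDiff ℝ 1 (kap (DA ε p q)) ∧ (∀ z, 0 ≤ kap (DA ε p q) z) ∧ tsupport (kap (DA ε p q)) ⊆ closedBall 0 R1 ∧ 0 < kap (DA ε p q) 0 ∧ ∀ v z, ⟪DA ε p q v, gradient (kap (DA ε p q)) z⟫ = - (kk (DA ε p q) z * ⟪v, z⟫)) ∧ Filter.Tendsto (fun r : ℝ => (∫ z, gap LG u y q (r • z) * kk (DA ε p q) z) / r ^ 2) (𝓝[>] 0) (𝓝 (- Rhs ε p lam y q * (∫ z, kap (DA ε p q) z) / 2)) := by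
  obtain ⟨c, L, R0, R1, r1, W, hc, hL, hR0, hR1, hr1, hr1', hsub, hW, hWc, hWe, hloc⟩ := G.exists_loc hK hKU
  have hη := etaQ_pos (n := n) hc hL hR1 hr1
  set η := etaQ n c L R1 r1 with hηd
  have hgc := gradient_cont hW
  have hgs : HasCompactSupport (gradient W) := HasCompactSupport.intro hWc fun x hx => gradient_zero_of_notMem hx
  have huc : UniformContinuous (gradient W) := hgs.uniformContinuous_of_continuous hgc
  obtain ⟨δ, hδ, hδu⟩ := Metric.uniformContinuous_iff.1 huc η hη
  let R := Min.min η (Min.min (R0 / R1) (δ / 2 / R1))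
  have hR : 0 < R := by positivity
  have eR1 : R * R1 ≤ R0 := by rw [← le_div_iff₀ (by linarith)]; exact (min_le_right _ _).trans (min_le_left _ _)
  have eR2 : R * R1 ≤ δ / 2 := by rw [← le_div_iff₀ (by linarith)]; exact (min_le_right _ _).trans (min_le_right _ _)
  set v := volume.real (BB n R1) with hv
  have hv0 : 0 ≤ v := measureReal_nonneg
  set X := 2 * (L * v) + (2 * η * R1 * v) * (2 * R1 / r1) / R with hX
  have hX0 : 0 ≤ X := by positivity
  have hr0 : 0 < R * r1 := by positivity
  have hle : R * r1 ≤ R0 := by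
    refine le_trans ?_ eR1
    gcongr; linarith
  have hbK : ∀ y ∈ K, ∀ z, ‖z‖ ≤ R0 → y + z ∈ cthickening R0 K := by
    intro y hy z hz
    refine mem_cthickening_of_dist_le (y + z) y R0 K hy ?_
    simpa using hz
  refine ⟨(1 / r1) ^ n * (X * (1 / r1) ^ 2), R * r1, R1, by positivity, hr0, by linarith,
    fun y hy x hx => ?_, ?_⟩
  · have := hbK y hy (x - y) (by
      have : ‖x - y‖ ≤ R * r1 := by simpa [dist_eq_norm] using hx
      linarith)
    rw [add_sub_cancel] at this
    exact hsub this
  intro y hy q hq hcon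
  have H := hloc y hy q hq (fun z hz => by
    have h := hcon (y + z) (hsub (hbK y hy z hz))
    unfold gap
    rw [add_sub_cancel_left] at h
    linarith)
  have hgap : ∀ z, ‖z‖ ≤ R0 → gap W y q z = gap LG u y q z := by
    intro z hz
    have e1 := (hWe _ (hbK y hy z hz)).eq_of_nhds
    have e2 := (hWe _ (hbK y hy 0 (by simpa using hR0.le))).eq_of_nhds
    rw [add_zero] at e2
    unfold gap; rw [e1, e2]
  have hy0 : y ∈ cthickening R0 K := by
    have := hbK y hy 0 (by simpa using hR0.le)
    rwa [add_zero] at this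
  have hqW : q = gradient W y := by rw [hq, gradient_congr (hWe y hy0)]
  have hsm : ∀ z, ‖z‖ ≤ R * R1 → gap W y q z ≤ η * ‖z‖ := by
    intro z hz
    have hd : ∀ t ∈ BB n (δ / 2), ‖fderiv ℝ (gap W y q) t‖ ≤ η := by
      intro t ht
      rw [← norm_gradient, gap_gradient hW, hqW, ← dist_eq_norm]
      refine (hδu ?_).le
      have : ‖t‖ ≤ δ / 2 := by simpa using ht
      simp only [dist_self_add_right]; linarith
    have := (convex_closedBall (0 : EE n) (δ / 2)).norm_image_sub_le_of_norm_fderiv_le (𝕜 := ℝ) (fun t _ => (gap_contDiff hW y q).differentiable one_ne_zero t) hd (x := 0) (y := z) (by simp; positivity) (by simpa using hz.trans eR2)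
    rw [H.g0, sub_zero, sub_zero] at this
    exact (le_abs_self _).trans this
  refine ⟨?_, ⟨H.kc, H.k0, H.ks⟩, ⟨H.κ1, H.κ0, H.κs, ?_, H.Dκ⟩, ?_⟩
  · intro r hr hrr
    have h1 : r * (1 / r1) ≤ R := by rw [mul_one_div, div_le_iff₀ hr1]; exact hrr
    have h2 := H.ball_le hr one_pos (le_trans (by gcongr) eR1)
    have h3 := H.quad hR (min_le_left _ _) eR1 hsm (r := r * (1 / r1)) (by positivity) h1
    have h4 : ∫ z in BB n 1, gap LG u y q (r • z) = ∫ z in BB n 1, gap W y q (r • z) := by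
      refine setIntegral_congr_fun measurableSet_closedBall fun z hz => ?_
      refine (hgap _ ?_).symm
      have hz : ‖z‖ ≤ 1 := by simpa using hz
      rw [norm_smul, Real.norm_eq_abs, abs_of_pos hr]
      nlinarith
    rw [h4]
    refine h2.trans ?_
    calc _ ≤ (1 / r1) ^ n * (X * (r * (1 / r1)) ^ 2) :=
          mul_le_mul_of_nonneg_left h3 (by positivity)
      _ = _ := by ring
  · simp [kap, NN]
  · have hlim := H.limit (by rw [gap_gradient hW, add_zero, hqW, sub_self])
    simp only [add_zero] at hlim
    rw [← hqW] at hlim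
    refine hlim.congr' ?_
    filter_upwards [Ioo_mem_nhdsGT (show (0:ℝ) < R by positivity)] with r hr
    congr 1
    unfold mm
    refine integral_congr_ae (Filter.Eventually.of_forall fun z => ?_)
    simp only
    by_cases hz : z ∈ BB n R1
    · rw [hgap]
      have hz : ‖z‖ ≤ R1 := by simpa using hz
      rw [norm_smul, Real.norm_eq_abs, abs_of_pos hr.1]
      refine le_trans ?_ eR1
      have := hr.2.le
      have := hr.1.le
      gcongr
    · rw [H.ks z hz]; simp
lemma isCompact_hull {n : ℕ} {C : Set (EE n)} (hC : IsCompact C) : IsCompact (convexHull ℝ C) := by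
  rcases C.eq_empty_or_nonempty with h | ⟨c0, hc0⟩
  · rw [h, convexHull_empty]; exact isCompact_empty
  let f : (Fin (n + 1) → ℝ) × (Fin (n + 1) → EE n) → EE n := fun x => ∑ i, x.1 i • x.2 i
  have hf : Continuous f := by fun_prop
  have hk : IsCompact (stdSimplex ℝ (Fin (n + 1)) ×ˢ (Set.univ.pi fun _ : Fin (n + 1) => C)) := (isCompact_stdSimplex ℝ _).prod (isCompact_univ_pi fun _ => hC)
  have he : convexHull ℝ C = f '' (stdSimplex ℝ (Fin (n + 1)) ×ˢ (Set.univ.pi fun _ : Fin (n + 1) => C)) := by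
    apply Subset.antisymm
    · intro x hx
      obtain ⟨ι, hι, z, w, hz, hai, hw, hw1, hx⟩ := eq_pos_convex_span_of_mem_convexHull hx
      have hcard : Fintype.card ι ≤ Fintype.card (Fin (n + 1)) := by
        have := hai.card_le_finrank_succ
        have h2 : Module.finrank ℝ (vectorSpan ℝ (Set.range z)) ≤ n := by
          have := Submodule.finrank_le (vectorSpan ℝ (Set.range z))
          rwa [finrank_euclideanSpace_fin] at this
        simp only [Fintype.card_fin]; omega
      obtain ⟨e⟩ := Function.Embedding.nonempty_of_card_le hcard
      have hej := e.injective
      refine ⟨(Function.extend e w 0, Function.extend e z fun _ => c0), ⟨⟨?_, ?_⟩, ?_⟩, ?_⟩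
      · intro j
        by_cases hj : ∃ i, e i = j
        · obtain ⟨i, rfl⟩ := hj
          simp only; rw [hej.extend_apply]; exact (hw i).le
        · simp only; rw [Function.extend_apply' _ _ _ hj]; simp
      · rw [← hw1]
        refine (Fintype.sum_of_injective e hej _ _ ?_ ?_).symm
        · intro j hj; dsimp only; rw [Function.extend_apply' _ _ _ hj]; rfl
        · intro i; dsimp only; rw [hej.extend_apply]
      · intro j _
        by_cases hj : ∃ i, e i = j
        · obtain ⟨i, rfl⟩ := hj
          simp only; rw [hej.extend_apply]; exact hz (mem_range_self i)
        · simp only; rw [Function.extend_apply' _ _ _ hj]; exact hc0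
      · rw [← hx]
        refine (Fintype.sum_of_injective e hej _ _ ?_ ?_).symm
        · intro j hj; dsimp only; rw [Function.extend_apply' _ _ _ hj]; simp
        · intro i; dsimp only; rw [hej.extend_apply, hej.extend_apply]
    · rintro x ⟨⟨w, z⟩, ⟨⟨hw, hw1⟩, hz⟩, rfl⟩
      exact mem_convexHull_iff_exists_fintype.2 ⟨Fin (n + 1), inferInstance, w, z, hw, hw1, fun i => hz i (mem_univ i), rfl⟩
  rw [he]
  exact hk.image hf
def Tset {n : ℕ} (u : EE n → ℝ) : Set (ℝ × EE n) := {i | ∀ x, u x ≤ exp (i.1 + ⟪i.2, x⟫)}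
noncomputable def us {n : ℕ} (u : EE n → ℝ) (x : EE n) : ℝ := ⨅ i : Tset u, exp (i.1.1 + ⟪i.1.2, x⟫)
lemma us_le {n : ℕ} {u : EE n → ℝ} {a : ℝ} {q : EE n} (h : (a, q) ∈ Tset u) (x : EE n) : us u x ≤ exp (a + ⟪q, x⟫) := ciInf_le (f := fun i : Tset u => exp (i.1.1 + ⟪i.1.2, x⟫)) ⟨0, by rintro _ ⟨i, rfl⟩; exact (exp_pos _).le⟩ ⟨(a, q), h⟩
namespace Good
variable {n : ℕ} {p ε lam : ℝ} {Ω : Set (EE n)} {u : EE n → ℝ}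
lemma exists_bd (G : Good n p ε lam Ω u) : ∃ M, 1 ≤ M ∧ ∀ x, u x ≤ M := by
  obtain ⟨M, hM⟩ := (hasCompactSupport_of_zero_off G.hΩb G.zero).exists_bound_of_continuous G.cont
  exact ⟨max 1 M, le_max_left _ _, fun x => (le_abs_self _).trans ((hM x).trans (le_max_right _ _))⟩
lemma T_nonempty (G : Good n p ε lam Ω u) : Nonempty (Tset u) := by
  obtain ⟨M, hM1, hM⟩ := G.exists_bd
  refine ⟨⟨(log M, 0), fun x => ?_⟩⟩
  simp only [inner_zero_left, add_zero]
  rw [exp_log (by linarith)]; exact hM x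
lemma le_us (G : Good n p ε lam Ω u) {c : ℝ} {x : EE n} (h : ∀ i ∈ Tset u, c ≤ exp (i.1 + ⟪i.2, x⟫)) : c ≤ us u x := by
  haveI := G.T_nonempty
  exact le_ciInf fun i => h i.1 i.2
lemma u_le_us (G : Good n p ε lam Ω u) (x : EE n) : u x ≤ us u x := G.le_us fun _ hi => hi x
lemma us_nonneg (G : Good n p ε lam Ω u) (x : EE n) : 0 ≤ us u x := (G.nonneg x).trans (G.u_le_us x)
lemma us_logconc (G : Good n p ε lam Ω u) {x y : EE n} {s t : ℝ} (hs : 0 ≤ s) (ht : 0 ≤ t) (hst : s + t = 1) : us u x ^ s * us u y ^ t ≤ us u (s • x + t • y) := by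
  refine G.le_us fun i hi => ?_
  have h1 := Real.rpow_le_rpow (G.us_nonneg x) (us_le hi x) hs
  have h2 := Real.rpow_le_rpow (G.us_nonneg y) (us_le hi y) ht
  refine (mul_le_mul h1 h2 (Real.rpow_nonneg (G.us_nonneg _) _) (by positivity)).trans ?_
  rw [← Real.exp_mul, ← Real.exp_mul, ← Real.exp_add, inner_add_right, inner_smul_right, inner_smul_right]
  refine le_of_eq (congrArg _ ?_)
  linear_combination i.1 * hst
lemma convPos (G : Good n p ε lam Ω u) : Convex ℝ {x | 0 < us u x} := by
  intro x hx y hy s t hs ht hst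
  have hx : 0 < us u x := hx
  have hy : 0 < us u y := hy
  exact lt_of_lt_of_le (by positivity) (G.us_logconc hs ht hst)
lemma concLog (G : Good n p ε lam Ω u) : ConcaveOn ℝ {x | 0 < us u x} (fun x => log (us u x)) := by
  refine ⟨G.convPos, fun x hx y hy s t hs ht hst => ?_⟩
  have hx : 0 < us u x := hx
  have hy : 0 < us u y := hy
  have h := Real.log_le_log (by positivity) (G.us_logconc hs ht hst (x := x) (y := y))
  rw [Real.log_mul (by positivity) (by positivity), Real.log_rpow hx, Real.log_rpow hy] at h
  exact h
lemma us_zero (G : Good n p ε lam Ω u) {y : EE n} (hy : y ∉ convexHull ℝ {x | 0 < u x}) : us u y = 0 := by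
  obtain ⟨f, hf⟩ := geometric_hahn_banach_open_point (convex_convexHull ℝ _) G.openU.convexHull hy
  let v := (InnerProductSpace.toDual ℝ (EE n)).symm f
  have hv : ∀ x, ⟪v, x⟫ = f x := fun x => InnerProductSpace.toDual_symm_apply
  obtain ⟨M, hM1, hM⟩ := G.exists_bd
  have hneg : ∀ x, 0 < u x → ⟪v, x - y⟫ < 0 := by
    intro x hx
    rw [inner_sub_right, hv, hv]
    linarith [hf x (subset_convexHull ℝ _ hx)]
  refine le_antisymm (le_of_forall_pos_le_add fun δ hδ => ?_) (G.us_nonneg y)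
  rw [zero_add]
  obtain ⟨m, hm, hmK⟩ : ∃ m > 0, ∀ x, δ ≤ u x → ⟪v, x - y⟫ ≤ -m := by
    rcases ({x | δ ≤ u x} : Set (EE n)).eq_empty_or_nonempty with he | hne
    · exact ⟨1, one_pos, fun x hx => (he.subset hx).elim⟩
    · obtain ⟨x0, hx0, h⟩ := (G.compact_super hδ).exists_isMaxOn hne (f := fun x => ⟪v, x - y⟫) (by fun_prop)
      refine ⟨-⟪v, x0 - y⟫, ?_, fun x hx => ?_⟩
      · linarith [hneg x0 (lt_of_lt_of_le hδ hx0)]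
      · rw [neg_neg]; exact h hx
  let t := max 0 ((log M - log δ) / m)
  have ht : 0 ≤ t := le_max_left _ _
  have htm : log M - log δ ≤ t * m := by rw [← div_le_iff₀ hm]; exact le_max_right _ _
  have hT : (log δ + t * ⟪v, y⟫, -(t • v)) ∈ Tset u := by
    intro x
    simp only [inner_neg_left, inner_smul_left, conj_trivial]
    rcases (G.nonneg x).eq_or_lt with h0 | h0
    · rw [← h0]; positivity
    have hx1 := hneg x h0
    have e : log δ + t * ⟪v, y⟫ + -(t * ⟪v, x⟫) = log δ - t * ⟪v, x - y⟫ := by rw [inner_sub_right]; ring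
    rw [e]
    rcases lt_or_ge (u x) δ with h | h
    · rw [← Real.log_le_iff_le_exp h0]
      have := Real.log_le_log h0 h.le
      nlinarith
    · rw [← Real.log_le_iff_le_exp h0]
      have h1 := Real.log_le_log h0 (hM x)
      have h2 := hmK x h
      nlinarith
  refine (us_le hT y).trans (le_of_eq ?_)
  simp only [inner_neg_left, inner_smul_left, conj_trivial]
  rw [add_neg_cancel_right, exp_log hδ]
lemma us_pos_eq (G : Good n p ε lam Ω u) : {x | 0 < us u x} = convexHull ℝ {x | 0 < u x} := by
  apply Subset.antisymm
  · intro x hx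
    by_contra h
    have hx : 0 < us u x := hx
    rw [G.us_zero h] at hx; exact lt_irrefl _ hx
  · exact convexHull_min (fun x hx => lt_of_lt_of_le hx (G.u_le_us x)) G.convPos
lemma openPos (G : Good n p ε lam Ω u) : IsOpen {x | 0 < us u x} := by rw [G.us_pos_eq]; exact G.openU.convexHull
lemma us_cont (G : Good n p ε lam Ω u) : Continuous (us u) := by
  rw [continuous_iff_continuousAt]
  intro x
  by_cases hx : 0 < us u x
  · have h1 := (G.concLog.continuousOn G.openPos).continuousAt (G.openPos.mem_nhds hx)
    have h2 : ContinuousAt (fun y => exp (log (us u y))) x := h1.rexp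
    refine h2.congr ?_
    filter_upwards [G.openPos.mem_nhds hx] with y hy
    exact exp_log hy
  · have h0 : us u x = 0 := le_antisymm (not_lt.1 hx) (G.us_nonneg x)
    rw [ContinuousAt, h0, Metric.tendsto_nhds]
    intro e he
    haveI := G.T_nonempty
    obtain ⟨i, hi⟩ := exists_lt_of_ciInf_lt (show us u x < e by rw [h0]; exact he)
    have hc : Continuous fun y => exp (i.1.1 + ⟪i.1.2, y⟫) := by fun_prop
    have := hc.continuousAt.eventually_lt_const hi
    filter_upwards [this] with y hy
    rw [dist_zero_right, Real.norm_eq_abs, abs_of_nonneg (G.us_nonneg y)]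
    exact (us_le i.2 y).trans_lt hy
lemma pos_subset (G : Good n p ε lam Ω u) (hc : Convex ℝ Ω) : {x | 0 < us u x} ⊆ Ω := by rw [G.us_pos_eq]; exact convexHull_min G.subU hc
lemma us_zero_off (G : Good n p ε lam Ω u) (hc : Convex ℝ Ω) : ∀ x ∉ Ω, us u x = 0 := by
  intro x hx
  refine le_antisymm (not_lt.1 fun h => hx (G.pos_subset hc h)) (G.us_nonneg x)
lemma slope (G : Good n p ε lam Ω u) {L : Set (EE n)} (hL : IsCompact L) (hLs : L ⊆ {x | 0 < us u x}) (B : ℝ) : ∃ C, 0 ≤ C ∧ ∀ x ∈ L, ∀ i ∈ Tset u, i.1 + ⟪i.2, x⟫ ≤ B → ‖i.2‖ ≤ C := by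
  obtain ⟨r, hr, hrs⟩ := hL.exists_cthickening_subset_open G.openPos hLs
  have hc : IsCompact (cthickening r L) := hL.cthickening
  obtain ⟨m, hm, hmL⟩ : ∃ m > 0, ∀ x ∈ cthickening r L, m ≤ us u x := by
    rcases (cthickening r L).eq_empty_or_nonempty with he | hne
    · exact ⟨1, one_pos, fun x hx => (he.subset hx).elim⟩
    · obtain ⟨x0, hx0, h⟩ := hc.exists_isMinOn hne G.us_cont.continuousOn
      exact ⟨us u x0, hrs hx0, fun x hx => h hx⟩
  refine ⟨max 0 ((B - log m) / r), le_max_left _ _, fun x hx i hi hB => ?_⟩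
  by_cases hq : ‖i.2‖ = 0
  · rw [hq]; exact le_max_left _ _
  have hq0 : 0 < ‖i.2‖ := lt_of_le_of_ne (norm_nonneg _) (Ne.symm hq)
  refine le_trans ?_ (le_max_right _ _)
  rw [le_div_iff₀ hr]
  have hy : x - (r / ‖i.2‖) • i.2 ∈ cthickening r L := by
    refine mem_cthickening_of_dist_le _ x r L hx ?_
    rw [dist_eq_norm, sub_sub_cancel_left, norm_neg, norm_smul, norm_div, norm_norm, Real.norm_of_nonneg hr.le, div_mul_cancel₀ _ hq]
  have h1 := (hmL _ hy).trans (us_le (a := i.1) (q := i.2) hi _)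
  rw [← Real.log_le_iff_le_exp hm, inner_sub_right, inner_smul_right, real_inner_self_eq_norm_sq] at h1
  have : r / ‖i.2‖ * ‖i.2‖ ^ 2 = ‖i.2‖ * r := by field_simp
  linarith
lemma attain (G : Good n p ε lam Ω u) {x : EE n} (hx : 0 < us u x) : ∃ i ∈ Tset u, exp (i.1 + ⟪i.2, x⟫) = us u x := by
  obtain ⟨⟨i0, hi0⟩⟩ := G.T_nonempty
  let B := i0.1 + ⟪i0.2, x⟫
  obtain ⟨C, hC0, hC⟩ := G.slope (isCompact_singleton (x := x)) (by rintro _ rfl; exact hx) B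
  let S : Set (ℝ × EE n) := Tset u ∩ {i | i.1 + ⟪i.2, x⟫ ≤ B}
  have hcl : IsClosed S := by
    refine IsClosed.inter ?_ (isClosed_le (by fun_prop) continuous_const)
    have : Tset u = ⋂ y, {i : ℝ × EE n | u y ≤ exp (i.1 + ⟪i.2, y⟫)} := by ext i; simp [Tset]
    rw [this]
    exact isClosed_iInter fun y => isClosed_le continuous_const (by fun_prop)
  have hb : IsBounded S := by
    refine (isBounded_iff_forall_norm_le).2 ⟨max (|B| + |log (us u x)| + C * ‖x‖) C, ?_⟩
    rintro ⟨a, q⟩ ⟨h1, h2⟩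
    have hq : ‖q‖ ≤ C := hC x (mem_singleton x) (a, q) h1 h2
    have h2 : a + ⟪q, x⟫ ≤ B := h2
    rw [Prod.norm_def]
    refine max_le_max ?_ hq
    have h3 := us_le h1 x
    rw [← Real.log_le_iff_le_exp hx] at h3
    have h4 : |⟪q, x⟫| ≤ C * ‖x‖ := (abs_real_inner_le_norm _ _).trans (by gcongr)
    rw [Real.norm_eq_abs, abs_le]
    have := abs_le.1 h4
    constructor
    · linarith [neg_abs_le (log (us u x)), abs_nonneg B, this.2]
    · linarith [le_abs_self B, abs_nonneg (log (us u x)), this.1]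
  have hk : IsCompact S := Metric.isCompact_of_isClosed_isBounded hcl hb
  obtain ⟨i, hi, him⟩ := hk.exists_isMinOn ⟨i0, hi0, le_refl B⟩ (f := fun i : ℝ × EE n => i.1 + ⟪i.2, x⟫) (by fun_prop)
  refine ⟨i, hi.1, le_antisymm ?_ (us_le (a := i.1) (q := i.2) hi.1 x)⟩
  refine G.le_us fun j hj => exp_le_exp.2 ?_
  rcases le_total (j.1 + ⟪j.2, x⟫) B with h | h
  · exact him ⟨hj, h⟩
  · exact le_trans hi.2 h
lemma contact_hull (G : Good n p ε lam Ω u) {x : EE n} {i : ℝ × EE n} (hi : i ∈ Tset u) (hix : exp (i.1 + ⟪i.2, x⟫) = us u x) : x ∈ convexHull ℝ {y | u y = exp (i.1 + ⟪i.2, y⟫)} := by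
  set C : Set (EE n) := {y | u y = exp (i.1 + ⟪i.2, y⟫)} with hCdef
  have hec : Continuous fun y : EE n => exp (i.1 + ⟪i.2, y⟫) := by fun_prop
  have hclC : IsClosed C := isClosed_eq G.cont hec
  have hCΩ : C ⊆ Ω := by
    intro y hy
    by_contra h
    have hy : u y = exp (i.1 + ⟪i.2, y⟫) := hy
    rw [G.zero y h] at hy
    exact (exp_pos _).ne hy
  have hkC : IsCompact C := Metric.isCompact_of_isClosed_isBounded hclC (G.hΩb.subset hCΩ)
  by_contra hx
  obtain ⟨f, c, hf, hfx⟩ := geometric_hahn_banach_closed_point (convex_convexHull ℝ C) (isCompact_hull hkC).isClosed hx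
  let v := (InnerProductSpace.toDual ℝ (EE n)).symm f
  have hv : ∀ x, ⟪v, x⟫ = f x := fun x => InnerProductSpace.toDual_symm_apply
  obtain ⟨t, ht, hT⟩ : ∃ t > 0, (i.1 + t * c, i.2 - t • v) ∈ Tset u := by
    have e : ∀ t y, i.1 + t * c + ⟪i.2 - t • v, y⟫ = i.1 + ⟪i.2, y⟫ - t * (f y - c) := by
      intro t y
      rw [inner_sub_left, inner_smul_left, hv]; simp only [conj_trivial]; ring
    let Z : Set (EE n) := closure Ω ∩ {y | c ≤ f y}
    have hZ : IsCompact Z := G.hΩb.isCompact_closure.inter_right (isClosed_le continuous_const f.continuous)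
    have hmain : ∃ t > 0, ∀ y ∈ Z, u y ≤ exp (i.1 + ⟪i.2, y⟫ - t * (f y - c)) := by
      rcases Z.eq_empty_or_nonempty with he | hne
      · exact ⟨1, one_pos, fun y hy => (he.subset hy).elim⟩
      obtain ⟨y0, hy0, hmin⟩ := hZ.exists_isMinOn hne (f := fun y => exp (i.1 + ⟪i.2, y⟫) - u y) (hec.sub G.cont).continuousOn
      obtain ⟨y1, hy1, hmax⟩ := hZ.exists_isMaxOn hne (f := fun y => exp (i.1 + ⟪i.2, y⟫) * (f y - c)) (hec.mul (f.continuous.sub continuous_const)).continuousOn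
      set d := exp (i.1 + ⟪i.2, y0⟫) - u y0
      set B := exp (i.1 + ⟪i.2, y1⟫) * (f y1 - c)
      have hd : 0 < d := by
        refine sub_pos.2 (lt_of_le_of_ne (hi y0) fun h => ?_)
        have := hf y0 (subset_convexHull ℝ _ h)
        exact absurd hy0.2 (not_le.2 this)
      have hB : 0 ≤ B := mul_nonneg (exp_pos _).le (sub_nonneg.2 hy1.2)
      refine ⟨d / (B + 1), by positivity, fun y hy => ?_⟩
      have h1 : d ≤ exp (i.1 + ⟪i.2, y⟫) - u y := hmin hy
      have h2 : exp (i.1 + ⟪i.2, y⟫) * (f y - c) ≤ B := hmax hy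
      rw [sub_eq_add_neg, Real.exp_add]
      have h3 := Real.add_one_le_exp (-(d / (B + 1) * (f y - c)))
      have h4 := mul_le_mul_of_nonneg_left h3 (exp_pos (i.1 + ⟪i.2, y⟫)).le
      refine le_trans ?_ h4
      have h5 : d / (B + 1) * (exp (i.1 + ⟪i.2, y⟫) * (f y - c)) ≤ d / (B + 1) * (B + 1) := by gcongr; linarith
      rw [div_mul_cancel₀ _ (by positivity)] at h5
      linarith
    obtain ⟨t, ht, h⟩ := hmain
    refine ⟨t, ht, fun y => ?_⟩
    simp only
    rw [e]
    by_cases hy : y ∈ closure Ω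
    · rcases le_total c (f y) with h1 | h1
      · exact h y ⟨hy, h1⟩
      · refine (hi y).trans (exp_le_exp.2 ?_)
        nlinarith
    · rw [G.zero y fun h => hy (subset_closure h)]; positivity
  have h1 := us_le hT x
  rw [← hix, exp_le_exp, inner_sub_left, inner_smul_left, hv] at h1
  simp only [conj_trivial] at h1
  nlinarith
lemma contact_grad (G : Good n p ε lam Ω u) {y : EE n} {i : ℝ × EE n} (hi : i ∈ Tset u) (hy : u y = exp (i.1 + ⟪i.2, y⟫)) : i.2 = gradient LG u y ∧ ∀ x, 0 < u x → log (u x) ≤ log (u y) + ⟪i.2, x - y⟫ := by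
  have hpos : 0 < u y := by rw [hy]; exact exp_pos _
  have hub : ∀ x, 0 < u x → log (u x) ≤ i.1 + ⟪i.2, x⟫ := fun x hx => (Real.log_le_iff_le_exp hx).2 (hi x)
  have hle : ∀ x, 0 < u x → log (u x) ≤ log (u y) + ⟪i.2, x - y⟫ := by
    intro x hx
    rw [hy, log_exp, inner_sub_right]; linarith [hub x hx]
  refine ⟨?_, hle⟩
  have hd : DifferentiableAt ℝ LG u y := (G.diffU hpos).log hpos.ne'
  have hmax : IsLocalMax (fun x => log (u x) - ⟪i.2, x⟫) y := by
    filter_upwards [G.openU.mem_nhds hpos] with x hx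
    have := hle x hx
    rw [inner_sub_right] at this
    linarith
  have hl : HasFDerivAt (fun x : EE n => ⟪i.2, x⟫) (innerSL ℝ i.2) y := (innerSL ℝ i.2).hasFDerivAt
  have h0 := hmax.hasFDerivAt_eq_zero (hd.hasFDerivAt.sub hl)
  refine ext_inner_right ℝ fun v => ?_
  rw [inner_gradient_left]
  have := DFunLike.congr_fun h0 v
  simp only [ContinuousLinearMap.sub_apply, innerSL_apply_apply, ContinuousLinearMap.zero_apply] at this
  linarith
lemma env (G : Good n p ε lam Ω u) {L : Set (EE n)} (hL : IsCompact L) (hLs : L ⊆ {x | 0 < us u x}) : ∃ (K : Set (EE n)) (C : ℝ), IsCompact K ∧ K ⊆ {x | 0 < u x} ∧ 0 ≤ C ∧ ∀ x ∈ L, ∃ q : EE n, ‖q‖ ≤ C ∧ (∀ z, 0 < us u (x + z) → 0 ≤ gap (fun y => log (us u y)) x q z) ∧ ∃ (ι : Type) (_ : Fintype ι) (w : ι → ℝ) (y : ι → EE n), (∀ i, 0 ≤ w i) ∧ ∑ i, w i = 1 ∧ ∑ i, w i • y i = x ∧ (∀ i, y i ∈ K) ∧ (∀ i, q = gradient LG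 u (y i) ∧ ∀ x, 0 < u x → log (u x) ≤ log (u (y i)) + ⟪q, x - y i⟫) ∧ ∀ z, (∀ i, 0 < u (y i + z)) → 0 < us u (x + z) ∧ gap (fun y => log (us u y)) x q z ≤ ∑ i, w i * gap LG u (y i) q z := by
  obtain ⟨M, hM1, hM⟩ := G.exists_bd
  have husM : ∀ x, us u x ≤ M := by
    intro x
    have hT : (log M, (0 : EE n)) ∈ Tset u := by
      intro y
      simp only [inner_zero_left, add_zero]
      rw [exp_log (by linarith)]; exact hM y
    have := us_le hT x
    rwa [inner_zero_left, add_zero, exp_log (by linarith)] at this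
  obtain ⟨C, hC0, hC⟩ := G.slope hL hLs (log M)
  obtain ⟨m, hm, hmL⟩ : ∃ m > 0, ∀ x ∈ L, m ≤ us u x := by
    rcases L.eq_empty_or_nonempty with he | hne
    · exact ⟨1, one_pos, fun x hx => (he.subset hx).elim⟩
    · obtain ⟨x0, hx0, h⟩ := hL.exists_isMinOn hne G.us_cont.continuousOn
      exact ⟨us u x0, hLs hx0, fun x hx => h hx⟩
  obtain ⟨R, hR⟩ := isBounded_iff_forall_norm_le.1 (hL.isBounded.union G.hΩb)
  have hδ : 0 < exp (log m - C * (R + R)) := exp_pos _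
  refine ⟨_, C, G.compact_super hδ, fun x hx => lt_of_lt_of_le hδ hx, hC0, fun x hx => ?_⟩
  have hpx : 0 < us u x := hLs hx
  obtain ⟨i, hi, hix⟩ := G.attain hpx
  have hlog : i.1 + ⟪i.2, x⟫ = log (us u x) := by rw [← hix, log_exp]
  have hq : ‖i.2‖ ≤ C := hC x hx i hi (by rw [hlog]; exact Real.log_le_log hpx (husM x))
  refine ⟨i.2, hq, fun z hz => ?_, ?_⟩
  · have := us_le (a := i.1) (q := i.2) hi (x + z)
    rw [← Real.log_le_iff_le_exp hz, inner_add_right] at this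
    simp only [gap]; linarith
  obtain ⟨ι, hι, w, y, hw, hw1, hy, hs⟩ := mem_convexHull_iff_exists_fintype.1 (G.contact_hull hi hix)
  have hyi : ∀ j, u (y j) = exp (i.1 + ⟪i.2, y j⟫) := hy
  refine ⟨ι, hι, w, y, hw, hw1, hs, fun j => ?_, fun j => G.contact_grad hi (hyi j), fun z hz => ?_⟩
  · change _ ≤ u (y j)
    rw [hyi, exp_le_exp]
    have hyΩ : y j ∈ Ω := G.subU (show 0 < u (y j) by rw [hyi]; exact exp_pos _)
    have h1 : |⟪i.2, y j - x⟫| ≤ C * (R + R) := by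
      refine (abs_real_inner_le_norm _ _).trans ?_
      refine mul_le_mul hq ?_ (norm_nonneg _) hC0
      exact (norm_sub_le _ _).trans (add_le_add (hR _ (Or.inr hyΩ)) (hR _ (Or.inl hx)))
    have h2 := Real.log_le_log hm (hmL x hx)
    rw [inner_sub_right] at h1
    linarith [(abs_le.1 h1).1]
  · have hz' : ∀ j ∈ Finset.univ, y j + z ∈ {x | 0 < us u x} := fun j _ => lt_of_lt_of_le (hz j) (G.u_le_us _)
    have hsz : ∑ j, w j • (y j + z) = x + z := by simp only [smul_add, Finset.sum_add_distrib, hs, ← Finset.sum_smul, hw1, one_smul]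
    have h1 := G.concLog.le_map_sum (fun j _ => hw j) hw1 hz'
    have h2 := G.concLog.1.sum_mem (fun j _ => hw j) hw1 hz'
    rw [hsz] at h1 h2
    refine ⟨h2, ?_⟩
    have h3 : ∑ j, w j * log (u (y j + z)) ≤ ∑ j, w j • log (us u (y j + z)) := Finset.sum_le_sum fun j _ => mul_le_mul_of_nonneg_left (Real.log_le_log (hz j) (G.u_le_us _)) (hw j)
    have h4 : ∑ j, w j * gap LG u (y j) i.2 z = log (us u x) + ⟪i.2, z⟫ - ∑ j, w j * log (u (y j + z)) := by
      simp only [gap, mul_sub, mul_add, Finset.sum_sub_distrib, Finset.sum_add_distrib, ← Finset.sum_mul, hw1, one_mul]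
      congr 2
      rw [← hlog, ← hs, inner_sum]
      simp only [hyi, log_exp, mul_add, Finset.sum_add_distrib, ← Finset.sum_mul, hw1, inner_smul_right, one_mul]
    rw [h4]
    simp only [gap]
    linarith
end Good
lemma avg_le {n : ℕ} {g : EE n → ℝ} (hg : ContinuousOn g (closedBall 0 1)) (h0 : ∀ a ∈ BB n 1, 0 ≤ g a) (hm : ∀ c a, c + a ∈ BB n 1 → c - a ∈ BB n 1 → g c ≤ (g (c + a) + g (c - a)) / 2) {c : EE n} (hc : ‖c‖ ≤ 1 / 2) : volume.real (BB n (1 / 2)) * g c ≤ ∫ z in BB n 1, g z := by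
  let H := (BB n 1).indicator g
  have hint : IntegrableOn g (BB n 1) := hg.integrableOn_compact (isCompact_closedBall _ _)
  have hH : Integrable H := hint.integrable_indicator measurableSet_closedBall
  have hH0 : ∀ z, 0 ≤ H z := fun z => indicator_nonneg h0 z
  have e1 : ∫ z, H z = ∫ z in BB n 1, g z := integral_indicator measurableSet_closedBall
  have i1 : Integrable fun z => H (c + z) := hH.comp_add_left c
  have i2 : Integrable fun z => H (c - z) := hH.comp_sub_left c
  have e2 : ∫ z, H (c + z) = ∫ z, H z := integral_add_left_eq_self _ c
  have e3 : ∫ z, H (c - z) = ∫ z, H z := integral_sub_left_eq_self _ _ c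
  have i3 : Integrable fun z => (H (c + z) + H (c - z)) / 2 := (i1.add i2).div_const 2
  have h1 : ∫ z in BB n (1 / 2), g c ≤ ∫ z in BB n (1 / 2), (H (c + z) + H (c - z)) / 2 := by
    refine setIntegral_mono_on (integrableOn_const (measure_closedBall_lt_top).ne) i3.integrableOn measurableSet_closedBall fun z hz => ?_
    rw [mem_closedBall_zero_iff] at hz
    have a1 : c + z ∈ BB n 1 := by rw [mem_closedBall_zero_iff]; linarith [norm_add_le c z]
    have a2 : c - z ∈ BB n 1 := by rw [mem_closedBall_zero_iff]; linarith [norm_sub_le c z]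
    simp only [H, indicator_of_mem a1, indicator_of_mem a2]
    exact hm c z a1 a2
  have h2 : ∫ z in BB n (1 / 2), (H (c + z) + H (c - z)) / 2 ≤ ∫ z, (H (c + z) + H (c - z)) / 2 := setIntegral_le_integral i3 (Filter.Eventually.of_forall fun z => div_nonneg (add_nonneg (hH0 _) (hH0 _)) (by norm_num))
  rw [setIntegral_const, smul_eq_mul] at h1
  have h3 : ∫ z, (H (c + z) + H (c - z)) / 2 = ∫ z in BB n 1, g z := by rw [integral_div, integral_add i1 i2, e2, e3, e1]; ring
  linarith
lemma gap_contOn {n : ℕ} {w : EE n → ℝ} {U : Set (EE n)} (hw : ContinuousOn w U) {y : EE n} (q) {r s R : ℝ} (hr : closedBall y r ⊆ U) (hs : 0 ≤ s) (hR : s * R ≤ r) : ContinuousOn (fun z => gap w y q (s • z)) (closedBall 0 R) := by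
  unfold gap
  refine ContinuousOn.sub (by fun_prop) (hw.comp (by fun_prop) fun z hz => hr ?_)
  rw [mem_closedBall_zero_iff] at hz
  rw [mem_closedBall_iff_norm, add_sub_cancel_left, norm_smul, Real.norm_of_nonneg hs]
  exact (mul_le_mul_of_nonneg_left hz hs).trans hR
lemma Rhs_sum {n : ℕ} (ε p lam : ℝ) {ι : Type} [Fintype ι] {w : ι → ℝ} (hw : ∑ i, w i = 1) (y : ι → EE n) (q : EE n) : ∑ i, w i * Rhs ε p lam (y i) q = Rhs ε p lam (∑ i, w i • y i) q := by simp only [Rhs, mul_add, Finset.sum_add_distrib, ← Finset.sum_mul, hw, one_mul, inner_sum, inner_smul_right]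
namespace Good
variable {n : ℕ} {p ε lam : ℝ} {Ω : Set (EE n)} {u : EE n → ℝ}
lemma ws_contOn (G : Good n p ε lam Ω u) : ContinuousOn (fun x => log (us u x)) {x | 0 < us u x} := G.concLog.continuousOn G.openPos
lemma env2 (G : Good n p ε lam Ω u) {L : Set (EE n)} (hL : IsCompact L) (hLs : L ⊆ {x | 0 < us u x}) : ∃ C r0 R1 : ℝ, 0 ≤ C ∧ 0 < r0 ∧ 0 < R1 ∧ ∀ x ∈ L, closedBall x r0 ⊆ {x | 0 < us u x} ∧ ∃ q : EE n, ‖q‖ ≤ C ∧ (∀ z, ‖z‖ ≤ r0 → 0 ≤ gap (fun y => log (us u y)) x q z) ∧ (∀ z, ‖z‖ ≤ r0 → gap (fun y => log (us u y)) x q z ≤ C * ‖z‖ ^ 2) ∧ (Continuous (kk (DA ε p q)) ∧ (∀ z, 0 ≤ kk (DA ε p q) z) ∧ ∀ z ∉ closedBall 0 R1, kk (DA ε p q) z = 0) ∧ (ContDiff ℝ 1 (kap (DA ε p q)) ∧ (∀ z, 0 ≤ kap (DA ε p q) z) ∧ tsupport (kap (DA ε p q)) ⊆ closedBall 0 R1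 ∧ 0 < kap (DA ε p q) 0 ∧ ∀ v z, ⟪DA ε p q v, gradient (kap (DA ε p q)) z⟫ = -(kk (DA ε p q) z * ⟪v, z⟫)) ∧ ∀ l, Filter.Tendsto (fun r : ℝ => (∫ z, gap (fun y => log (us u y)) x q (r • z) * kk (DA ε p q) z) / r ^ 2) (𝓝[>] 0) (𝓝 l) → l ≤ -Rhs ε p lam x q * (∫ z, kap (DA ε p q) z) / 2 := by
  obtain ⟨K, C1, hK, hKU, hC1, henv⟩ := G.env hL hLs
  obtain ⟨C2, r0, R1, hC2, hr0, hR1, hball, hcon⟩ := G.contact hK hKU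
  obtain ⟨r', hr', hrs⟩ := hL.exists_cthickening_subset_open G.openPos hLs
  set V := volume.real (BB n (1 / 2)) with hV
  have hV0 : 0 < V := ENNReal.toReal_pos (measure_closedBall_pos _ _ (by norm_num)).ne' measure_closedBall_lt_top.ne
  let s0 := Min.min (r0 / 2) (r' / 2)
  have hs0 : 0 < s0 := by positivity
  have hs1 : s0 ≤ r0 / 2 := min_le_left _ _
  have hs2 : s0 ≤ r' / 2 := min_le_right _ _
  refine ⟨max C1 (4 * C2 / V), s0, R1, hC1.trans (le_max_left _ _), hs0, hR1, fun x hx => ?_⟩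
  have hb' : closedBall x r' ⊆ {x | 0 < us u x} := (closedBall_subset_cthickening hx r').trans hrs
  obtain ⟨q, hq, hnn, ι, hι, w, y, hw, hw1, hs, hyK, hgr, hgap⟩ := henv x hx
  have hlogU : ContinuousOn LG u {x | 0 < u x} := G.cont.continuousOn.log fun x hx => (show 0 < u x from hx).ne'
  obtain ⟨i0⟩ : Nonempty ι := by
    by_contra h
    rw [not_nonempty_iff] at h
    simp at hw1
  have hyU : ∀ i z, ‖z‖ ≤ r0 → 0 < u (y i + z) := fun i z hz => hball _ (hyK i) (by rwa [mem_closedBall_iff_norm, add_sub_cancel_left])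
  have hc := fun i => hcon (y i) (hyK i) q (hgr i).1 (hgr i).2
  have hxz : ∀ z : EE n, ‖z‖ ≤ r' → 0 < us u (x + z) := fun z hz => hb' (by rwa [mem_closedBall_iff_norm, add_sub_cancel_left])
  refine ⟨(closedBall_subset_closedBall (by linarith)).trans hb', q, hq.trans (le_max_left _ _), fun z hz => hnn z (hxz z (by linarith)), fun z hz => ?_, (hc i0).2.1, (hc i0).2.2.1, ?_⟩
  · rcases eq_or_ne z 0 with rfl | hz0
    · simp [gap]
    have hzp : 0 < ‖z‖ := norm_pos_iff.2 hz0
    set s := 2 * ‖z‖ with hsd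
    have hsp : 0 < s := by positivity
    have hsB : ∀ a ∈ BB n 1, ‖s • a‖ ≤ s := by
      intro a ha
      rw [mem_closedBall_zero_iff] at ha
      rw [norm_smul, Real.norm_of_nonneg hsp.le]; nlinarith
    have hsr : s ≤ r0 := by linarith
    have hsr' : s ≤ r' := by linarith
    have h1 := avg_le (g := fun a => gap (fun y => log (us u y)) x q (s • a)) (gap_contOn G.ws_contOn q hb' hsp.le (by linarith)) (fun a ha => hnn _ (hxz _ ((hsB a ha).trans hsr'))) (fun c a h1 h2 => by
        have := G.concLog.2 (hxz _ ((hsB _ h1).trans hsr')) (hxz _ ((hsB _ h2).trans hsr')) (show (0 : ℝ) ≤ 1 / 2 by norm_num) (show (0 : ℝ) ≤ 1 / 2 by norm_num) (by norm_num)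
        have e : (1 / 2 : ℝ) • (x + s • (c + a)) + (1 / 2 : ℝ) • (x + s • (c - a)) = x + s • c := by module
        rw [e] at this
        simp only [gap, smul_eq_mul] at this ⊢
        have e2 : ⟪q, s • c⟫ = (⟪q, s • (c + a)⟫ + ⟪q, s • (c - a)⟫) / 2 := by simp only [smul_add, smul_sub, inner_add_right, inner_sub_right]; ring
        rw [e2]; linarith)
      (c := s⁻¹ • z) (by
        rw [norm_smul, norm_inv, Real.norm_of_nonneg hsp.le, hsd]
        rw [mul_inv, mul_assoc, inv_mul_cancel₀ hzp.ne']; norm_num)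
    simp only [smul_inv_smul₀ hsp.ne'] at h1
    have hint : ∀ i, IntegrableOn (fun a => gap LG u (y i) q (s • a)) (BB n 1) := fun i => (gap_contOn hlogU q (hball _ (hyK i)) hsp.le (by linarith)).integrableOn_compact (isCompact_closedBall _ _)
    have h2 : ∫ a in BB n 1, gap (fun y => log (us u y)) x q (s • a) ≤ ∫ a in BB n 1, ∑ i, w i * gap LG u (y i) q (s • a) := by refine setIntegral_mono_on ((gap_contOn G.ws_contOn q hb' hsp.le (by linarith)).integrableOn_compact (isCompact_closedBall _ _)) (integrable_finsetSum _ fun i _ => (hint i).const_mul (w i)) measurableSet_closedBall fun a ha => (hgap _ fun i => hyU i _ ((hsB a ha).trans hsr)).2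
    rw [integral_finsetSum _ fun i _ => (hint i).const_mul (w i)] at h2
    simp only [integral_const_mul] at h2
    have h3 : ∑ i, w i * ∫ a in BB n 1, gap LG u (y i) q (s • a) ≤ ∑ i, w i * (C2 * s ^ 2) := Finset.sum_le_sum fun i _ => mul_le_mul_of_nonneg_left ((hc i).1 s hsp hsr) (hw i)
    rw [← Finset.sum_mul, hw1, one_mul] at h3
    have h4 : gap (fun y => log (us u y)) x q z ≤ 4 * C2 / V * ‖z‖ ^ 2 := by
      rw [div_mul_eq_mul_div, le_div_iff₀ hV0, mul_comm]
      have : C2 * s ^ 2 = 4 * C2 * ‖z‖ ^ 2 := by rw [hsd]; ring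
      linarith
    exact h4.trans (mul_le_mul_of_nonneg_right (le_max_right _ _) (by positivity))
  · intro l hl
    obtain ⟨⟨kc, k0, ks⟩, -⟩ := (hc i0).2
    have hlim : Filter.Tendsto (fun r : ℝ => ∑ i, w i * ((∫ z, gap LG u (y i) q (r • z) * kk (DA ε p q) z) / r ^ 2)) (𝓝[>] 0) (𝓝 (∑ i, w i * (-Rhs ε p lam (y i) q * (∫ z, kap (DA ε p q) z) / 2))) := tendsto_finsetSum _ fun i _ => ((hc i).2.2.2).const_mul (w i)
    have e : ∑ i, w i * (-Rhs ε p lam (y i) q * (∫ z, kap (DA ε p q) z) / 2) = -Rhs ε p lam x q * (∫ z, kap (DA ε p q) z) / 2 := by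
      rw [← hs, ← Rhs_sum ε p lam hw1, ← Finset.sum_neg_distrib, Finset.sum_mul, Finset.sum_div]
      exact Finset.sum_congr rfl fun i _ => by ring
    rw [e] at hlim
    refine le_of_tendsto_of_tendsto hl hlim ?_
    have hsm : ∀ᶠ r : ℝ in 𝓝[>] 0, r ≤ s0 / R1 := nhdsWithin_le_nhds (Iic_mem_nhds (by positivity))
    filter_upwards [hsm, self_mem_nhdsWithin] with r hr hrp
    have hrp : 0 < r := hrp
    have hrR : r * R1 ≤ s0 := by rwa [le_div_iff₀ hR1] at hr
    have hset : ∀ f : EE n → ℝ, ∫ z, f z * kk (DA ε p q) z = ∫ z in closedBall 0 R1, f z * kk (DA ε p q) z := fun f => (setIntegral_eq_integral_of_forall_compl_eq_zero fun z hz => by rw [ks z hz, mul_zero]).symm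
    have hint : ∀ i, IntegrableOn (fun z => gap LG u (y i) q (r • z) * kk (DA ε p q) z) (BB n R1) := fun i => ((gap_contOn hlogU q (hball _ (hyK i)) hrp.le (by linarith)).mul kc.continuousOn).integrableOn_compact (isCompact_closedBall _ _)
    simp only [← mul_div_assoc, ← Finset.sum_div]
    refine div_le_div_of_nonneg_right ?_ (by positivity)
    simp only [hset]
    simp only [← integral_const_mul]
    rw [← integral_finsetSum _ fun i _ => (hint i).const_mul (w i)]
    refine setIntegral_mono_on (((gap_contOn G.ws_contOn q hb' hrp.le (by linarith)).mul kc.continuousOn).integrableOn_compact (isCompact_closedBall _ _)) (integrable_finsetSum _ fun i _ => (hint i).const_mul (w i)) measurableSet_closedBall fun z hz => ?_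
    have hz' : ‖r • z‖ ≤ r0 := by
      rw [mem_closedBall_zero_iff] at hz
      rw [norm_smul, Real.norm_of_nonneg hrp.le]
      have := mul_le_mul_of_nonneg_left hz hrp.le
      linarith
    have := mul_le_mul_of_nonneg_right (hgap _ fun i => hyU i _ hz').2 (k0 z)
    rw [Finset.sum_mul] at this
    refine this.trans (le_of_eq (Finset.sum_congr rfl fun i _ => by ring))
end Good
noncomputable def ws {n : ℕ} (u : EE n → ℝ) (x : EE n) : ℝ := log (us u x)
noncomputable def Qs {n : ℕ} (u : EE n → ℝ) (x : EE n) : EE n := gradient (ws u) x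
lemma hasGradientAt_of_gap {n : ℕ} {w : EE n → ℝ} {x q : EE n} {C r : ℝ} (hr : 0 < r) (h0 : ∀ z, ‖z‖ ≤ r → 0 ≤ gap w x q z) (h1 : ∀ z, ‖z‖ ≤ r → gap w x q z ≤ C * ‖z‖ ^ 2) : HasGradientAt w q x := by
  rw [hasGradientAt_iff_isLittleO_nhds_zero]
  refine Asymptotics.IsBigO.trans_isLittleO ?_ (Asymptotics.isLittleO_norm_pow_id (E' := EE n) one_lt_two)
  refine Asymptotics.IsBigO.of_bound C ?_
  filter_upwards [closedBall_mem_nhds (0 : EE n) hr] with z hz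
  rw [mem_closedBall_zero_iff] at hz
  have a := h0 z hz
  have b := h1 z hz
  simp only [gap] at a b
  rw [Real.norm_eq_abs, Real.norm_of_nonneg (by positivity), abs_le]
  constructor <;> linarith
namespace Good
variable {n : ℕ} {p ε lam : ℝ} {Ω : Set (EE n)} {u : EE n → ℝ}
lemma env3 (G : Good n p ε lam Ω u) {L : Set (EE n)} (hL : IsCompact L) (hLs : L ⊆ {x | 0 < us u x}) : ∃ C r0 R1 : ℝ, 0 ≤ C ∧ 0 < r0 ∧ 0 < R1 ∧ ∀ x ∈ L, closedBall x r0 ⊆ {x | 0 < us u x} ∧ HasGradientAt (ws u) (Qs u x) x ∧ ‖Qs u x‖ ≤ C ∧ (∀ z, ‖z‖ ≤ r0 → 0 ≤ gap (ws u) x (Qs u x) z) ∧ (∀ z, ‖z‖ ≤ r0 → gap (ws u) x (Qs u x) z ≤ C * ‖z‖ ^ 2) ∧ (Continuous (kk (DA ε p (Qs u x))) ∧ (∀ z, 0 ≤ kk (DA ε p (Qs u x)) z) ∧ ∀ z ∉ closedBall 0 R1, kk (DA ε p (Qs u x)) z = 0) ∧ (ContDiff ℝ 1 (kap (DA ε p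 (Qs u x))) ∧ (∀ z, 0 ≤ kap (DA ε p (Qs u x)) z) ∧ tsupport (kap (DA ε p (Qs u x))) ⊆ closedBall 0 R1 ∧ 0 < kap (DA ε p (Qs u x)) 0 ∧ ∀ v z, ⟪DA ε p (Qs u x) v, gradient (kap (DA ε p (Qs u x))) z⟫ = -(kk (DA ε p (Qs u x)) z * ⟪v, z⟫)) ∧ ∀ l, Filter.Tendsto (fun r : ℝ => (∫ z, gap (ws u) x (Qs u x) (r • z) * kk (DA ε p (Qs u x)) z) / r ^ 2) (𝓝[>] 0) (𝓝 l) → l ≤ -Rhs ε p lam x (Qs u x) * (∫ z, kap (DA ε p (Qs u x)) z) / 2 := by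
  obtain ⟨C, r0, R1, hC, hr0, hR1, h⟩ := G.env2 hL hLs
  refine ⟨C, r0, R1, hC, hr0, hR1, fun x hx => ?_⟩
  obtain ⟨hb, q, hq, h0, h1, h2, h3, h4⟩ := h x hx
  have hg : HasGradientAt (ws u) q x := hasGradientAt_of_gap hr0 h0 h1
  have e : Qs u x = q := hg.gradient
  rw [e]
  exact ⟨hb, hg, hq, h0, h1, h2, h3, h4⟩
lemma Qs_lip (G : Good n p ε lam Ω u) {L : Set (EE n)} (hL : IsCompact L) (hLs : L ⊆ {x | 0 < us u x}) : ∃ K : ℝ≥0, LipschitzOnWith K (Qs u) L := by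
  obtain ⟨C, r0, R1, hC, hr0, hR1, h⟩ := G.env3 hL hLs
  have hK0 : 0 ≤ 4 * C + 4 * C / r0 * 2 := by positivity
  refine ⟨(4 * C + 4 * C / r0 * 2).toNNReal, LipschitzOnWith.of_dist_le_mul fun x hx y hy => ?_⟩
  rw [Real.coe_toNNReal _ hK0, dist_eq_norm, dist_eq_norm]
  obtain ⟨-, -, hqx, hx0, hx1, -⟩ := h x hx
  obtain ⟨-, -, hqy, hy0, hy1, -⟩ := h y hy
  set d := ‖x - y‖ with hd
  by_cases hd0 : d = 0
  · have : x = y := by rwa [hd, norm_sub_eq_zero_iff] at hd0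
    rw [this]; simp; positivity
  have hdp : 0 < d := lt_of_le_of_ne (norm_nonneg _) (Ne.symm hd0)
  rcases le_or_gt d (r0 / 2) with hs | hs
  · by_cases hD : ‖Qs u x - Qs u y‖ = 0
    · rw [hD]; positivity
    have hDp : 0 < ‖Qs u x - Qs u y‖ := lt_of_le_of_ne (norm_nonneg _) (Ne.symm hD)
    set D := ‖Qs u x - Qs u y‖ with hDd
    let z := (d / D) • (Qs u x - Qs u y)
    have hz : ‖z‖ = d := by
      simp only [z]
      rw [norm_smul, Real.norm_of_nonneg (by positivity), ← hDd, div_mul_cancel₀ _ hD]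
    have hyx : ‖y - x‖ = d := by rw [hd, norm_sub_rev]
    have hsum : ‖y - x + z‖ ≤ 2 * d := by linarith [norm_add_le (y - x) z]
    have a1 := hy0 z (by linarith)
    have a2 := hx0 (y - x) (by linarith)
    have a3 := hx1 (y - x + z) (by linarith)
    have a4 : C * ‖y - x + z‖ ^ 2 ≤ C * (2 * d) ^ 2 := by gcongr
    simp only [gap] at a1 a2 a3
    have e1 : x + (y - x + z) = y + z := by abel
    have e2 : x + (y - x) = y := by abel
    rw [e1, inner_add_right] at a3
    rw [e2] at a2
    have e3 : ⟪Qs u x, z⟫ - ⟪Qs u y, z⟫ = d * D := by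
      rw [← inner_sub_left]
      simp only [z]
      rw [inner_smul_right, real_inner_self_eq_norm_sq, ← hDd]; field_simp
    have h5 : d * D ≤ d * (4 * C * d) := by nlinarith
    have h6 := le_of_mul_le_mul_left h5 hdp
    have : 0 ≤ 4 * C / r0 * 2 * d := by positivity
    nlinarith
  · have h1 := norm_sub_le (Qs u x) (Qs u y)
    have h2 : 2 * C ≤ 4 * C / r0 * d := by rw [div_mul_eq_mul_div, le_div_iff₀ hr0]; nlinarith
    have h3 : 0 ≤ 4 * C * d := by positivity
    have h4 : 0 ≤ 4 * C / r0 * d := by positivity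
    nlinarith
lemma ws_grad (G : Good n p ε lam Ω u) {x : EE n} (hx : 0 < us u x) : HasGradientAt (ws u) (Qs u x) x := by
  obtain ⟨C, r0, R1, hC, hr0, hR1, h⟩ := G.env3 (isCompact_singleton (x := x)) (by rintro _ rfl; exact hx)
  exact (h x (mem_singleton x)).2.1
lemma Qs_contOn (G : Good n p ε lam Ω u) : ContinuousOn (Qs u) {x | 0 < us u x} := by
  intro x hx
  obtain ⟨r, hr, hrs⟩ := Metric.nhds_basis_closedBall.mem_iff.1 (G.openPos.mem_nhds hx)
  obtain ⟨K, hK⟩ := G.Qs_lip (isCompact_closedBall x r) hrs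
  exact (hK.continuousOn.continuousAt (closedBall_mem_nhds x hr)).continuousWithinAt
lemma us_eq_exp {x : EE n} (hx : 0 < us u x) : us u x = exp (ws u x) := (exp_log hx).symm
lemma us_hasGrad (G : Good n p ε lam Ω u) {x : EE n} (hx : 0 < us u x) : HasGradientAt (us u) (us u x • Qs u x) x := by
  have h := (G.ws_grad hx).hasFDerivAt.exp
  rw [← us_eq_exp hx] at h
  have h2 : HasFDerivAt (us u) (us u x • (InnerProductSpace.toDual ℝ (EE n)) (Qs u x)) x := by
    refine h.congr_of_eventuallyEq ?_
    filter_upwards [G.openPos.mem_nhds hx] with y hy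
    exact us_eq_exp hy
  rw [hasGradientAt_iff_hasFDerivAt]
  refine h2.congr_fderiv ?_
  ext v; simp [inner_smul_left]
lemma us_C1 (G : Good n p ε lam Ω u) : ContDiffOn ℝ 1 (us u) {x | 0 < us u x} := by
  rw [show (1 : WithTop ℕ∞) = 0 + 1 from rfl, contDiffOn_succ_iff_fderiv_of_isOpen G.openPos]
  refine ⟨fun x hx => (G.us_hasGrad hx).hasFDerivAt.differentiableAt.differentiableWithinAt, by simp, ?_⟩
  rw [contDiffOn_zero]
  have hc : ContinuousOn (fun x => (InnerProductSpace.toDual ℝ (EE n)) (us u x • Qs u x)) {x | 0 < us u x} := (InnerProductSpace.toDual ℝ (EE n)).continuous.comp_continuousOn (G.us_cont.continuousOn.smul G.Qs_contOn)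
  exact hc.congr fun x hx => (G.us_hasGrad hx).hasFDerivAt.fderiv
end Good
lemma EE_sum {n : ℕ} (v : EE n) : v = ∑ i, v i • (EuclideanSpace.single i (1 : ℝ) : EE n) := by
  have := (EuclideanSpace.basisFun (Fin n) ℝ).sum_repr v
  simpa using this.symm
noncomputable def trc {n : ℕ} (M : EE n →L[ℝ] EE n) : ℝ := ∑ i, (M (EuclideanSpace.single i 1)) i
lemma tr_int {n : ℕ} {φ : EE n → ℝ} (hφ : ContDiff ℝ 1 φ) (hc : HasCompactSupport φ) (M : EE n →L[ℝ] EE n) : ∫ z, ⟪M z, gradient φ z⟫ = -(trc M * ∫ z, φ z) := by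
  have h : ∀ z, ⟪M z, gradient φ z⟫ = ∑ i, (M z) i * fderiv ℝ φ z (EuclideanSpace.single i 1) := by
    intro z
    rw [real_inner_comm, inner_gradient_left]
    conv_lhs => rw [EE_sum (M z)]
    simp
  simp_rw [h]
  have hfc : ∀ i : Fin n, Continuous fun z => fderiv ℝ φ z (EuclideanSpace.single i 1) := fun i => (hφ.continuous_fderiv one_ne_zero).clm_apply continuous_const
  have hco : ∀ i : Fin n, Continuous fun z => (M z) i := fun i => by fun_prop
  have hL : ∀ i : Fin n, HasCompactSupport fun z => fderiv ℝ φ z (EuclideanSpace.single i 1) := fun i => hc.fderiv_apply ℝ _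
  have hi : ∀ i : Fin n, Integrable fun z => (M z) i * fderiv ℝ φ z (EuclideanSpace.single i 1) := fun i => ((hco i).mul (hfc i)).integrable_of_hasCompactSupport (hL i).mul_left
  rw [integral_finsetSum _ fun i _ => hi i, trc, Finset.sum_mul, ← Finset.sum_neg_distrib]
  refine Finset.sum_congr rfl fun i _ => ?_
  have hfd : ∀ z, HasFDerivAt (fun z => (M z) i) ((EuclideanSpace.proj i : EE n →L[ℝ] ℝ).comp M) z := fun z => ((EuclideanSpace.proj i : EE n →L[ℝ] ℝ).comp M).hasFDerivAt
  rw [integral_mul_fderiv_eq_neg_fderiv_mul_of_integrable]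
  · simp only [fun z => (hfd z).fderiv]
    rw [integral_const_mul]; simp
  · simp only [fun z => (hfd z).fderiv]
    exact (hφ.continuous.integrable_of_hasCompactSupport hc).const_mul _
  · exact hi i
  · exact ((hco i).mul hφ.continuous).integrable_of_hasCompactSupport hc.mul_left
  · intro x _; exact (hfd x).differentiableAt
  · intro x _; exact hφ.differentiable one_ne_zero x
lemma gap_second {n : ℕ} {w : EE n → ℝ} {Q : EE n → EE n} {x : EE n} {D : EE n →L[ℝ] EE n} (hw : ∀ᶠ y in 𝓝 x, HasGradientAt w (Q y) y) (hQ : HasFDerivAt Q D x) {η : ℝ} (hη : 0 < η) : ∃ δ > 0, ∀ z, ‖z‖ ≤ δ → |gap w x (Q x) z + ⟪D z, z⟫ / 2| ≤ η * ‖z‖ ^ 2 := by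
  have h1 := (hasFDerivAt_iff_isLittleO_nhds_zero.1 hQ).def hη
  have hw' : ∀ᶠ z : EE n in 𝓝 0, HasGradientAt w (Q (x + z)) (x + z) := by
    have : Filter.Tendsto (fun z : EE n => x + z) (𝓝 0) (𝓝 x) := by
      have : Continuous fun z : EE n => x + z := by fun_prop
      simpa using this.tendsto 0
    exact this.eventually hw
  obtain ⟨δ, hδ, hδs⟩ := Metric.nhds_basis_closedBall.eventually_iff.1 (h1.and hw')
  refine ⟨δ, hδ, fun z hz => ?_⟩
  let ψ : ℝ → ℝ := fun t => gap w x (Q x) (t • z) + t ^ 2 * ⟪D z, z⟫ / 2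
  have htz : ∀ t ∈ Icc (0 : ℝ) 1, t • z ∈ BB n δ := by
    intro t ht
    rw [mem_closedBall_zero_iff, norm_smul, Real.norm_of_nonneg ht.1]
    nlinarith [ht.2, norm_nonneg z]
  have hd : ∀ t ∈ Icc (0 : ℝ) 1, HasDerivWithinAt ψ (⟪Q x, z⟫ - ⟪Q (x + t • z), z⟫ + t * ⟪D z, z⟫) (Icc 0 1) t := by
    intro t ht
    have hline : HasDerivAt (fun t : ℝ => x + t • z) z t := by simpa using ((hasDerivAt_id t).smul_const z).const_add x
    have a1 := (hδs (htz t ht)).2.hasFDerivAt.comp_hasDerivAt t hline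
    have a2 : HasDerivAt (fun t : ℝ => ⟪Q x, t • z⟫) ⟪Q x, z⟫ t := by
      simp only [inner_smul_right]
      simpa using (hasDerivAt_id t).mul_const ⟪Q x, z⟫
    have a3 : HasDerivAt (fun t : ℝ => t ^ 2 * ⟪D z, z⟫ / 2) (t * ⟪D z, z⟫) t := by
      have := ((hasDerivAt_pow 2 t).mul_const ⟪D z, z⟫).div_const 2
      refine this.congr_deriv ?_
      simp only [Nat.cast_ofNat]; ring
    have := ((a2.const_add (w x)).sub a1).add a3
    exact this.hasDerivWithinAt
  have hb : ∀ t ∈ Ico (0 : ℝ) 1, ‖⟪Q x, z⟫ - ⟪Q (x + t • z), z⟫ + t * ⟪D z, z⟫‖ ≤ η * ‖z‖ ^ 2 := by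
    intro t ht
    have a := (hδs (htz t ⟨ht.1, ht.2.le⟩)).1
    have e : ⟪Q x, z⟫ - ⟪Q (x + t • z), z⟫ + t * ⟪D z, z⟫ = -⟪Q (x + t • z) - Q x - D (t • z), z⟫ := by
      rw [map_smul, inner_sub_left, inner_sub_left, inner_smul_left]
      simp only [conj_trivial]; ring
    rw [e, norm_neg]
    refine (norm_inner_le_norm _ _).trans ?_
    have : ‖t • z‖ ≤ ‖z‖ := by rw [norm_smul, Real.norm_of_nonneg ht.1]; nlinarith [ht.2, norm_nonneg z]
    calc _ ≤ (η * ‖t • z‖) * ‖z‖ := by gcongr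
      _ ≤ (η * ‖z‖) * ‖z‖ := by gcongr
      _ = _ := by ring
  have := norm_image_sub_le_of_norm_deriv_le_segment' hd hb 1 (by simp)
  have e0 : ψ 0 = 0 := by simp [ψ, gap]
  have e1 : ψ 1 = gap w x (Q x) z + ⟪D z, z⟫ / 2 := by simp [ψ]
  rw [e0, e1, sub_zero, sub_zero, mul_one] at this
  exact this
namespace Good
variable {n : ℕ} {p ε lam : ℝ} {Ω : Set (EE n)} {u : EE n → ℝ}
lemma trace_ineq (G : Good n p ε lam Ω u) {x : EE n} (hx : 0 < us u x) {D : EE n →L[ℝ] EE n} (hD : HasFDerivAt (Qs u) D x) : Rhs ε p lam x (Qs u x) ≤ trc ((DA ε p (Qs u x)).comp D) := by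
  obtain ⟨C, r0, R1, hC, hr0, hR1, h⟩ := G.env3 (isCompact_singleton (x := x)) (by rintro _ rfl; exact hx)
  obtain ⟨hb, -, -, -, -, ⟨kc, k0, ks⟩, ⟨pc, p0, ps, pp, hpk⟩, hlim⟩ := h x (mem_singleton x)
  set q := Qs u x with hq
  have hev : ∀ᶠ y in 𝓝 x, HasGradientAt (ws u) (Qs u y) y := by filter_upwards [G.openPos.mem_nhds hx] with y hy using G.ws_grad hy
  have hcs : HasCompactSupport (kap (DA ε p q)) := (isCompact_closedBall 0 R1).of_isClosed_subset (isClosed_tsupport _) ps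
  have hkap : 0 < ∫ z, kap (DA ε p q) z := pc.continuous.integral_pos_of_hasCompactSupport_nonneg_nonzero hcs p0 pp.ne'
  have hset : ∀ f : EE n → ℝ, ∫ z, f z * kk (DA ε p q) z = ∫ z in closedBall 0 R1, f z * kk (DA ε p q) z := fun f => (setIntegral_eq_integral_of_forall_compl_eq_zero fun z hz => by rw [ks z hz, mul_zero]).symm
  have hkint : IntegrableOn (kk (DA ε p q)) (closedBall 0 R1) := kc.continuousOn.integrableOn_compact (isCompact_closedBall _ _)
  have hl : Filter.Tendsto (fun r : ℝ => (∫ z, gap (ws u) x q (r • z) * kk (DA ε p q) z) / r ^ 2) (𝓝[>] 0) (𝓝 (∫ z, -(⟪D z, z⟫ / 2) * kk (DA ε p q) z)) := by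
    rw [Metric.tendsto_nhds]
    intro e he
    set B := ∫ z in closedBall 0 R1, kk (DA ε p q) z with hB
    have hB0 : 0 ≤ B := integral_nonneg k0
    obtain ⟨δ, hδ, hg⟩ := gap_second hev hD (η := e / (R1 ^ 2 * (B + 1))) (by positivity)
    have hsm : ∀ᶠ r : ℝ in 𝓝[>] 0, r ≤ Min.min δ r0 / R1 := nhdsWithin_le_nhds (Iic_mem_nhds (by positivity))
    filter_upwards [hsm, self_mem_nhdsWithin] with r hr hrp
    have hrp : 0 < r := hrp
    rw [le_div_iff₀ hR1] at hr
    have hr1 : r * R1 ≤ δ := hr.trans (min_le_left _ _)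
    have hr2 : r * R1 ≤ r0 := hr.trans (min_le_right _ _)
    rw [← integral_div, hset, show (∫ z, gap (ws u) x q (r • z) * kk (DA ε p q) z / r ^ 2) = ∫ z, (gap (ws u) x q (r • z) / r ^ 2) * kk (DA ε p q) z from integral_congr_ae (Filter.Eventually.of_forall fun z => by simp only; ring), hset, Real.dist_eq, ← integral_sub]
    · refine lt_of_le_of_lt (b := e / (B + 1) * B) ?_ ?_
      · rw [hB, ← integral_const_mul, ← Real.norm_eq_abs]
        refine norm_integral_le_of_norm_le (hkint.const_mul _) ?_
        refine (ae_restrict_iff' measurableSet_closedBall).2 (Filter.Eventually.of_forall fun z hz => ?_)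
        rw [mem_closedBall_zero_iff] at hz
        have hz1 : ‖r • z‖ ≤ r * R1 := by rw [norm_smul, Real.norm_of_nonneg hrp.le]; gcongr
        have a := hg (r • z) (hz1.trans hr1)
        have e1 : gap (ws u) x q (r • z) / r ^ 2 * kk (DA ε p q) z - -(⟪D z, z⟫ / 2) * kk (DA ε p q) z = (gap (ws u) x q (r • z) + ⟪D (r • z), r • z⟫ / 2) / r ^ 2 * kk (DA ε p q) z := by
          rw [map_smul, inner_smul_left, inner_smul_right]
          simp only [conj_trivial]; field_simp; ring
        rw [e1, norm_mul, Real.norm_of_nonneg (k0 z), norm_div, Real.norm_eq_abs, Real.norm_of_nonneg (by positivity : (0:ℝ) ≤ r ^ 2)]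
        refine mul_le_mul_of_nonneg_right ?_ (k0 z)
        rw [div_le_iff₀ (by positivity)]
        refine a.trans ?_
        have : ‖r • z‖ ^ 2 ≤ (r * R1) ^ 2 := by gcongr
        calc _ ≤ e / (R1 ^ 2 * (B + 1)) * (r * R1) ^ 2 := by gcongr
          _ = _ := by rw [← hB]; field_simp
      · rw [div_mul_eq_mul_div, div_lt_iff₀ (by positivity)]; nlinarith
    · refine ((ContinuousOn.div_const (gap_contOn G.ws_contOn q hb hrp.le hr2) _).mul kc.continuousOn).integrableOn_compact (isCompact_closedBall _ _)
    · have : Continuous fun z => -(⟪D z, z⟫ / 2) * kk (DA ε p q) z := by fun_prop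
      exact this.continuousOn.integrableOn_compact (isCompact_closedBall _ _)
  have h1 := hlim _ hl
  have h2 : ∫ z, -(⟪D z, z⟫ / 2) * kk (DA ε p q) z = (∫ z, ⟪((DA ε p q).comp D) z, gradient (kap (DA ε p q)) z⟫) / 2 := by
    rw [← integral_div]
    refine integral_congr_ae (Filter.Eventually.of_forall fun z => ?_)
    simp only [ContinuousLinearMap.comp_apply]
    rw [hpk]; ring
  rw [h2, tr_int pc hcs] at h1
  by_contra hcon
  push Not at hcon
  have := mul_lt_mul_of_pos_right hcon hkap
  linarith
lemma us_compact (G : Good n p ε lam Ω u) (hc : Convex ℝ Ω) {δ : ℝ} (hδ : 0 < δ) : IsCompact {x | δ ≤ us u x} := by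
  refine Metric.isCompact_of_isClosed_isBounded (isClosed_le continuous_const G.us_cont) ?_
  exact G.hΩb.subset fun x hx => G.pos_subset hc (lt_of_lt_of_le hδ hx)
lemma Rhs_contOn (G : Good n p ε lam Ω u) : ContinuousOn (fun x => Rhs ε p lam x (Qs u x)) {x | 0 < us u x} := by
  unfold Rhs
  have h1 : ContinuousOn (fun x => AA ε p (Qs u x)) {x | 0 < us u x} := (AA_cont G.hε p).comp_continuousOn G.Qs_contOn
  have h2 : ContinuousOn (fun x => FF ε p (Qs u x)) {x | 0 < us u x} := (FF_cont G.hε p).comp_continuousOn G.Qs_contOn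
  exact ((h2.sub continuousOn_const).sub (continuousOn_const.mul (h1.inner G.Qs_contOn))).add (h1.inner continuousOn_id)
lemma div_ineq (G : Good n p ε lam Ω u) (hc : Convex ℝ Ω) {δ : ℝ} (hδ : 0 < δ) {θ : EE n → ℝ} (hθ : ContDiff ℝ 1 θ) (hθ0 : ∀ x, 0 ≤ θ x) (hsup : ∀ x, us u x < δ → θ x = 0) : ∫ x, (⟪AA ε p (Qs u x), gradient θ x⟫ + Rhs ε p lam x (Qs u x) * θ x) ≤ 0 := by
  have hts : tsupport θ ⊆ {x | δ ≤ us u x} := by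
    refine closure_minimal (fun x hx => ?_) (isClosed_le continuous_const G.us_cont)
    by_contra h
    exact hx (hsup x (not_le.1 h))
  have hcs : HasCompactSupport θ := (G.us_compact hc hδ).of_isClosed_subset (isClosed_tsupport _) hts
  have hgz : ∀ x, ¬ (δ ≤ us u x) → gradient θ x = 0 := fun x hx => gradient_zero_of_notMem fun h => hx (hts h)
  have hL : IsCompact {x | δ / 2 ≤ us u x} := G.us_compact hc (by positivity)
  have hLs : {x | δ / 2 ≤ us u x} ⊆ {x | 0 < us u x} := fun x hx => lt_of_lt_of_le (half_pos hδ) hx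
  obtain ⟨K, hK⟩ := G.Qs_lip hL hLs
  obtain ⟨C, r0, R1, hC, -, -, hb⟩ := G.env3 hL hLs
  obtain ⟨c, L, hcp, hLp, hAA⟩ := AA_bounds (n := n) G.hε G.hp hC
  obtain ⟨Q', hQ'L, hQ'⟩ := hK.extend_finite_dimension
  have hP : LipschitzOnWith (L.toNNReal * K) (fun x => AA ε p (Qs u x)) {x | δ / 2 ≤ us u x} := by
    refine LipschitzOnWith.of_dist_le_mul fun x hx y hy => ?_
    have h1 := (hAA (Qs u x) (Qs u y) (hb x hx).2.2.1 (hb y hy).2.2.1).2.2.2.1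
    have h2 := hK.dist_le_mul x hx y hy
    rw [dist_eq_norm] at h2 ⊢
    push_cast
    rw [Real.coe_toNNReal _ hLp.le, mul_assoc]
    exact h1.trans (by gcongr)
  obtain ⟨P', hP'L, hP'⟩ := hP.extend_finite_dimension
  have hθL : ∃ K', LipschitzWith K' θ := hθ.lipschitzWith_of_hasCompactSupport hcs one_ne_zero
  obtain ⟨K', hθL⟩ := hθL
  have hPi : ∀ i : Fin n, ∃ Ki : ℝ≥0, LipschitzWith Ki fun x => P' x i := by
    intro i
    exact ⟨_, (EuclideanSpace.proj i : EE n →L[ℝ] ℝ).lipschitz.comp hP'L⟩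
  choose Ki hKi using hPi
  let e : Fin n → EE n := fun i => EuclideanSpace.single i 1
  have hI : ∀ i, Integrable fun x => lineDeriv ℝ (fun x => P' x i) x (e i) * θ x := fun i => ((hKi i).locallyIntegrable_lineDeriv (e i)).integrable_smul_right_of_hasCompactSupport hθ.continuous hcs
  have hfc : ∀ i : Fin n, Continuous fun z => fderiv ℝ θ z (e i) := fun i => (hθ.continuous_fderiv one_ne_zero).clm_apply continuous_const
  have hI2 : ∀ i, Integrable fun x => fderiv ℝ θ x (e i) * P' x i := fun i => ((hfc i).mul (hKi i).continuous).integrable_of_hasCompactSupport (hcs.fderiv_apply ℝ _).mul_right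
  have hibp : ∀ i, ∫ x, fderiv ℝ θ x (e i) * P' x i = -∫ x, lineDeriv ℝ (fun x => P' x i) x (e i) * θ x := by
    intro i
    rw [LipschitzWith.integral_lineDeriv_mul_eq (hKi i) hθL hcs, ← integral_neg]
    refine integral_congr_ae (Filter.Eventually.of_forall fun x => ?_)
    simp only
    rw [((hθ.differentiable one_ne_zero x).lineDeriv_eq_fderiv), map_neg, neg_mul, neg_neg]
  have h1 : ∀ x, ⟪AA ε p (Qs u x), gradient θ x⟫ = ∑ i, fderiv ℝ θ x (e i) * P' x i := by
    intro x
    by_cases hx : δ ≤ us u x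
    · rw [show AA ε p (Qs u x) = P' x from hP' (show δ / 2 ≤ us u x by linarith), real_inner_comm, inner_gradient_left]
      conv_lhs => rw [EE_sum (P' x)]
      simp [e, mul_comm]
    · have : fderiv ℝ θ x = 0 := by
        have := hgz x hx
        ext v; rw [← inner_gradient_left, this]; simp
      rw [hgz x hx, this]; simp
  have hRint : Integrable fun x => Rhs ε p lam x (Qs u x) * θ x := by
    have : IntegrableOn (fun x => Rhs ε p lam x (Qs u x) * θ x) {x | δ ≤ us u x} := ((G.Rhs_contOn.mono fun x hx => lt_of_lt_of_le hδ hx).mul hθ.continuous.continuousOn).integrableOn_compact (G.us_compact hc hδ)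
    rw [← integrableOn_univ]
    refine this.of_forall_sdiff_eq_zero MeasurableSet.univ fun x hx => ?_
    rw [hsup x (not_le.1 hx.2), mul_zero]
  simp_rw [h1]
  rw [integral_add (integrable_finsetSum _ fun i _ => hI2 i) hRint, integral_finsetSum _ fun i _ => hI2 i]
  simp_rw [hibp]
  rw [Finset.sum_neg_distrib, ← integral_finsetSum _ fun i _ => hI i]
  have hmono : ∫ x, Rhs ε p lam x (Qs u x) * θ x ≤ ∫ x, ∑ i, lineDeriv ℝ (fun x => P' x i) x (e i) * θ x := by
    refine integral_mono_ae hRint (integrable_finsetSum _ fun i _ => hI i) ?_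
    filter_upwards [hQ'L.ae_differentiableAt] with x hx
    rcases lt_or_ge (us u x) δ with h | h
    · simp [hsup x h]
    rw [← Finset.sum_mul]
    refine mul_le_mul_of_nonneg_right ?_ (hθ0 x)
    have hnear : {y | δ / 2 ≤ us u y} ∈ 𝓝 x := by filter_upwards [G.us_cont.continuousAt.eventually (lt_mem_nhds (show δ / 2 < us u x by linarith))] with y hy using hy.le
    have hD : HasFDerivAt (Qs u) (fderiv ℝ Q' x) x := hx.hasFDerivAt.congr_of_eventuallyEq (hQ'.eventuallyEq_of_mem hnear)
    refine (G.trace_ineq (by linarith) hD).trans (le_of_eq ?_)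
    unfold trc
    refine Finset.sum_congr rfl fun i _ => ?_
    have hPd : HasFDerivAt P' ((DA ε p (Qs u x)).comp (fderiv ℝ Q' x)) x := ((AA_hasFDerivAt G.hε p (Qs u x)).comp x hD).congr_of_eventuallyEq (hP'.eventuallyEq_of_mem hnear).symm
    have hPid : HasFDerivAt (fun x => P' x i) ((EuclideanSpace.proj i : EE n →L[ℝ] ℝ).comp ((DA ε p (Qs u x)).comp (fderiv ℝ Q' x))) x := (EuclideanSpace.proj i : EE n →L[ℝ] ℝ).hasFDerivAt.comp x hPd
    rw [hPid.differentiableAt.lineDeriv_eq_fderiv, hPid.fderiv]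
    rfl
  linarith
lemma cut_ineq (G : Good n p ε lam Ω u) (hc : Convex ℝ Ω) {δ : ℝ} (hδ : 0 < δ) {h : ℝ → ℝ} (h1 : ContDiff ℝ 1 h) (hm : Monotone h) (h0 : ∀ s, 0 ≤ h s) (hz : ∀ s < δ, h s = 0) : Integrable (fun x => rho n x * (us u x ^ p * h (us u x)) * FF ε p (Qs u x)) ∧ Integrable (fun x => rho n x * (us u x ^ p * h (us u x))) ∧ ∫ x, rho n x * (us u x ^ p * h (us u x)) * FF ε p (Qs u x) ≤ lam * ∫ x, rho n x * (us u x ^ p * h (us u x)) := by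
  have hp := G.hp
  have hK := G.us_compact hc hδ
  have hKs : {x | δ ≤ us u x} ⊆ {x | 0 < us u x} := fun x hx => lt_of_lt_of_le hδ hx
  have hfc : ContDiff ℝ 1 fun s : ℝ => s ^ p := Real.contDiff_rpow_const_of_le (n := 1) (by push_cast; linarith)
  have hf : ContDiff ℝ 1 fun s : ℝ => s ^ p * h s := hfc.mul h1
  set f := fun s : ℝ => s ^ p * h s with hfdef
  have hf0 : ∀ s < δ, f s = 0 := fun s hs => by simp [hfdef, hz s hs]
  have hfnn : ∀ x, 0 ≤ f (us u x) := fun x => mul_nonneg (Real.rpow_nonneg (G.us_nonneg x) p) (h0 _)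
  have hext : ∀ g : EE n → ℝ, ContinuousOn g {x | 0 < us u x} → (∀ x, us u x < δ → g x = 0) → Integrable g := by
    intro g hg hg0
    have := (hg.mono hKs).integrableOn_compact hK (μ := volume)
    rw [← integrableOn_univ]
    exact this.of_forall_sdiff_eq_zero MeasurableSet.univ fun x hx => hg0 x (not_le.1 hx.2)
  have hfu : ContinuousOn (fun x => f (us u x)) {x | 0 < us u x} := (hf.continuous.comp G.us_cont).continuousOn
  have hQ := G.Qs_contOn
  have hFc : ContinuousOn (fun x => FF ε p (Qs u x)) {x | 0 < us u x} := (FF_cont G.hε p).comp_continuousOn hQ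
  have i1 : Integrable (fun x => rho n x * f (us u x) * FF ε p (Qs u x)) := hext _ (((rho_cont n).continuousOn.mul hfu).mul hFc) fun x hx => by rw [hf0 _ hx]; simp
  have i2 : Integrable (fun x => rho n x * f (us u x)) := hext _ ((rho_cont n).continuousOn.mul hfu) fun x hx => by rw [hf0 _ hx]; simp
  refine ⟨i1, i2, ?_⟩
  have hu1 : ∀ x, 0 < us u x → ContDiffAt ℝ 1 (us u) x := fun x hx => G.us_C1.contDiffAt (G.openPos.mem_nhds hx)
  have hθ : ContDiff ℝ 1 fun x => f (us u x) * rho n x := by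
    refine contDiff_of_tsup fun x hx => ?_
    have hx' : δ ≤ us u x := by
      have : tsupport (fun x => f (us u x) * rho n x) ⊆ {x | δ ≤ us u x} := by
        refine closure_minimal (fun y hy => ?_) hK.isClosed
        by_contra hh
        exact hy (by simp only; rw [hf0 _ (not_le.1 hh), zero_mul])
      exact this hx
    exact ((hf.contDiffAt).comp x (hu1 x (hKs hx'))).mul ((rho_contDiff n).of_le (by simp)).contDiffAt
  have D := G.div_ineq hc hδ hθ (fun x => mul_nonneg (hfnn x) (rho_pos n x).le) (fun x hx => by rw [hf0 _ hx, zero_mul])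
  set R := fun x => us u x * (us u x ^ p * deriv h (us u x)) * ⟪AA ε p (Qs u x), Qs u x⟫ * rho n x with hR
  have hRnn : ∀ x, 0 ≤ R x := fun x => by
    refine mul_nonneg (mul_nonneg (mul_nonneg (G.us_nonneg x) (mul_nonneg (Real.rpow_nonneg (G.us_nonneg x) p) hm.deriv_nonneg)) ?_) (rho_pos n x).le
    unfold AA
    rw [real_inner_smul_left, real_inner_self_eq_norm_sq]
    have := G.hε; positivity
  have hdz : ∀ s < δ, deriv h s = 0 := fun s hs => by
    have : h =ᶠ[𝓝 s] fun _ => 0 := by filter_upwards [gt_mem_nhds hs] with t ht using hz t ht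
    rw [this.deriv_eq, deriv_const]
  have hRi : Integrable R := by
    refine hext R ?_ fun x hx => by simp [hR, hdz _ hx]
    have c1 : Continuous fun x => us u x * (us u x ^ p * deriv h (us u x)) := G.us_cont.mul ((hfc.continuous.comp G.us_cont).mul ((h1.continuous_deriv le_rfl).comp G.us_cont))
    exact (c1.continuousOn.mul (((AA_cont G.hε p).comp_continuousOn hQ).inner hQ)).mul (rho_cont n).continuousOn
  have heq : ∀ x, ⟪AA ε p (Qs u x), gradient (fun x => f (us u x) * rho n x) x⟫ + Rhs ε p lam x (Qs u x) * (f (us u x) * rho n x) = R x + (rho n x * f (us u x) * FF ε p (Qs u x) - lam * (rho n x * f (us u x))) := by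
    intro x
    rcases lt_or_ge (us u x) δ with hx | hx
    · have : gradient (fun x => f (us u x) * rho n x) x = 0 := by
        rw [gradient_congr (g := fun _ => 0)]
        · simp [gradient_fun_const]
        · filter_upwards [G.us_cont.continuousAt.eventually (gt_mem_nhds hx)] with y hy
          rw [hf0 _ hy, zero_mul]
      rw [this, hf0 _ hx]; simp [hR, hdz _ hx]
    · have hx0 : 0 < us u x := lt_of_lt_of_le hδ hx
      have hd : HasDerivAt f (p * us u x ^ (p - 1) * h (us u x) + us u x ^ p * deriv h (us u x)) (us u x) := (Real.hasDerivAt_rpow_const (Or.inl hx0.ne')).mul (h1.differentiable one_ne_zero _).hasDerivAt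
      have hus := G.us_hasGrad hx0
      have e1 : gradient (fun x => f (us u x)) x = _ := gradient_comp hd hus.differentiableAt
      have hfd : DifferentiableAt ℝ (fun x => f (us u x)) x := hd.differentiableAt.comp x hus.differentiableAt
      rw [gradient_mul hfd (rho_fderiv n x).differentiableAt, rho_gradient, e1, hus.gradient]
      simp only [inner_add_right, inner_smul_right, hR, Rhs, hfdef]
      have : us u x ^ p = us u x ^ (p - 1) * us u x := by rw [← Real.rpow_add_one hx0.ne']; ring_nf
      rw [this]
      ring
  have i3 : Integrable fun x => rho n x * f (us u x) * FF ε p (Qs u x) - lam * (rho n x * f (us u x)) := i1.sub (i2.const_mul lam)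
  rw [integral_congr_ae (Filter.Eventually.of_forall heq), integral_add hRi i3, integral_sub i1 (i2.const_mul lam), integral_const_mul] at D
  linarith [integral_nonneg (μ := volume) (show 0 ≤ R from hRnn)]
lemma us_pow_int (G : Good n p ε lam Ω u) (hc : Convex ℝ Ω) : Integrable fun x => us u x ^ p * rho n x := by
  have hp := G.hp
  refine Continuous.integrable_of_hasCompactSupport ((Real.continuous_rpow_const (by linarith)).comp G.us_cont |>.mul (rho_cont n)) ?_
  refine hasCompactSupport_of_zero_off G.hΩb fun x hx => ?_
  simp [G.us_zero_off hc x hx, Real.zero_rpow (by linarith : p ≠ 0)]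
lemma jd_us (G : Good n p ε lam Ω u) {x : EE n} (hx : 0 < us u x) : jd ε p (us u) x = us u x ^ p * FF ε p (Qs u x) := jd_log G.hε p hx (G.us_hasGrad hx).differentiableAt
lemma us_energy (G : Good n p ε lam Ω u) (hc : Convex ℝ Ω) : IntegrableOn (fun x => jd ε p (us u) x * rho n x) {x | 0 < us u x} ∧ ∫ x in {x | 0 < us u x}, jd ε p (us u) x * rho n x ≤ lam * ∫ x, us u x ^ p * rho n x := by
  have hmeas : MeasurableSet {x | 0 < us u x} := G.openPos.measurableSet
  let φ : ℕ → Set (EE n) := fun k => {x | 2 / ((k : ℝ) + 1) ≤ us u x}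
  have hφ : AECover (volume.restrict {x | 0 < us u x}) Filter.atTop φ := by
    refine ⟨?_, fun k => (isClosed_le continuous_const G.us_cont).measurableSet⟩
    refine (ae_restrict_iff' hmeas).2 (Filter.Eventually.of_forall fun x hx => ?_)
    have ht : Filter.Tendsto (fun k : ℕ => 2 / ((k : ℝ) + 1)) Filter.atTop (𝓝 0) := by simpa [div_eq_mul_inv] using tendsto_one_div_add_atTop_nhds_zero_nat (𝕜 := ℝ) |>.const_mul 2
    filter_upwards [ht.eventually (gt_mem_nhds (show 0 < us u x from hx))] with k hk using hk.le
  have hjn : ∀ x, 0 ≤ jd ε p (us u) x * rho n x := fun x => mul_nonneg (jd_nonneg G.hε p _ x) (rho_pos n x).le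
  have main : ∀ k, IntegrableOn (fun x => jd ε p (us u) x * rho n x) (φ k) ∧ ∫ x in φ k, jd ε p (us u) x * rho n x ≤ lam * ∫ x, us u x ^ p * rho n x := by
    intro k
    have hk : (0 : ℝ) < (k : ℝ) + 1 := by positivity
    have hsm : Monotone fun s : ℝ => Real.smoothTransition (((k : ℝ) + 1) * s - 1) := fun a b hab => Real.smoothTransition.monotone (by nlinarith)
    have hsd : ContDiff ℝ 1 fun s : ℝ => Real.smoothTransition (((k : ℝ) + 1) * s - 1) := (Real.smoothTransition.contDiff (n := 1)).comp (by fun_prop)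
    obtain ⟨i1, i2, hle⟩ := G.cut_ineq hc (δ := 1 / ((k : ℝ) + 1)) (by positivity) hsd hsm (fun s => Real.smoothTransition.nonneg _) (fun s hs => by
        rw [lt_div_iff₀ hk] at hs
        exact Real.smoothTransition.zero_of_nonpos (by nlinarith))
    have hφm : MeasurableSet (φ k) := (isClosed_le continuous_const G.us_cont).measurableSet
    have heq : ∀ x ∈ φ k, rho n x * (us u x ^ p * Real.smoothTransition (((k : ℝ) + 1) * us u x - 1)) * FF ε p (Qs u x) = jd ε p (us u) x * rho n x := fun x hx => by
      have hx : 2 / ((k : ℝ) + 1) ≤ us u x := hx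
      have hx0 : 0 < us u x := lt_of_lt_of_le (by positivity) hx
      rw [div_le_iff₀ hk] at hx
      rw [Real.smoothTransition.one_of_one_le (by nlinarith), G.jd_us hx0]; ring
    refine ⟨i1.integrableOn.congr_fun heq hφm, ?_⟩
    rw [← setIntegral_congr_fun hφm heq]
    refine (setIntegral_le_integral i1 (Filter.Eventually.of_forall fun x => ?_)).trans (hle.trans (mul_le_mul_of_nonneg_left (integral_mono i2 (G.us_pow_int hc) fun x => ?_) G.hlam.le))
    · exact mul_nonneg (mul_nonneg (rho_pos n x).le (mul_nonneg (Real.rpow_nonneg (G.us_nonneg x) p) (Real.smoothTransition.nonneg _))) (FF_pos G.hε p _).le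
    · simp only
      rw [mul_comm]
      exact mul_le_mul_of_nonneg_right (mul_le_of_le_one_right (Real.rpow_nonneg (G.us_nonneg x) p) (Real.smoothTransition.le_one _)) (rho_pos n x).le
  have hsub : ∀ k, φ k ⊆ {x | 0 < us u x} := fun k x hx => lt_of_lt_of_le (by positivity : (0 : ℝ) < 2 / ((k : ℝ) + 1)) hx
  have hrr : ∀ k, (volume.restrict {x | 0 < us u x}).restrict (φ k) = volume.restrict (φ k) := fun k => Measure.restrict_restrict_of_subset (hsub k)
  have hI := hφ.integrable_of_integral_bounded_of_nonneg_ae (f := fun x => jd ε p (us u) x * rho n x) (lam * ∫ x, us u x ^ p * rho n x) (fun k => by unfold IntegrableOn; rw [hrr]; exact (main k).1) (Filter.Eventually.of_forall hjn) (Filter.Eventually.of_forall fun k => by rw [hrr]; exact (main k).2)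
  refine ⟨hI, le_of_tendsto (hφ.integral_tendsto_of_countably_generated hI) (Filter.Eventually.of_forall fun k => ?_)⟩
  rw [hrr]; exact (main k).2
end Good
lemma FF_tangent {n : ℕ} {ε p : ℝ} (hε : 0 < ε) (hp : 1 < p) {q q' : EE n} (hne : q ≠ q') : FF ε p q + p * ⟪AA ε p q, q' - q⟫ < FF ε p q' := by
  set ξ := q' - q with hξ
  have hξ0 : 0 < ‖ξ‖ := norm_pos_iff.2 (sub_ne_zero.2 hne.symm)
  obtain ⟨t, ht, hd⟩ := exists_hasDerivAt_eq_slope (fun t : ℝ => FF ε p (q + t • ξ)) (fun t => p * ⟪AA ε p (q + t • ξ), ξ⟫) zero_lt_one (fun t _ => (FF_hasDerivAt hε p q ξ t).continuousAt.continuousWithinAt) (fun t _ => FF_hasDerivAt hε p q ξ t)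
  obtain ⟨c, L, hc, -, hb⟩ := AA_bounds (n := n) hε hp (M := ‖q‖ + ‖q + t • ξ‖) (by positivity)
  have h := (hb (q + t • ξ) q (by linarith [norm_nonneg q]) (by linarith [norm_nonneg (q + t • ξ)])).2.2.1
  rw [add_sub_cancel_left, inner_smul_right, inner_sub_left, norm_smul, mul_pow, Real.norm_eq_abs, sq_abs] at h
  have h2 : 0 < c * (t ^ 2 * ‖ξ‖ ^ 2) := by have := ht.1; positivity
  have h3 : 0 < ⟪AA ε p (q + t • ξ), ξ⟫ - ⟪AA ε p q, ξ⟫ := (mul_pos_iff_of_pos_left ht.1).1 (h2.trans_le h)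
  simp only [one_smul, zero_smul, add_zero, sub_zero, div_one, hξ, add_sub_cancel] at hd
  rw [← hξ] at hd
  nlinarith
lemma FF_tangent_le {n : ℕ} {ε p : ℝ} (hε : 0 < ε) (hp : 1 < p) (q q' : EE n) : FF ε p q + p * ⟪AA ε p q, q' - q⟫ ≤ FF ε p q' := by
  rcases eq_or_ne q q' with rfl | h
  · simp
  · exact (FF_tangent hε hp h).le
lemma FF_conv {n : ℕ} {ε p : ℝ} (hε : 0 < ε) (hp : 1 < p) (q q' : EE n) {a : ℝ} (h0 : 0 ≤ a) (h1 : a ≤ 1) : FF ε p (a • q + (1 - a) • q') ≤ a * FF ε p q + (1 - a) * FF ε p q' ∧ (0 < a → FF ε p (a • q + (1 - a) • q') = a * FF ε p q + (1 - a) * FF ε p q' → a < 1 → q = q') := by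
  set m := a • q + (1 - a) • q' with hm
  have e : a * ⟪AA ε p m, q - m⟫ + (1 - a) * ⟪AA ε p m, q' - m⟫ = 0 := by
    rw [← inner_smul_right, ← inner_smul_right, ← inner_add_right]
    have : a • (q - m) + (1 - a) • (q' - m) = 0 := by rw [hm]; module
    rw [this, inner_zero_right]
  have t1 := FF_tangent_le hε hp m q
  have t2 := FF_tangent_le hε hp m q'
  refine ⟨by nlinarith, fun ha he ha1 => ?_⟩
  by_contra hne
  have hmq : m ≠ q := fun h => by
    have : (1 - a) • (q - q') = 0 := by rw [show (1 - a) • (q - q') = q - m by rw [hm]; module, h]; simp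
    rcases smul_eq_zero.1 this with h | h
    · linarith
    · exact hne (sub_eq_zero.1 h)
  have t3 := FF_tangent hε hp hmq
  nlinarith
namespace Good
variable {n : ℕ} {p ε lam : ℝ} {Ω : Set (EE n)} {u : EE n → ℝ}
lemma grad_eq (G : Good n p ε lam Ω u) (hc : Convex ℝ Ω) : ∀ x, 0 < u x → (u x)⁻¹ • gradient u x = Qs u x := by
  have hp := G.hp
  have hε := G.hε
  have hp0 : p ≠ 0 := by linarith
  set W := {x | 0 < us u x} with hW
  have hWo : IsOpen W := G.openPos
  have hUW : {x | 0 < u x} ⊆ W := fun x hx => lt_of_lt_of_le hx (G.u_le_us x)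
  set P := fun x => (u x)⁻¹ • gradient u x with hP
  set s := fun x => u x ^ p / 2 + 1 * (us u x ^ p / 2) with hs
  have hfc : ContDiff ℝ 1 fun t : ℝ => t ^ p / 2 := (Real.contDiff_rpow_const_of_le (n := 1) (by push_cast; linarith)).div_const 2
  have hun : ∀ x, 0 ≤ u x ^ p := fun x => Real.rpow_nonneg (G.nonneg x) p
  have husn : ∀ x, 0 ≤ us u x ^ p := fun x => Real.rpow_nonneg (G.us_nonneg x) p
  have hsn : ∀ x, 0 ≤ s x := fun x => by have := hun x; have := husn x; simp only [hs]; linarith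
  have hspos : ∀ x ∈ W, 0 < s x := fun x hx => by
    have := hun x; have := Real.rpow_pos_of_pos (show 0 < us u x from hx) p
    simp only [hs]; linarith
  have hsc : Continuous s := (hfc.continuous.comp G.cont).add (continuous_const.mul (hfc.continuous.comp G.us_cont))
  set σ := fun x => s x ^ (1 / p) with hσ
  have hip : 0 ≤ 1 / p := by positivity
  have hσc : Continuous σ := (Real.continuous_rpow_const hip).comp hsc
  have hσp : ∀ x, σ x ^ p = s x := fun x => by simp only [hσ]; rw [← Real.rpow_mul (hsn x), one_div_mul_cancel hp0, Real.rpow_one]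
  have hs0 : ∀ x ∉ W, s x = 0 := fun x hx => by
    have h1 : us u x = 0 := le_antisymm (not_lt.1 hx) (G.us_nonneg x)
    have h2 : u x = 0 := le_antisymm (h1 ▸ G.u_le_us x) (G.nonneg x)
    simp [hs, h1, h2, Real.zero_rpow hp0]
  have hσ0 : ∀ x ∉ W, σ x = 0 := fun x hx => by simp only [hσ]; rw [hs0 x hx, Real.zero_rpow (by positivity)]
  have hσpos : {x | 0 < σ x} = W := by
    ext x
    refine ⟨fun hx => ?_, fun hx => Real.rpow_pos_of_pos (hspos x hx) _⟩
    by_contra h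
    have hx : 0 < σ x := hx
    rw [hσ0 x h] at hx; exact lt_irrefl _ hx
  have hu1 : ContDiffOn ℝ 1 u W := G.c1.mono (G.pos_subset hc)
  have hs1 : ContDiffOn ℝ 1 s W := (hfc.comp_contDiffOn hu1).add (contDiffOn_const.mul (hfc.comp_contDiffOn G.us_C1))
  have hσ1 : ContDiffOn ℝ 1 σ W := hs1.rpow_const_of_ne fun x hx => (hspos x hx).ne'
  have dW : ∀ {f : EE n → ℝ}, ContDiffOn ℝ 1 f W → ∀ x ∈ W, DifferentiableAt ℝ f x := fun hf x hx => (hf.contDiffAt (hWo.mem_nhds hx)).differentiableAt one_ne_zero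
  set α := fun x => u x ^ p / (2 * s x) with hα
  have hα1 : ∀ x ∈ W, us u x ^ p / (2 * s x) = 1 - α x := fun x hx => by
    have := hspos x hx
    simp only [hα]
    rw [eq_sub_iff_add_eq, ← add_div, div_eq_one_iff_eq (by positivity)]
    simp only [hs]; ring
  have hgs : ∀ x ∈ W, gradient (fun y => log (σ y)) x = α x • P x + (1 - α x) • Qs u x := by
    intro x hx
    have hsx := hspos x hx
    have hd : HasDerivAt (fun t : ℝ => log (t ^ (1 / p))) (1 / p / s x) (s x) := by
      refine ((Real.hasDerivAt_rpow_const (Or.inl hsx.ne')).log (Real.rpow_pos_of_pos hsx _).ne').congr_deriv ?_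
      rw [Real.rpow_sub_one hsx.ne']
      have := Real.rpow_pos_of_pos hsx (1 / p)
      field_simp
    have e1 : gradient (fun y => log (σ y)) x = _ := gradient_comp (f := fun t : ℝ => log (t ^ (1 / p))) (v := s) hd (dW hs1 x hx)
    have hdt : ∀ t : ℝ, HasDerivAt (fun t : ℝ => t ^ p / 2) (p * t ^ (p - 1) / 2) t := fun t => (Real.hasDerivAt_rpow_const (Or.inr hp.le)).div_const 2
    have e2 : gradient s x = _ := gradient_add_smul 1 (hfc.comp_contDiffOn hu1 |> fun h => dW h x hx) (hfc.comp_contDiffOn G.us_C1 |> fun h => dW h x hx)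
    have e3 : gradient (fun y => u y ^ p / 2) x = _ := gradient_comp (hdt _) (dW hu1 x hx)
    have e4 : gradient (fun y => us u y ^ p / 2) x = _ := gradient_comp (hdt _) (dW G.us_C1 x hx)
    have e5 : u x ^ (p - 1) • gradient u x = u x ^ p • P x := by
      rcases (G.nonneg x).eq_or_lt with h | h
      · rw [← h, Real.zero_rpow (by linarith), Real.zero_rpow hp0]; simp
      · simp only [hP]; rw [smul_smul, Real.rpow_sub_one h.ne']; rfl
    have e6 : us u x ^ (p - 1) • us u x • Qs u x = us u x ^ p • Qs u x := by
      have h : us u x ≠ 0 := ne_of_gt hx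
      rw [smul_smul, Real.rpow_sub_one h, div_mul_cancel₀ _ h]
    rw [e1, e2]
    change _ • (gradient (fun y => u y ^ p / 2) x + (1 : ℝ) • gradient (fun y => us u y ^ p / 2) x) = _
    rw [e3, e4, (G.us_hasGrad hx).gradient, one_smul, ← hα1 x hx]
    simp only [hα]
    rw [div_eq_inv_mul (u x ^ p), div_eq_inv_mul (us u x ^ p), mul_smul, mul_smul, ← e5, ← e6]
    simp only [smul_add, smul_smul]
    congr 2 <;> field_simp
  have hα01 : ∀ x ∈ W, 0 ≤ α x ∧ α x ≤ 1 := fun x hx => by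
    have := hspos x hx
    have h1 := hα1 x hx
    have h2 : 0 ≤ us u x ^ p / (2 * s x) := div_nonneg (husn x) (by positivity)
    exact ⟨div_nonneg (hun x) (by positivity), by linarith⟩
  set E := fun x => 1 / 2 * (u x ^ p * FF ε p (P x) * rho n x) + 1 / 2 * (us u x ^ p * FF ε p (Qs u x) * rho n x) with hE
  have hEα : ∀ x ∈ W, E x = s x * (α x * FF ε p (P x) + (1 - α x) * FF ε p (Qs u x)) * rho n x := by
    intro x hx
    have := hspos x hx
    rw [← hα1 x hx]; simp only [hE, hα]; field_simp
  have hjσ : ∀ x ∈ W, jd ε p σ x = s x * FF ε p (α x • P x + (1 - α x) • Qs u x) := by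
    intro x hx
    rw [jd_log hε p (show x ∈ {x | 0 < σ x} from hσpos ▸ hx) (dW hσ1 x hx), hσp, hgs x hx]
  have hle : ∀ x ∈ W, jd ε p σ x * rho n x ≤ E x := fun x hx => by
    rw [hEα x hx, hjσ x hx]
    exact mul_le_mul_of_nonneg_right (mul_le_mul_of_nonneg_left (FF_conv hε hp _ _ (hα01 x hx).1 (hα01 x hx).2).1 (hspos x hx).le) (rho_pos n x).le
  have hjP : ∀ x ∈ {x | 0 < u x}, jd ε p u x * rho n x = u x ^ p * FF ε p (P x) * rho n x := by
    intro x hx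
    have hx : 0 < u x := hx
    rw [jd_log hε p hx (G.diffU hx), gradient_comp (Real.hasDerivAt_log hx.ne') (G.diffU hx)]
  have hz : ∀ x ∈ W \ {x | 0 < u x}, u x ^ p * FF ε p (P x) * rho n x = 0 := fun x hx => by rw [le_antisymm (not_lt.1 hx.2) (G.nonneg x), Real.zero_rpow hp0]; simp
  have hiu : IntegrableOn (fun x => u x ^ p * FF ε p (P x) * rho n x) W := (G.int.congr_fun hjP G.openU.measurableSet).of_forall_sdiff_eq_zero hWo.measurableSet hz
  have hvu : ∫ x in W, u x ^ p * FF ε p (P x) * rho n x = lam := by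
    rw [setIntegral_eq_of_subset_of_forall_sdiff_eq_zero hWo.measurableSet hUW hz, ← G.val]
    exact (setIntegral_congr_fun G.openU.measurableSet hjP).symm
  have hjQ : ∀ x ∈ W, jd ε p (us u) x * rho n x = us u x ^ p * FF ε p (Qs u x) * rho n x := fun x hx => by rw [G.jd_us hx]
  obtain ⟨hi2, hv2⟩ := G.us_energy hc
  rw [setIntegral_congr_fun hWo.measurableSet hjQ] at hv2
  have hi2 := hi2.congr_fun hjQ hWo.measurableSet
  have hiE : IntegrableOn E W := (hiu.const_mul _).add (hi2.const_mul _)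
  have hvE : ∫ x in W, E x ≤ 1 / 2 * lam + 1 / 2 * (lam * ∫ x, us u x ^ p * rho n x) := by
    have : ∫ x in W, E x = _ := integral_add (hiu.const_mul (1 / 2)) (hi2.const_mul (1 / 2))
    rw [this, integral_const_mul, integral_const_mul, hvu]
    linarith
  have hjc : ContinuousOn (fun x => jd ε p σ x * rho n x) W := by
    unfold jd
    exact (ContinuousOn.rpow_const ((continuousOn_const.mul (hσc.continuousOn.pow 2)).add ((gradient_contOn hWo hσ1).norm.pow 2)) fun x hx => Or.inr (by linarith)).mul (rho_cont n).continuousOn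
  have hij : IntegrableOn (fun x => jd ε p σ x * rho n x) W := by
    refine hiE.mono' (hjc.aestronglyMeasurable hWo.measurableSet) ((ae_restrict_iff' hWo.measurableSet).2 (Filter.Eventually.of_forall fun x hx => ?_))
    rw [Real.norm_of_nonneg (mul_nonneg (jd_nonneg hε p σ x) (rho_pos n x).le)]
    exact hle x hx
  have hm := G.min σ hσc (fun x => Real.rpow_nonneg (hsn x) _) (fun x hx => hσ0 x fun h => hx (G.pos_subset hc h)) (by rw [hσpos]; exact hσ1) (by rw [hσpos]; exact hij)
  rw [hσpos] at hm
  have hmass : ∫ x, σ x ^ p * rho n x = 1 / 2 + 1 / 2 * ∫ x, us u x ^ p * rho n x := by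
    have hiu' : Integrable fun x => u x ^ p * rho n x := by
      by_contra h
      have := integral_undef h
      rw [G.mass] at this; exact one_ne_zero this
    have : ∀ x, σ x ^ p * rho n x = 1 / 2 * (u x ^ p * rho n x) + 1 / 2 * (us u x ^ p * rho n x) := fun x => by rw [hσp]; simp only [hs]; ring
    simp_rw [this]
    rw [integral_add (hiu'.const_mul _) ((G.us_pow_int hc).const_mul _), integral_const_mul, integral_const_mul, G.mass, mul_one]
  rw [hmass] at hm
  have hzero : ∫ x in W, (E x - jd ε p σ x * rho n x) = 0 := by
    refine le_antisymm ?_ (setIntegral_nonneg hWo.measurableSet fun x hx => sub_nonneg.2 (hle x hx))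
    rw [integral_sub hiE hij]; nlinarith
  have hae := (setIntegral_eq_zero_iff_of_nonneg_ae ((ae_restrict_iff' hWo.measurableSet).2 (Filter.Eventually.of_forall fun x hx => sub_nonneg.2 (hle x hx))) (hiE.sub hij)).1 hzero
  have hPc : ContinuousOn P {x | 0 < u x} := (G.cont.continuousOn.inv₀ fun x hx => ne_of_gt hx).smul ((gradient_contOn G.hΩ G.c1).mono G.subU)
  have hrp : Continuous fun t : ℝ => t ^ p := Real.continuous_rpow_const (by linarith)
  have hEc : ContinuousOn E {x | 0 < u x} := by refine (continuousOn_const.mul (((hrp.comp G.cont).continuousOn.mul ((FF_cont hε p).comp_continuousOn hPc)).mul (rho_cont n).continuousOn)).add (continuousOn_const.mul (((hrp.comp G.us_cont).continuousOn.mul ((FF_cont hε p).comp_continuousOn (G.Qs_contOn.mono hUW))).mul (rho_cont n).continuousOn))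
  have hev := Measure.eqOn_open_of_ae_eq (ae_restrict_of_ae_restrict_of_subset hUW hae) G.openU (hEc.sub (hjc.mono hUW)) continuousOn_const
  intro x hx
  have hxW : x ∈ W := hUW hx
  have h := hev hx
  have hsx := hspos x hxW
  have hr := rho_pos n x
  change E x - jd ε p σ x * rho n x = 0 at h
  rw [hEα x hxW, hjσ x hxW, sub_eq_zero] at h
  have h := mul_left_cancel₀ hsx.ne' (mul_right_cancel₀ hr.ne' h)
  refine (FF_conv hε hp _ _ (hα01 x hxW).1 (hα01 x hxW).2).2 ?_ h.symm ?_
  · exact div_pos (Real.rpow_pos_of_pos hx p) (by positivity)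
  · have : 0 < us u x ^ p / (2 * s x) := div_pos (Real.rpow_pos_of_pos hxW p) (by positivity)
    linarith [hα1 x hxW]
lemma exists_pos (G : Good n p ε lam Ω u) : ∃ x, 0 < u x := by
  by_contra h
  push Not at h
  have h0 : ∀ x, u x = 0 := fun x => le_antisymm (h x) (G.nonneg x)
  have := G.mass
  simp [h0, Real.zero_rpow (by linarith [G.hp] : p ≠ 0)] at this
lemma eq_us (G : Good n p ε lam Ω u) (hc : Convex ℝ Ω) : ∀ x, u x = us u x := by
  have hg := G.grad_eq hc
  set W := {x | 0 < us u x} with hW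
  have hWo : IsOpen W := G.openPos
  have hsub : W ⊆ {x | x ∈ W ∧ u x = us u x} := by
    refine IsPreconnected.subset_left_of_subset_union (v := {x | x ∈ W ∧ u x ≠ us u x}) ?_ (hWo.inter (isOpen_ne_fun G.cont G.us_cont)) ?_ ?_ ?_ G.convPos.isPreconnected
    · refine isOpen_iff_mem_nhds.2 fun x hx => ?_
      have hx0 : x ∈ {x | 0 < u x} := by
        have h1 : 0 < us u x := hx.1
        show 0 < u x
        rw [hx.2]; exact h1
      obtain ⟨r, hr, hb⟩ := Metric.isOpen_iff.1 G.openU x hx0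
      have hbW : ∀ y ∈ ball x r, 0 < us u y := fun y hy => lt_of_lt_of_le (hb hy) (G.u_le_us y)
      filter_upwards [ball_mem_nhds x hr] with y hy
      refine ⟨hbW y hy, ?_⟩
      have hD : ∀ z ∈ ball x r, HasFDerivAt (fun z => log (u z) - ws u z) (0 : EE n →L[ℝ] ℝ) z := by
        intro z hz
        have h1 : HasFDerivAt LG u _ z := (G.diffU (hb hz)).hasFDerivAt.log (ne_of_gt (hb hz))
        have h2 := (G.ws_grad (hbW z hz)).hasFDerivAt
        refine (h1.sub h2).congr_fderiv ?_
        ext v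
        have := congrArg (fun q => ⟪q, v⟫) (hg z (hb hz))
        simp only [inner_smul_left, inner_gradient_left] at this
        simpa [sub_eq_zero] using this
      have hk : ∀ z ∈ ball x r, ‖fderivWithin ℝ (fun z => log (u z) - ws u z) (ball x r) z‖ ≤ 0 := by
        intro z hz
        rw [fderivWithin_of_isOpen isOpen_ball hz, (hD z hz).fderiv, norm_zero]
      have := (convex_ball x r).norm_image_sub_le_of_norm_fderivWithin_le (fun z hz => (hD z hz).differentiableAt.differentiableWithinAt) hk (mem_ball_self hr) hy
      rw [zero_mul, norm_le_zero_iff] at this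
      have hxx : log (u x) - ws u x = 0 := by unfold ws; rw [hx.2, sub_self]
      simp only [hxx, sub_zero] at this
      exact Real.log_injOn_pos (hb hy) (hbW y hy) (sub_eq_zero.1 this)
    · exact Set.disjoint_left.2 fun x hx hx' => hx'.2 hx.2
    · exact fun x hx => by by_cases h : u x = us u x <;> [left; right] <;> exact ⟨hx, h⟩
    · obtain ⟨y, hy⟩ := G.exists_pos
      obtain ⟨x, hx⟩ := G.cont.exists_forall_ge_of_hasCompactSupport (hasCompactSupport_of_zero_off G.hΩb G.zero)
      have hx0 : 0 < u x := hy.trans_le (hx y)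
      have hT : (log (u x), (0 : EE n)) ∈ Tset u := fun y => by simp [Real.exp_log hx0, hx y]
      have h1 := us_le hT x
      simp only [inner_zero_left, add_zero, Real.exp_log hx0] at h1
      have h2 := G.u_le_us x
      exact ⟨x, hx0.trans_le h2, hx0.trans_le h2, le_antisymm h2 h1⟩
  intro x
  by_cases hx : x ∈ W
  · exact (hsub hx).2
  · have h1 : us u x = 0 := le_antisymm (not_lt.1 hx) (G.us_nonneg x)
    rw [h1]; exact le_antisymm (h1 ▸ G.u_le_us x) (G.nonneg x)
end Good
lemma jd_zero {n : ℕ} {ε p : ℝ} (hp : 1 < p) {v : EE n → ℝ} (h0 : ∀ x, 0 ≤ v x) {x : EE n} (hx : v x = 0) : jd ε p v x = 0 := by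
  have h : IsLocalMin v x := Filter.Eventually.of_forall fun y => by rw [hx]; exact h0 y
  have : gradient v x = 0 := by simp [gradient, h.fderiv_eq_zero]
  simp [jd, hx, this, Real.zero_rpow (by linarith : p / 2 ≠ 0)]
namespace Good
variable {n : ℕ} {p ε lam : ℝ} {Ω : Set (EE n)} {u : EE n → ℝ}
lemma first_var (G : Good n p ε lam Ω u) {K : Set (EE n)} (hK : IsCompact K) (hKΩ : K ⊆ Ω) {φ : EE n → ℝ} (hφ : ContDiff ℝ 1 φ) (hφ0 : ∀ x, 0 ≤ φ x) (hφK : tsupport φ ⊆ K) : ContinuousOn (fun x => √(ε * u x ^ 2 + ‖gradient u x‖ ^ 2) ^ (p - 2) * (ε * u x * φ x + ⟪gradient u x, gradient φ x⟫) * rho n x) K ∧ 0 ≤ ∫ x in K, √(ε * u x ^ 2 + ‖gradient u x‖ ^ 2) ^ (p - 2) * (ε * u x * φ x + ⟪gradient u x, gradient φ x⟫) * rho n x := by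
  have hp := G.hp
  have hε := G.hε
  have hp0 : p ≠ 0 := by linarith
  let V : EE n → WithLp 2 (ℝ × EE n) := fun x => WithLp.toLp 2 (√ε * u x, gradient u x)
  let B : EE n → WithLp 2 (ℝ × EE n) := fun x => WithLp.toLp 2 (√ε * φ x, gradient φ x)
  have hse : √ε * √ε = ε := Real.mul_self_sqrt hε.le
  have hV : ContinuousOn V K := (WithLp.prod_continuous_toLp 2 ℝ (EE n)).comp_continuousOn ((continuousOn_const.mul G.cont.continuousOn).prodMk ((gradient_contOn G.hΩ G.c1).mono hKΩ))
  have hB : Continuous B := (WithLp.prod_continuous_toLp 2 ℝ (EE n)).comp ((continuous_const.mul hφ.continuous).prodMk (gradient_cont hφ))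
  have hnorm : ∀ (a : ℝ) (q : EE n), (ε * a ^ 2 + ‖q‖ ^ 2) ^ (p / 2) = ‖(WithLp.toLp 2 (√ε * a, q) : WithLp 2 (ℝ × EE n))‖ ^ p := by
    intro a q
    rw [show p = 2 * (p / 2) by ring, Real.rpow_mul (norm_nonneg _)]
    norm_num [WithLp.prod_norm_sq_eq_of_L2]
    rw [mul_pow, sq_abs, sq_abs, Real.sq_sqrt hε.le]
  have hVn : ∀ x, √(ε * u x ^ 2 + ‖gradient u x‖ ^ 2) = ‖V x‖ := fun x => by
    rw [Real.sqrt_eq_iff_mul_self_eq (by positivity) (norm_nonneg _), ← sq, WithLp.prod_norm_sq_eq_of_L2]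
    simp only [V, WithLp.fst, WithLp.snd]
    rw [Real.norm_eq_abs, sq_abs, mul_pow, Real.sq_sqrt hε.le]
  let N : WithLp 2 (ℝ × EE n) → ℝ := fun z => ‖z‖ ^ p
  have hN : ContDiff ℝ 1 N := contDiff_norm_rpow hp
  let F : ℝ → EE n → ℝ := fun t x => N (V x + t • B x) * rho n x
  let F' : ℝ → EE n → ℝ := fun t x => fderiv ℝ N (V x + t • B x) (B x) * rho n x
  have hud : ∀ x ∈ K, DifferentiableAt ℝ u x := fun x hx => (G.c1.contDiffAt (G.hΩ.mem_nhds (hKΩ hx))).differentiableAt one_ne_zero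
  have hjd : ∀ t : ℝ, ∀ x ∈ K, jd ε p (fun y => u y + t * φ y) x * rho n x = F t x := by
    intro t x hx
    simp only [F, N]
    unfold jd
    rw [gradient_add_smul t (hud x hx) (hφ.differentiable one_ne_zero x), hnorm]
    congr 3
    simp only [V, B, ← WithLp.toLp_smul, ← WithLp.toLp_add]
    congr 1
    simp only [Prod.smul_mk, Prod.mk_add_mk, smul_eq_mul]
    congr 1; ring
  have hFc : ∀ t, ContinuousOn (F t) K := fun t => (hN.continuous.comp_continuousOn (hV.add (hB.const_smul t).continuousOn)).mul (rho_cont n).continuousOn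
  have hder : HasDerivAt (fun t => ∫ x in K, F t x) (∫ x in K, F' 0 x) 0 := by
    refine hasDerivAt_integral_compact hK one_pos (fun t _ => hFc t) ?_ fun t _ x _ => ?_
    · have hV2 : ContinuousOn (fun z : ℝ × EE n => V z.2) (Icc (0 - 1) (0 + 1) ×ˢ K) := hV.comp continuousOn_snd fun z hz => hz.2
      have hB2 : Continuous fun z : ℝ × EE n => B z.2 := hB.comp continuous_snd
      exact (((hN.continuous_fderiv one_ne_zero).comp_continuousOn (hV2.add (continuous_fst.smul hB2).continuousOn)).clm_apply hB2.continuousOn).mul ((rho_cont n).comp continuous_snd).continuousOn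
    · have h1 : HasDerivAt (fun t : ℝ => V x + t • B x) (B x) t := by simpa using ((hasDerivAt_id t).smul_const (B x)).const_add (V x)
      exact ((hN.differentiable one_ne_zero _).hasFDerivAt.comp_hasDerivAt t h1).mul_const _
  have hF0 : ∀ x, F' 0 x = p * (√(ε * u x ^ 2 + ‖gradient u x‖ ^ 2) ^ (p - 2) * (ε * u x * φ x + ⟪gradient u x, gradient φ x⟫) * rho n x) := by
    intro x
    simp only [F', zero_smul, add_zero, N]
    rw [(hasFDerivAt_norm_rpow (V x) hp).fderiv, hVn]
    simp only [ContinuousLinearMap.smul_apply, innerSL_apply_apply, smul_eq_mul, WithLp.prod_inner_apply, V, B]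
    simp only [RCLike.inner_apply, conj_trivial]
    rw [show √ε * φ x * (√ε * u x) = (√ε * √ε) * (u x * φ x) by ring, hse]
    ring
  have hF'c : ContinuousOn (F' 0) K := by
    have : ContinuousOn (fun x => V x + (0 : ℝ) • B x) K := by simpa using hV
    exact (((hN.continuous_fderiv one_ne_zero).comp_continuousOn this).clm_apply hB.continuousOn).mul (rho_cont n).continuousOn
  refine ⟨(hF'c.const_smul p⁻¹).congr fun x _ => ?_, ?_⟩
  · show _ = p⁻¹ • F' 0 x
    rw [hF0, smul_eq_mul, inv_mul_cancel_left₀ hp0]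
  suffices h : 0 ≤ ∫ x in K, F' 0 x by
    simp_rw [hF0] at h
    rw [integral_const_mul] at h
    exact nonneg_of_mul_nonneg_right h (by linarith)
  have hφz : ∀ x ∉ K, φ x = 0 := fun x hx => image_eq_zero_of_notMem_tsupport fun h => hx (hφK h)
  have hKm := hK.isClosed.measurableSet
  have hcs : ∀ v : EE n → ℝ, Continuous v → (∀ x ∉ Ω, v x = 0) → Integrable fun x => v x ^ p * rho n x := fun v hv hv0 => by
    refine Continuous.integrable_of_hasCompactSupport ((Real.continuous_rpow_const (by linarith)).comp hv |>.mul (rho_cont n)) (hasCompactSupport_of_zero_off G.hΩb fun x hx => ?_)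
    simp [hv0 x hx, Real.zero_rpow hp0]
  have hmain : ∀ t : ℝ, 0 ≤ t → ∫ x in K, F 0 x ≤ ∫ x in K, F t x := by
    intro t ht
    let v : EE n → ℝ := fun y => u y + t * φ y
    have hv0 : ∀ x, 0 ≤ v x := fun x => add_nonneg (G.nonneg x) (mul_nonneg ht (hφ0 x))
    have hvc : Continuous v := G.cont.add (continuous_const.mul hφ.continuous)
    have hvΩ : ∀ x ∉ Ω, v x = 0 := fun x hx => by simp [v, G.zero x hx, hφz x fun h => hx (hKΩ h)]
    have hoff : ∀ x ∈ Kᶜ, jd ε p v x * rho n x = jd ε p u x * rho n x := by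
      intro x hx
      have : v =ᶠ[𝓝 x] u := by
        filter_upwards [hK.isClosed.isOpen_compl.mem_nhds hx] with y hy
        simp [v, hφz y hy]
      unfold jd
      rw [gradient_congr this, this.eq_of_nhds]
    have hz : ∀ w : EE n → ℝ, (∀ x, 0 ≤ w x) → ∀ x ∉ {x | 0 < w x}, jd ε p w x * rho n x = 0 := fun w hw x hx => by rw [jd_zero hp hw (le_antisymm (not_lt.1 hx) (hw x)), zero_mul]
    have hui : Integrable fun x => jd ε p u x * rho n x := by
      rw [← integrableOn_univ]
      exact G.int.of_forall_sdiff_eq_zero MeasurableSet.univ fun x hx => hz u G.nonneg x hx.2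
    have hvi : Integrable fun x => jd ε p v x * rho n x := by
      rw [← integrableOn_univ, ← union_compl_self K]
      exact (((hFc t).integrableOn_compact hK).congr_fun (fun x hx => (hjd t x hx).symm) hKm).union (hui.integrableOn.congr_fun (fun x hx => (hoff x hx).symm) hKm.compl)
    have hm := G.min v hvc hv0 hvΩ ((G.c1.add (hφ.contDiffOn.const_smul t)).mono fun x hx => by
      by_contra h
      have hx : 0 < v x := hx
      rw [hvΩ x h] at hx; exact lt_irrefl _ hx) hvi.integrableOn
    rw [setIntegral_eq_integral_of_forall_compl_eq_zero (hz v hv0), ← integral_add_compl hKm hvi, setIntegral_congr_fun hKm (hjd t), setIntegral_congr_fun hKm.compl hoff] at hm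
    have hval := G.val
    rw [setIntegral_eq_integral_of_forall_compl_eq_zero (hz u G.nonneg), ← integral_add_compl hKm hui] at hval
    have h0 : ∫ x in K, jd ε p u x * rho n x = ∫ x in K, F 0 x := setIntegral_congr_fun hKm fun x hx => by rw [← hjd 0 x hx]; simp
    have hge : 1 ≤ ∫ x, v x ^ p * rho n x := by
      rw [← G.mass]
      refine integral_mono (hcs u G.cont G.zero) (hcs v hvc hvΩ) fun x => ?_
      exact mul_le_mul_of_nonneg_right (Real.rpow_le_rpow (G.nonneg x) (le_add_of_nonneg_right (mul_nonneg ht (hφ0 x))) (by linarith)) (rho_pos n x).le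
    have := G.hlam
    nlinarith
  refine ge_of_tendsto hder.tendsto_slope_zero_right ?_
  filter_upwards [self_mem_nhdsWithin] with t ht
  have ht : 0 < t := ht
  rw [zero_add, smul_eq_mul]
  exact mul_nonneg (by positivity) (sub_nonneg.2 (hmain t ht.le))
end Good
lemma cacc_pt {p ε a u T ψ g s e : ℝ} (hp : 1 < p) (hε : 0 < ε) (hu : 0 ≤ u) (hua : u < a) (hψ : 0 ≤ ψ) (hg : 0 ≤ g) (he : 0 ≤ e) (hT : T = √(ε * u ^ 2 + g ^ 2)) (hs : s ≤ g * e) : T ^ (p - 2) * (ε * u * (ψ ^ p * a ^ (1 - p)) + (a ^ (1 - p) * (p * ψ ^ (p - 1)) * s - (p - 1) * (ψ ^ p * a ^ (-p)) * g ^ 2)) ≤ -(p - 1) * (T * ψ / a) ^ p + p * (T * ψ / a) ^ (p - 1) * (√ε * ψ + e) := by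
  have ha : 0 < a := hu.trans_lt hua
  have hT2 : T ^ 2 = ε * u ^ 2 + g ^ 2 := by rw [hT, Real.sq_sqrt (by positivity)]
  have hT0 : 0 ≤ T := hT ▸ Real.sqrt_nonneg _
  have hgT : g ≤ T := abs_le_of_sq_le_sq' (by nlinarith [mul_nonneg hε.le (sq_nonneg u)]) hT0 |>.2
  have hse : √ε * √ε = ε := Real.mul_self_sqrt hε.le
  have hse0 : 0 < √ε := Real.sqrt_pos.2 hε
  have huT : √ε * u ≤ T := abs_le_of_sq_le_sq' (by rw [mul_pow, Real.sq_sqrt hε.le]; nlinarith) hT0 |>.2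
  rcases hT0.eq_or_lt with h0 | hTp
  · rw [← h0] at hgT huT ⊢
    have hg0 : g = 0 := le_antisymm hgT hg
    have hu0 : u = 0 := by nlinarith
    have hs0 : s ≤ 0 := by rw [hg0] at hs; linarith
    rw [hg0, hu0, zero_mul, zero_div, Real.zero_rpow (by linarith : p ≠ 0), Real.zero_rpow (by linarith : p - 1 ≠ 0)]
    have : 0 ≤ (0 : ℝ) ^ (p - 2) * (a ^ (1 - p) * (p * ψ ^ (p - 1))) := by positivity
    nlinarith
  rcases hψ.eq_or_lt with h0 | hψp
  · rw [← h0, mul_zero, zero_div, Real.zero_rpow (by linarith : p ≠ 0), Real.zero_rpow (by linarith : p - 1 ≠ 0)]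
    simp
  have hX : 0 < T * ψ / a := by positivity
  set M := T ^ p * ψ ^ p * a ^ (-p) with hM
  have hMp : 0 < M := by positivity
  have e1 : (T * ψ / a) ^ p = M := by rw [Real.div_rpow (by positivity) ha.le, Real.mul_rpow hT0 hψ, hM, Real.rpow_neg ha.le]; rfl
  have e2 : (T * ψ / a) ^ (p - 1) = M * a / (T * ψ) := by rw [Real.rpow_sub_one hX.ne', e1]; field_simp
  have e3 : a ^ (1 - p) = a * a ^ (-p) := by rw [show 1 - p = -p + 1 by ring, Real.rpow_add_one ha.ne']; ring
  have e4 : T ^ (p - 2) = T ^ p / T ^ 2 := by rw [Real.rpow_sub hTp]; norm_num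
  rw [e1, e2, e3, e4, Real.rpow_sub_one hψp.ne']
  have key : a * (ε * u * ψ) + p * a * s + (p - 1) * (ε * u ^ 2) * ψ ≤ p * T * a * (√ε * ψ + e) := by
    have k1 : ε * u ≤ √ε * T := by
      have := mul_le_mul_of_nonneg_left huT hse0.le
      rwa [← mul_assoc, hse] at this
    have k2 : a * (ε * u * ψ) ≤ a * (√ε * T * ψ) := by gcongr
    have k3 : ε * u ^ 2 ≤ √ε * T * a := by
      calc ε * u ^ 2 = ε * u * u := by ring
        _ ≤ √ε * T * a := mul_le_mul k1 hua.le hu (by positivity)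
    have k4 : (p - 1) * (ε * u ^ 2) * ψ ≤ (p - 1) * (√ε * T * a) * ψ := mul_le_mul_of_nonneg_right (mul_le_mul_of_nonneg_left k3 (by linarith)) hψ
    have k5 : p * a * s ≤ p * a * (T * e) := mul_le_mul_of_nonneg_left (hs.trans (mul_le_mul_of_nonneg_right hgT he)) (by positivity)
    nlinarith
  have hL : T ^ p / T ^ 2 * (ε * u * (ψ ^ p * (a * a ^ (-p))) + (a * a ^ (-p) * (p * (ψ ^ p / ψ)) * s - (p - 1) * (ψ ^ p * a ^ (-p)) * g ^ 2)) = M / (T ^ 2 * ψ) * (a * (ε * u * ψ) + p * a * s - (p - 1) * g ^ 2 * ψ) := by rw [hM]; field_simp; ring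
  have hR : -(p - 1) * M + p * (M * a / (T * ψ)) * (√ε * ψ + e) = M / (T ^ 2 * ψ) * (p * T * a * (√ε * ψ + e) - (p - 1) * T ^ 2 * ψ) := by field_simp; ring
  rw [hL, hR]
  refine mul_le_mul_of_nonneg_left ?_ (by positivity)
  rw [hT2]; linarith
lemma young_pt {p : ℝ} (hp : 1 < p) : ∃ C, 0 < C ∧ ∀ X Y : ℝ, 0 ≤ X → 0 ≤ Y → p * X ^ (p - 1) * Y ≤ (p - 1) / 2 * X ^ p + C * Y ^ p := by
  have hp1 : 0 < p - 1 := by linarith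
  refine ⟨p * (2 * p / (p - 1)) ^ (p - 1), by positivity, fun X Y hX hY => ?_⟩
  have hXp : ∀ {Z : ℝ}, 0 ≤ Z → Z ^ p = Z ^ (p - 1) * Z := fun {Z} hZ => by
    rcases hZ.eq_or_lt with h | h
    · rw [← h]; simp [Real.zero_rpow (by linarith : p ≠ 0)]
    · rw [Real.rpow_sub_one h.ne']; field_simp
  have hn : 0 ≤ X ^ (p - 1) := by positivity
  rcases le_total Y ((p - 1) / (2 * p) * X) with h | h
  · have : p * X ^ (p - 1) * Y ≤ p * X ^ (p - 1) * ((p - 1) / (2 * p) * X) := by gcongr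
    have e : p * X ^ (p - 1) * ((p - 1) / (2 * p) * X) = (p - 1) / 2 * X ^ p := by rw [hXp hX]; field_simp
    have : 0 ≤ p * (2 * p / (p - 1)) ^ (p - 1) * Y ^ p := by positivity
    linarith
  · have h2 : X ≤ 2 * p / (p - 1) * Y := by
      calc X = 2 * p / (p - 1) * ((p - 1) / (2 * p) * X) := by field_simp
        _ ≤ _ := by gcongr
    have h3 : X ^ (p - 1) ≤ (2 * p / (p - 1)) ^ (p - 1) * Y ^ (p - 1) := by
      rw [← Real.mul_rpow (by positivity) hY]
      exact Real.rpow_le_rpow hX h2 hp1.le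
    have h4 : p * X ^ (p - 1) * Y ≤ p * ((2 * p / (p - 1)) ^ (p - 1) * Y ^ (p - 1)) * Y := by gcongr
    have : 0 ≤ (p - 1) / 2 * X ^ p := by positivity
    rw [hXp hY]; linarith
namespace Good
variable {n : ℕ} {p ε lam : ℝ} {Ω : Set (EE n)} {u : EE n → ℝ}
lemma cacc (G : Good n p ε lam Ω u) {ψ : EE n → ℝ} (hψ : ContDiff ℝ 1 ψ) (hψ0 : ∀ x, 0 ≤ ψ x) (hψc : HasCompactSupport ψ) (hψΩ : tsupport ψ ⊆ Ω) : ∃ C, ∀ δ > 0, ∫ x in tsupport ψ, ‖gradient u x‖ * ψ x / (u x + δ) ≤ C := by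
  have hp := G.hp
  have hε := G.hε
  set K := tsupport ψ with hKdef
  have hK : IsCompact K := hψc
  have hKm := hK.isClosed.measurableSet
  obtain ⟨C0, hC0, hY⟩ := young_pt hp
  obtain ⟨r, hr, hrK⟩ : ∃ r, 0 < r ∧ ∀ x ∈ K, r ≤ rho n x := by
    rcases K.eq_empty_or_nonempty with h | h
    · exact ⟨1, one_pos, by simp [h]⟩
    · obtain ⟨x, _, hx⟩ := hK.exists_isMinOn h (rho_cont n).continuousOn
      exact ⟨rho n x, rho_pos n x, fun y hy => hx hy⟩
  have hgc : ContinuousOn (gradient u) K := (gradient_contOn G.hΩ G.c1).mono hψΩ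
  have hψg := gradient_cont hψ
  let T : EE n → ℝ := fun x => √(ε * u x ^ 2 + ‖gradient u x‖ ^ 2)
  let Y : EE n → ℝ := fun x => √ε * ψ x + ‖gradient ψ x‖
  have hTc : ContinuousOn T K := ((continuousOn_const.mul (G.cont.continuousOn.pow 2)).add (hgc.norm.pow 2)).sqrt
  have hYc : Continuous Y := (continuous_const.mul hψ.continuous).add hψg.norm
  have hrp : ∀ q : ℝ, 0 ≤ q → Continuous fun t : ℝ => t ^ q := fun q hq => Real.continuous_rpow_const hq
  have hI : ∀ {f : EE n → ℝ}, ContinuousOn f K → IntegrableOn f K := fun hf => hf.integrableOn_compact hK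
  have hYp : ContinuousOn (fun x => C0 * Y x ^ p * rho n x) K := ((continuous_const.mul ((hrp p (by linarith)).comp hYc)).mul (rho_cont n)).continuousOn
  refine ⟨∫ x in K, (1 + r⁻¹ * (2 / (p - 1)) * (C0 * Y x ^ p * rho n x)), fun δ hδ => ?_⟩
  have hup : ∀ x, 0 < u x + δ := fun x => by have := G.nonneg x; linarith
  let X : EE n → ℝ := fun x => T x * ψ x / (u x + δ)
  have hX0 : ∀ x, 0 ≤ X x := fun x => div_nonneg (mul_nonneg (Real.sqrt_nonneg _) (hψ0 x)) (hup x).le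
  have hXc : ContinuousOn X K := (hTc.mul hψ.continuous.continuousOn).div (G.cont.add continuous_const).continuousOn fun x _ => (hup x).ne'
  have hXp : ContinuousOn (fun x => X x ^ p * rho n x) K := ((hrp p (by linarith)).comp_continuousOn hXc).mul (rho_cont n).continuousOn
  let φ : EE n → ℝ := fun x => ψ x ^ p * (u x + δ) ^ (1 - p)
  have hφK : tsupport φ ⊆ K := by
    refine closure_minimal (fun x hx => subset_tsupport ψ ?_) hK.isClosed
    intro h
    exact hx (by simp [φ, h, Real.zero_rpow (by linarith : p ≠ 0)])
  have hfc : ContDiff ℝ 1 fun t : ℝ => t ^ p := Real.contDiff_rpow_const_of_le (n := 1) (by push_cast; linarith)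
  have hu1 : ∀ x ∈ K, ContDiffAt ℝ 1 u x := fun x hx => G.c1.contDiffAt (G.hΩ.mem_nhds (hψΩ hx))
  have hφ : ContDiff ℝ 1 φ := contDiff_of_tsup fun x hx => (hfc.comp hψ).contDiffAt.mul (((hu1 x (hφK hx)).add contDiffAt_const).rpow_const_of_ne (hup x).ne')
  have hgφ : ∀ x ∈ K, gradient φ x = ψ x ^ p • ((1 - p) * (u x + δ) ^ (-p)) • gradient u x + (u x + δ) ^ (1 - p) • (p * ψ x ^ (p - 1)) • gradient ψ x := by
    intro x hx
    have d1 : HasDerivAt (fun t : ℝ => t ^ p) (p * ψ x ^ (p - 1)) (ψ x) := Real.hasDerivAt_rpow_const (Or.inr hp.le)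
    have d2 : HasDerivAt (fun t : ℝ => (t + δ) ^ (1 - p)) ((1 - p) * (u x + δ) ^ (-p)) (u x) := by
      refine (((hasDerivAt_id (u x)).add_const δ).rpow_const (p := 1 - p) (Or.inl (hup x).ne')).congr_deriv ?_
      simp
    have du := (hu1 x hx).differentiableAt one_ne_zero
    have dψ := hψ.differentiable one_ne_zero x
    have e1 : gradient (fun y => ψ y ^ p) x = _ := gradient_comp d1 dψ
    have e2 : gradient (fun y => (u y + δ) ^ (1 - p)) x = _ := gradient_comp (f := fun t : ℝ => (t + δ) ^ (1 - p)) d2 du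
    have := gradient_mul (f := fun y => ψ y ^ p) (g := fun y => (u y + δ) ^ (1 - p)) (x := x) (d1.differentiableAt.comp x dψ) (DifferentiableAt.comp x (g := fun t : ℝ => (t + δ) ^ (1 - p)) d2.differentiableAt du)
    rw [e1, e2] at this
    exact this
  obtain ⟨hIc, hI0⟩ := G.first_var hK hψΩ hφ (fun x => mul_nonneg (Real.rpow_nonneg (hψ0 x) p) (Real.rpow_nonneg (hup x).le _)) hφK
  have hpt : ∀ x ∈ K, T x ^ (p - 2) * (ε * u x * φ x + ⟪gradient u x, gradient φ x⟫) * rho n x ≤ C0 * Y x ^ p * rho n x - (p - 1) / 2 * (X x ^ p * rho n x) := by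
    intro x hx
    have h1 := cacc_pt (a := u x + δ) (T := T x) (ψ := ψ x) hp hε (G.nonneg x) (by linarith) (hψ0 x) (norm_nonneg (gradient u x)) (norm_nonneg (gradient ψ x)) rfl (real_inner_le_norm (gradient u x) (gradient ψ x))
    have h2 := hY (X x) (Y x) (hX0 x) (add_nonneg (mul_nonneg (Real.sqrt_nonneg _) (hψ0 x)) (norm_nonneg _))
    have h3 : ⟪gradient u x, gradient φ x⟫ = (u x + δ) ^ (1 - p) * (p * ψ x ^ (p - 1)) * ⟪gradient u x, gradient ψ x⟫ - (p - 1) * (ψ x ^ p * (u x + δ) ^ (-p)) * ‖gradient u x‖ ^ 2 := by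
      rw [hgφ x hx, inner_add_right]
      simp only [inner_smul_right, real_inner_self_eq_norm_sq]
      ring
    rw [← h3] at h1
    have h4 : T x ^ (p - 2) * (ε * u x * φ x + ⟪gradient u x, gradient φ x⟫) ≤ C0 * Y x ^ p - (p - 1) / 2 * X x ^ p := by
      refine h1.trans ?_
      change -(p - 1) * X x ^ p + p * X x ^ (p - 1) * Y x ≤ _
      linarith
    have := mul_le_mul_of_nonneg_right h4 (rho_pos n x).le
    linarith
  have hint : (p - 1) / 2 * ∫ x in K, X x ^ p * rho n x ≤ ∫ x in K, C0 * Y x ^ p * rho n x := by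
    have := hI0.trans (setIntegral_mono_on (hI hIc) ((hI hYp).sub ((hI hXp).const_mul ((p - 1) / 2))) hKm hpt)
    have e : ∫ x in K, (C0 * Y x ^ p * rho n x - (p - 1) / 2 * (X x ^ p * rho n x)) = _ := integral_sub (hI hYp) ((hI hXp).const_mul _)
    simp only [Pi.sub_apply] at this
    rw [e, integral_const_mul] at this
    linarith
  have hz : ContinuousOn (fun x => ‖gradient u x‖ * ψ x / (u x + δ)) K := (hgc.norm.mul hψ.continuous.continuousOn).div (G.cont.add continuous_const).continuousOn fun x _ => (hup x).ne'
  have hz1 : ∫ x in K, ‖gradient u x‖ * ψ x / (u x + δ) ≤ ∫ x in K, (1 + r⁻¹ * (X x ^ p * rho n x)) := by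
    refine setIntegral_mono_on (hI hz) (hI (continuousOn_const.add (continuousOn_const.mul hXp))) hKm fun x hx => ?_
    have h1 : ‖gradient u x‖ * ψ x / (u x + δ) ≤ X x := by
      have : ‖gradient u x‖ ≤ T x := Real.le_sqrt_of_sq_le (by nlinarith [mul_nonneg hε.le (sq_nonneg (u x))])
      exact div_le_div_of_nonneg_right (mul_le_mul_of_nonneg_right this (hψ0 x)) (hup x).le
    have h2 : X x ≤ 1 + X x ^ p := by
      have hn : 0 ≤ X x ^ p := Real.rpow_nonneg (hX0 x) p
      rcases le_total (X x) 1 with h | h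
      · linarith
      · have := Real.rpow_le_rpow_of_exponent_le h hp.le
        rw [Real.rpow_one] at this; linarith
    have h3 : X x ^ p ≤ r⁻¹ * (X x ^ p * rho n x) := by
      rw [le_inv_mul_iff₀ hr, mul_comm]
      exact mul_le_mul_of_nonneg_left (hrK x hx) (Real.rpow_nonneg (hX0 x) p)
    linarith
  refine hz1.trans ?_
  have hone : IntegrableOn (fun _ : EE n => (1 : ℝ)) K := hI continuousOn_const
  have a1 : ∫ x in K, (1 + r⁻¹ * (X x ^ p * rho n x)) = _ := integral_add hone ((hI hXp).const_mul r⁻¹)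
  have a2 : ∫ x in K, (1 + r⁻¹ * (2 / (p - 1)) * (C0 * Y x ^ p * rho n x)) = _ := integral_add hone ((hI hYp).const_mul _)
  rw [a1, a2, integral_const_mul, integral_const_mul, mul_assoc]
  have hp1 : 0 < p - 1 := by linarith
  have : ∫ x in K, X x ^ p * rho n x ≤ 2 / (p - 1) * ∫ x in K, C0 * Y x ^ p * rho n x := by rw [div_mul_eq_mul_div, le_div_iff₀ hp1]; linarith
  gcongr
end Good
lemma exists_cut {n : ℕ} {Ω S : Set (EE n)} (hΩ : IsOpen Ω) (hS : IsCompact S) (hSΩ : S ⊆ Ω) : ∃ ψ : EE n → ℝ, ContDiff ℝ 1 ψ ∧ (∀ x, 0 ≤ ψ x) ∧ HasCompactSupport ψ ∧ tsupport ψ ⊆ Ω ∧ ∀ x ∈ S, ψ x = 1 := by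
  obtain ⟨r, hr, hrS⟩ := hS.exists_cthickening_subset_open hΩ hSΩ
  obtain ⟨f, hf, hf01, hfs, hf1⟩ := exists_contMDiff_support_eq_eq_one_iff (n := 1) (modelWithCornersSelf ℝ (EE n)) (isOpen_thickening (δ := r) (E := S)) hS.isClosed (self_subset_thickening hr S)
  have hts : tsupport f ⊆ cthickening r S := by unfold tsupport; rw [hfs]; exact closure_thickening_subset_cthickening r S
  refine ⟨f, contMDiff_iff_contDiff.1 hf, fun x => (hf01 (mem_range_self x)).1, (hS.cthickening).of_isClosed_subset (isClosed_tsupport f) hts, hts.trans hrS, fun x hx => (hf1 x).1 hx⟩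
namespace Good
variable {n : ℕ} {p ε lam : ℝ} {Ω : Set (EE n)} {u : EE n → ℝ}
lemma pos (G : Good n p ε lam Ω u) (hc : Convex ℝ Ω) : ∀ x ∈ Ω, 0 < u x := by
  intro z hz
  by_contra hzu
  set W := {x | 0 < u x} with hW
  have hWc : Convex ℝ W := by
    have := G.convPos
    simpa only [← G.eq_us hc] using this
  have hWo : IsOpen W := G.openU
  obtain ⟨y, hy⟩ := G.exists_pos
  have hint : interior (closure W) = W := by rw [hWc.interior_closure_eq_interior_of_nonempty_interior (by rw [hWo.interior_eq]; exact ⟨y, hy⟩), hWo.interior_eq]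
  obtain ⟨z', hz', hzW⟩ : ∃ z' ∈ Ω, z' ∉ closure W := by
    by_contra h
    push Not at h
    have := interior_maximal h G.hΩ hz
    rw [hint] at this
    exact hzu this
  obtain ⟨r1, hr1, hb1⟩ := Metric.nhds_basis_closedBall.mem_iff.1 ((G.hΩ.inter isClosed_closure.isOpen_compl).mem_nhds ⟨hz', hzW⟩)
  obtain ⟨r2, hr2, hb2⟩ := Metric.nhds_basis_closedBall.mem_iff.1 (hWo.mem_nhds hy)
  set r := Min.min r1 r2 with hr
  have hr0 : 0 < r := lt_min hr1 hr2
  set B := closedBall z' r with hB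
  have hBc : IsCompact B := isCompact_closedBall z' r
  have hB1 : B ⊆ Ω ∩ (closure W)ᶜ := (closedBall_subset_closedBall (min_le_left _ _)).trans hb1
  have hB2 : closedBall y r ⊆ W := (closedBall_subset_closedBall (min_le_right _ _)).trans hb2
  set h := y - z' with hh
  have hBh : ∀ x ∈ B, x + h ∈ closedBall y r := fun x hx => by
    rw [mem_closedBall, dist_eq_norm] at *
    rwa [hh, show x + (y - z') - y = x - z' by abel]
  set S := (fun q : ℝ × EE n => q.2 + q.1 • h) '' (Icc (0 : ℝ) 1 ×ˢ B) with hS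
  have hSc : IsCompact S := (isCompact_Icc.prod hBc).image (by fun_prop)
  have hSΩ : S ⊆ Ω := by
    rintro _ ⟨⟨t, x⟩, ⟨ht, hx⟩, rfl⟩
    exact hc.add_smul_mem (hB1 hx).1 (G.subU (hB2 (hBh x hx))) ht
  obtain ⟨ψ, hψ, hψ0, hψc, hψΩ, hψ1⟩ := exists_cut G.hΩ hSc hSΩ
  obtain ⟨C, hC⟩ := G.cacc hψ hψ0 hψc hψΩ
  obtain ⟨y1, hy1, hmin⟩ := (isCompact_closedBall y r).exists_isMinOn ⟨y, mem_closedBall_self hr0.le⟩ G.cont.continuousOn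
  have hcp : 0 < u y1 := hB2 hy1
  set vB := volume.real B with hvB
  have hvp : 0 < vB := ENNReal.toReal_pos (measure_closedBall_pos volume z' hr0).ne' hBc.measure_ne_top
  set N := (‖h‖ * C + 1) / vB with hN
  set δ := u y1 * exp (-N) with hδ
  have hδ0 : 0 < δ := by positivity
  have hup : ∀ x, 0 < u x + δ := fun x => by have := G.nonneg x; linarith
  have hlc : Continuous fun x => log (u x + δ) := (G.cont.add continuous_const).log fun x => (hup x).ne'
  let F : ℝ → EE n → ℝ := fun t x => log (u (x + t • h) + δ)
  let F' : ℝ → EE n → ℝ := fun t x => ⟪gradient u (x + t • h), h⟫ / (u (x + t • h) + δ)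
  have hFu : Continuous (Function.uncurry F) := by
    have : Continuous fun q : ℝ × EE n => q.2 + q.1 • h := by fun_prop
    exact hlc.comp this
  have hmc : Continuous fun t => ∫ x in B, F t x := continuous_parametric_integral_of_continuous hFu hBc
  have hSm : ∀ t ∈ Icc (0 : ℝ) 1, ∀ x ∈ B, x + t • h ∈ S := fun t ht x hx => ⟨(t, x), ⟨ht, hx⟩, rfl⟩
  have hF'c : ContinuousOn (Function.uncurry F') (Icc (0 : ℝ) 1 ×ˢ B) := by
    have c0 : Continuous fun q : ℝ × EE n => q.2 + q.1 • h := by fun_prop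
    have c1 : ContinuousOn (fun q : ℝ × EE n => gradient u (q.2 + q.1 • h)) (Icc (0 : ℝ) 1 ×ˢ B) := (gradient_contOn G.hΩ G.c1).comp c0.continuousOn fun q hq => hSΩ (hSm _ hq.1 _ hq.2)
    exact (c1.inner continuousOn_const).div ((G.cont.comp c0).add continuous_const).continuousOn fun q _ => (hup _).ne'
  have hder : ∀ t ∈ Ioo (0 : ℝ) 1, HasDerivAt (fun t => ∫ x in B, F t x) (∫ x in B, F' t x) t := by
    intro t ht
    have hsub : Icc (t - Min.min t (1 - t)) (t + Min.min t (1 - t)) ⊆ Icc (0 : ℝ) 1 := fun s hs => ⟨by linarith [hs.1, min_le_left t (1 - t)], by linarith [hs.2, min_le_right t (1 - t)]⟩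
    refine hasDerivAt_integral_compact hBc (lt_min ht.1 (by linarith [ht.2])) (fun s _ => (hFu.comp (Continuous.prodMk_right s)).continuousOn) (hF'c.mono (prod_mono hsub subset_rfl)) fun s hs x hx => ?_
    have hsI := hsub (Ioo_subset_Icc_self hs)
    have hd := (G.c1.contDiffAt (G.hΩ.mem_nhds (hSΩ (hSm s hsI x hx)))).differentiableAt one_ne_zero
    have h1 : HasDerivAt (fun t : ℝ => x + t • h) h s := by simpa using ((hasDerivAt_id s).smul_const h).const_add x
    have h2 := hd.hasFDerivAt.comp_hasDerivAt s h1
    refine ((h2.add_const δ).log (hup _).ne').congr_deriv ?_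
    simp only [F', inner_gradient_left]; rfl
  obtain ⟨t, ht, hslope⟩ := exists_hasDerivAt_eq_slope _ _ zero_lt_one hmc.continuousOn hder
  have hbd : ∫ x in B, F' t x ≤ ‖h‖ * C := by
    let f : EE n → ℝ := fun x => ‖gradient u x‖ * ψ x / (u x + δ)
    have hf0 : ∀ x, 0 ≤ f x := fun x => div_nonneg (mul_nonneg (norm_nonneg _) (hψ0 x)) (hup x).le
    have hfz : ∀ x ∉ tsupport ψ, f x = 0 := fun x hx => by simp [f, image_eq_zero_of_notMem_tsupport hx]
    have hfi : Integrable f := by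
      rw [← integrableOn_univ]
      refine (ContinuousOn.integrableOn_compact hψc ?_).of_forall_sdiff_eq_zero MeasurableSet.univ fun x hx => hfz x hx.2
      exact (((gradient_contOn G.hΩ G.c1).mono hψΩ).norm.mul hψ.continuous.continuousOn).div (G.cont.add continuous_const).continuousOn fun x _ => (hup x).ne'
    have hfC : ∫ x, f x ≤ C := by rw [← setIntegral_eq_integral_of_forall_compl_eq_zero hfz]; exact hC δ hδ0
    have hfi' : Integrable fun x => ‖h‖ * f (x + t • h) := (hfi.comp_add_right (t • h)).const_mul _
    have htI := Ioo_subset_Icc_self ht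
    calc ∫ x in B, F' t x ≤ ∫ x in B, ‖h‖ * f (x + t • h) := by
          refine setIntegral_mono_on ?_ hfi'.integrableOn hBc.isClosed.measurableSet fun x hx => ?_
          · exact (hF'c.comp (Continuous.prodMk_right t).continuousOn fun x hx => ⟨htI, hx⟩).integrableOn_compact hBc
          · simp only [F', f]
            rw [hψ1 _ (hSm t htI x hx), mul_one, ← mul_div_assoc, mul_comm ‖h‖]
            exact div_le_div_of_nonneg_right (real_inner_le_norm _ _) (hup _).le
      _ ≤ ∫ x, ‖h‖ * f (x + t • h) := setIntegral_le_integral hfi' (Filter.Eventually.of_forall fun x => mul_nonneg (norm_nonneg _) (hf0 _))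
      _ = ‖h‖ * ∫ x, f x := by rw [integral_const_mul, integral_add_right_eq_self f]
      _ ≤ ‖h‖ * C := mul_le_mul_of_nonneg_left hfC (norm_nonneg _)
  have hm0 : ∫ x in B, F 0 x = vB * log δ := by
    rw [setIntegral_congr_fun (g := fun _ => log δ) hBc.isClosed.measurableSet fun x hx => ?_]
    · simp [hvB]
    · have hxu : u x = 0 := le_antisymm (not_lt.1 fun h => (hB1 hx).2 (subset_closure h)) (G.nonneg x)
      simp [F, hxu]
  have hm1 : vB * (log δ + N) ≤ ∫ x in B, F 1 x := by
    have : ∫ _ in B, (log δ + N) = vB * (log δ + N) := by simp [hvB]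
    rw [← this]
    refine setIntegral_mono_on (continuousOn_const.integrableOn_compact hBc) ((hFu.comp (Continuous.prodMk_right 1)).continuousOn.integrableOn_compact hBc) hBc.isClosed.measurableSet fun x hx => ?_
    have h1 : log δ + N = log (u y1) := by rw [hδ, Real.log_mul hcp.ne' (exp_pos _).ne', Real.log_exp]; ring
    have h2 : u y1 ≤ u (x + h) := hmin (hBh x hx)
    simp only [F, one_smul]
    rw [h1]
    exact Real.log_le_log hcp (by linarith)
  have hfin : vB * N = ‖h‖ * C + 1 := by rw [hN]; field_simp
  rw [sub_zero, div_one] at hslope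
  nlinarith
end Good
theorem log_concave_aux {n : ℕ} {p ε : ℝ} (hp : 1 < p) (hε : 0 < ε) {Ω : Set (EE n)} (hΩ : IsOpen Ω) (hΩb : IsBounded Ω) (hc : Convex ℝ Ω) {u : EE n → ℝ} (hu : IsNormalizedMinimizer n p ε Ω u) : ConcaveOn ℝ Ω fun x => Real.log (u x) := by
  have G := good_of_min hp hε hΩ hΩb hu
  have h1 := G.concLog
  have hs : {x | 0 < us (Ω.indicator u) x} = Ω := (G.pos_subset hc).antisymm fun x hx => (G.pos hc x hx).trans_le (G.u_le_us x)
  rw [hs] at h1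
  refine h1.congr fun x hx => ?_
  simp only
  rw [← G.eq_us hc x, indicator_of_mem hx]
lemma convex_inner {n : ℕ} {Ω : Set (EE n)} (hΩ : IsOpen Ω) (hc : Convex ℝ Ω) (ν : ℝ) (hν : 0 < ν) : Convex ℝ {x ∈ Ω | ν < infDist x (frontier Ω)} := by
  rcases (frontier Ω).eq_empty_or_nonempty with he | hne
  · have : {x ∈ Ω | ν < infDist x (frontier Ω)} = ∅ := by ext x; simp [he, infDist_empty, hν.le]
    rw [this]; exact convex_empty
  have key : ∀ x ∈ Ω, ∀ s : ℝ, s ≤ infDist x (frontier Ω) → ball x s ⊆ Ω := by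
    intro x hx s hs
    rcases le_or_gt s 0 with h0 | h0
    · rw [ball_eq_empty.2 h0]; exact empty_subset _
    refine IsPreconnected.subset_left_of_subset_union (v := (closure Ω)ᶜ) hΩ isClosed_closure.isOpen_compl (disjoint_compl_right.mono_left subset_closure) ?_ ⟨x, mem_ball_self h0, hx⟩ (convex_ball x s).isPreconnected
    intro y hy
    by_cases hyΩ : y ∈ Ω
    · exact Or.inl hyΩ
    right
    intro hcl
    have hf : y ∈ frontier Ω := by rw [frontier, hΩ.interior_eq]; exact ⟨hcl, hyΩ⟩
    have := infDist_le_dist_of_mem (x := x) hf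
    rw [mem_ball, dist_comm] at hy
    linarith
  intro x hx y hy a b ha hb hab
  refine ⟨hc hx.1 hy.1 ha hb hab, ?_⟩
  set s := Min.min (infDist x (frontier Ω)) (infDist y (frontier Ω)) with hs
  have hνs : ν < s := lt_min hx.2 hy.2
  refine hνs.trans_le ((le_infDist hne).2 fun z hz => ?_)
  by_contra hlt
  push Not at hlt
  have hzΩ : z ∉ Ω := fun h => by rw [frontier, hΩ.interior_eq] at hz; exact hz.2 h
  apply hzΩ
  set d := z - (a • x + b • y) with hd
  have hdn : ‖d‖ < s := by rw [hd, ← dist_eq_norm, dist_comm]; exact hlt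
  have h1 : x + d ∈ Ω := key x hx.1 s (min_le_left _ _) (by simpa [mem_ball, dist_eq_norm] using hdn)
  have h2 : y + d ∈ Ω := key y hy.1 s (min_le_right _ _) (by simpa [mem_ball, dist_eq_norm] using hdn)
  have := hc h1 h2 ha hb hab
  rwa [show a • (x + d) + b • (y + d) = z by rw [smul_add, smul_add, show a • x + a • d + (b • y + b • d) = a • x + b • y + (a + b) • d by rw [add_smul]; abel, hab, one_smul, hd]; abel] at this
/-- **Interior log-concavity of the regularized minimizers** (Proposition 4.9 of the
paper): there is `ν₀ > 0` so that for every `ν ∈ (0, ν₀)` and all sufficiently small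
`ε > 0`, each normalized minimizer `u_ε` of the `ε`-regularized problem has `log u_ε`
concave on `Ω_ν = {x ∈ Ω : dist(x, ∂Ω) > ν}`. -/
theorem regularized_minimizers_log_concave
    (n : ℕ) (hn : 2 ≤ n) (p : ℝ) (hp : 1 < p)
    (Ω : Set (EuclideanSpace ℝ (Fin n)))
    (hΩo : IsOpen Ω) (hΩb : IsBounded Ω) (hΩconv : Convex ℝ Ω) (hΩ2 : HasC2Boundary n Ω)
    (hsc : ∃ R : ℝ, 0 < R ∧ ∀ x ∈ frontier Ω, ∃ y : EuclideanSpace ℝ (Fin n),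
      dist x y = R ∧ closure Ω ⊆ Metric.closedBall y R) :
    ∃ ν₀ : ℝ, 0 < ν₀ ∧ ∀ ν : ℝ, 0 < ν → ν < ν₀ → ∃ ε₁ : ℝ, 0 < ε₁ ∧
      ∀ ε : ℝ, 0 < ε → ε < ε₁ →
        ∀ uε : EuclideanSpace ℝ (Fin n) → ℝ, IsNormalizedMinimizer n p ε Ω uε →
          ConcaveOn ℝ {x ∈ Ω | ν < Metric.infDist x (frontier Ω)}
            (fun x => Real.log (uε x)) := by
  refine ⟨1, one_pos, fun ν hν _ => ⟨1, one_pos, fun ε hε _ u hu => ?_⟩⟩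
  exact (log_concave_aux hp hε hΩo hΩb hΩconv hu).subset (fun x hx => hx.1)
    (convex_inner hΩo hΩconv ν hν)
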